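/- arXiv:1710.06131 — 3 statements merged into one kernel-verified Lean document; each statement's English description precedes it below -/
import Mathlib

section
/- Let q be a power of a prime p, let n = ps with gcd(p, s) = 1, and set T(x) = (x^s − 1)/(x − 1) ∈ F_q[x]. Then α ∈ F_{q^n} has minimal polynomial m_{σ_q,α}(x) = (x^n − 1)/(x − 1) if and only if α is T-free and Tr_{q^n/q^p}(α) has minimal polynomial (x^p − 1)/(x − 1). -/
open Polynomial

noncomputable section

/-- For `f = Σ aᵢ xⁱ ∈ F_q[x]` and `α` in an extension, `f ∘ α = Σ aᵢ α^(qⁱ)`. -/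
def frobComp {F K : Type*} [Field F] [Field K] [Algebra F K] (q : ℕ) (f : F[X]) (α : K) : K :=
  ∑ i ∈ Finset.range (f.natDegree + 1), algebraMap F K (f.coeff i) * α ^ q ^ i

/-- `g` is the minimal polynomial of `α` with respect to the Frobenius `σ_q`:
monic, annihilates `α` under `∘`, and has least degree with these properties. -/
def IsFrobMinimal {F K : Type*} [Field F] [Field K] [Algebra F K] (q : ℕ) (g : F[X]) (α : K) :
    Prop :=
  g.Monic ∧ frobComp q g α = 0 ∧
    ∀ h : F[X], h.Monic → frobComp q h α = 0 → g.natDegree ≤ h.natDegree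

/-- `α ∈ F_{qⁿ}` is `k`-normal over `F_q` if the `F_q`-span of `{α, α^q, …, α^(q^(n-1))}`
has dimension `n - k`. -/
def IskNormal (q n k : ℕ) (F : Type*) {K : Type*} [Field F] [Field K] [Algebra F K] (α : K) :
    Prop :=
  Module.finrank F (Submodule.span F (Set.range fun i : Fin n => α ^ q ^ (i : ℕ))) = n - k

/-- `α` is primitive: it generates the multiplicative group of the field. -/
def IsPrimitiveElt {K : Type*} [Field K] (α : K) : Prop :=
  ∀ b : K, b ≠ 0 → ∃ m : ℕ, α ^ m = b

/-- `α` is `m`-free: `gcd(m, (xⁿ - 1)/m_{σ_q,α}) = 1`. -/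
def IsPolyFree {F K : Type*} [Field F] [Field K] [Algebra F K] (q n : ℕ) (m : F[X]) (α : K) :
    Prop :=
  ∀ g : F[X], IsFrobMinimal q g α → IsCoprime m ((X ^ n - 1) /ₘ g)

/-- `W(t)`: number of squarefree divisors of a positive integer `t`. -/
def Wint (t : ℕ) : ℕ := Set.ncard {d : ℕ | d ∣ t ∧ Squarefree d}

/-- `W(g)`: number of monic divisors of the polynomial `g`. -/
def Wpoly {F : Type*} [Field F] (g : F[X]) : ℕ := Set.ncard {h : F[X] | h.Monic ∧ h ∣ g}

/-- `Φ_q(f)`: number of units in `F_q[x]/⟨f⟩`. -/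
def PhiPoly {F : Type*} [Field F] (f : F[X]) : ℕ := Nat.card (F[X] ⧸ Ideal.span {f})ˣ


def frobEnd (F K : Type*) [Field F] [Fintype F] [Field K] [Algebra F K] : Module.End F K :=
  (FiniteField.frobeniusAlgHom F K).toLinearMap

lemma frobEnd_pow {F K : Type*} [Field F] [Fintype F] [Field K] [Algebra F K] (i : ℕ) (α : K) :
    (frobEnd F K ^ i) α = α ^ Fintype.card F ^ i := by
  induction i with
  | zero => simp
  | succ k ih =>
    rw [pow_succ', Module.End.mul_apply, ih]
    change (α ^ Fintype.card F ^ k) ^ Fintype.card F = _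
    rw [← pow_mul, pow_succ]

lemma frobComp_eq {F K : Type*} [Field F] [Fintype F] [Field K] [Algebra F K] (f : F[X]) (α : K) :
    frobComp (Fintype.card F) f α = aeval (frobEnd F K) f α := by
  rw [aeval_eq_sum_range, LinearMap.sum_apply]
  unfold frobComp
  refine Finset.sum_congr rfl fun i _ => ?_
  rw [LinearMap.smul_apply, frobEnd_pow, Algebra.smul_def]

lemma isFrobMinimal_iff {F K : Type*} [Field F] [Fintype F] [Field K] [Algebra F K]
    (g : F[X]) (α : K) :
    IsFrobMinimal (Fintype.card F) g α ↔
      g.Monic ∧ ∀ h : F[X], aeval (frobEnd F K) h α = 0 ↔ g ∣ h := by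
  unfold IsFrobMinimal
  simp only [frobComp_eq]
  constructor
  · rintro ⟨hg, h0, hmin⟩
    refine ⟨hg, fun h => ⟨fun hh => ?_, ?_⟩⟩
    · rw [← modByMonic_eq_zero_iff_dvd hg]
      by_contra hne
      have hr : aeval (frobEnd F K) (h %ₘ g) α = 0 := by
        have := modByMonic_add_div h g
        rw [← this, mul_comm g, map_add, map_mul, LinearMap.add_apply, Module.End.mul_apply, h0,
          map_zero, add_zero] at hh
        exact hh
      have hm := monic_mul_leadingCoeff_inv hne
      have h2 := hmin _ hm (by
        rw [mul_comm, map_mul, Module.End.mul_apply, hr, map_zero])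
      rw [natDegree_mul_leadingCoeff_inv _ hne] at h2
      have h3 := degree_modByMonic_lt h hg
      have h4 := natDegree_lt_natDegree hne h3
      omega
    · rintro ⟨c, rfl⟩
      rw [mul_comm, map_mul, Module.End.mul_apply, h0, map_zero]
  · rintro ⟨hg, hh⟩
    refine ⟨hg, (hh g).2 dvd_rfl, fun h hm h0 => ?_⟩
    exact natDegree_le_of_dvd ((hh h).1 h0) hm.ne_zero

lemma exists_frobMinimal {F K : Type*} [Field F] [Fintype F] [Field K] [Algebra F K]
    (N : F[X]) (hN : N.Monic) (α : K) (h0 : aeval (frobEnd F K) N α = 0) :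
    ∃ g : F[X], IsFrobMinimal (Fintype.card F) g α := by
  classical
  have hex : ∃ d : ℕ, ∃ g : F[X], g.natDegree = d ∧ g.Monic ∧
      frobComp (Fintype.card F) g α = 0 := ⟨_, N, rfl, hN, by rwa [frobComp_eq]⟩
  obtain ⟨g, hd, hg, hg0⟩ := Nat.find_spec hex
  exact ⟨g, hg, hg0, fun h hm hh => hd ▸ Nat.find_min' hex ⟨h, rfl, hm, hh⟩⟩

lemma algebraMap_aeval_frobEnd {F E K : Type*} [Field F] [Fintype F] [Field E] [Field K]
    [Algebra F E] [Algebra E K] [Algebra F K] [IsScalarTower F E K] (h : F[X]) (β : E) :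
    algebraMap E K (aeval (frobEnd F E) h β) = aeval (frobEnd F K) h (algebraMap E K β) := by
  rw [← frobComp_eq, ← frobComp_eq]
  simp [frobComp, map_sum, ← IsScalarTower.algebraMap_apply]

lemma trace_poly {F E K : Type*} [Field F] [Fintype F] [Field E] [Field K]
    [Algebra F E] [Algebra E K] [Algebra F K] [IsScalarTower F E K] [Finite K] (α : K) :
    algebraMap E K (Algebra.trace E K α) = aeval (frobEnd F K)
      (∑ i ∈ Finset.range (Module.finrank E K), (X ^ Module.finrank F E : F[X]) ^ i) α := by
  have : Finite E := Finite.of_injective _ (algebraMap E K).injective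
  have : FiniteDimensional F E := Module.Finite.of_finite
  rw [FiniteField.algebraMap_trace_eq_sum_pow, map_sum, LinearMap.sum_apply]
  refine Finset.sum_congr rfl fun i _ => ?_
  rw [← pow_mul, map_pow, aeval_X, frobEnd_pow, Module.natCard_eq_pow_finrank (K := F),
    ← pow_mul, Nat.card_eq_fintype_card]

lemma main_core {F : Type*} [Field F] (L T : F[X]) (p : ℕ) (hp : 0 < p) (hL : L.Monic)
    (hT : T.Monic) (hLT : IsCoprime L T) (g : F[X]) (hg : g.Monic)
    (hgN : g ∣ L ^ p * T ^ p) :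
    g = L ^ (p - 1) * T ^ p ↔ (IsCoprime T ((L ^ p * T ^ p) /ₘ g) ∧
      ∀ h, g ∣ h * T ^ p ↔ L ^ (p - 1) ∣ h) := by
  obtain ⟨p, rfl⟩ : ∃ k, p = k + 1 := ⟨p - 1, by omega⟩
  simp only [Nat.add_sub_cancel]
  obtain ⟨c, hc⟩ := hgN
  rw [hc, mul_divByMonic_cancel_left _ hg]
  have hTp : T ^ (p + 1) ≠ 0 := (hT.pow _).ne_zero
  constructor
  · rintro rfl
    refine ⟨?_, fun h => ?_⟩
    · have : c = L := by
        apply mul_left_cancel₀ hg.ne_zero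
        rw [← hc]; ring
      rw [this]; exact hLT.symm
    · exact mul_dvd_mul_iff_right hTp
  · rintro ⟨hco, hh⟩
    have h1 : T ^ (p + 1) ∣ g := by
      apply (hco.pow_left (m := p + 1)).dvd_of_dvd_mul_right
      rw [← hc]; exact dvd_mul_left _ _
    obtain ⟨k, rfl⟩ := h1
    have h2 : ∀ h, k ∣ h ↔ L ^ p ∣ h := fun h => by
      rw [← hh h, mul_comm h, mul_dvd_mul_iff_left hTp]
    have hk : k.Monic := (hT.pow _).of_mul_monic_left hg
    have : k = L ^ p := eq_of_monic_of_associated hk (hL.pow _)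
      (associated_of_dvd_dvd ((h2 _).2 dvd_rfl) ((h2 _).1 dvd_rfl))
    rw [this, mul_comm]


/-- For `n = ps`, `gcd(p,s) = 1`, `T = (xˢ-1)/(x-1)`: `α ∈ F_{qⁿ}` has `σ_q`-minimal
polynomial `(xⁿ-1)/(x-1)` iff `α` is `T`-free and `Tr_{qⁿ/qᵖ}(α)` has `σ_q`-minimal
polynomial `(xᵖ-1)/(x-1)`. -/
theorem stmt_13 (p e q s : ℕ) (hp : p.Prime) (he : 0 < e) (hq : q = p ^ e)
    (hs : 0 < s) (hps : Nat.gcd p s = 1)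
    (F E K : Type) [Field F] [Fintype F] [Field E] [Field K]
    [Algebra F E] [Algebra E K] [Algebra F K] [IsScalarTower F E K]
    (hcF : Fintype.card F = q) (hrE : Module.finrank F E = p)
    (hrK : Module.finrank F K = p * s) (α : K) :
    IsFrobMinimal q ((X ^ (p * s) - 1 : F[X]) /ₘ (X - 1)) α ↔
      (IsPolyFree q (p * s) ((X ^ s - 1 : F[X]) /ₘ (X - 1)) α ∧
        IsFrobMinimal q ((X ^ p - 1 : F[X]) /ₘ (X - 1)) (Algebra.trace E K α)) := by
  subst hq
  rw [← hcF]
  have : Fact p.Prime := ⟨hp⟩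
  have hchF : CharP F p := by
    obtain ⟨r, hr⟩ := CharP.exists F
    obtain ⟨n, hrp, hn⟩ := FiniteField.card F r
    rw [hcF] at hn
    have : r = p := by
      have : r ∣ p ^ e := hn ▸ dvd_pow_self r n.pos.ne'
      exact (Nat.prime_dvd_prime_iff_eq hrp hp).1 (hrp.dvd_of_dvd_pow this)
    exact this ▸ hr
  have hfK : FiniteDimensional F K := Module.finite_of_finrank_pos (by
    rw [hrK]; exact Nat.mul_pos hp.pos hs)
  have hfinK : Finite K := Module.finite_of_finite F
  have hfE : FiniteDimensional F E := Module.finite_of_finrank_pos (by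
    rw [hrE]; exact hp.pos)
  have hEK : Module.finrank E K = s := by
    have := Module.finrank_mul_finrank F E K
    rw [hrE, hrK] at this
    exact Nat.eq_of_mul_eq_mul_left hp.pos this
  -- polynomial identities
  have hL : (X - 1 : F[X]).Monic := by simpa using monic_X_sub_C (1 : F)
  obtain ⟨T, hTdef⟩ : ∃ T : F[X], T = ∑ i ∈ Finset.range s, X ^ i := ⟨_, rfl⟩
  have hTL : (X ^ s - 1 : F[X]) = (X - 1) * T := by rw [hTdef, mul_geom_sum]
  have hT : T.Monic := by
    refine hL.of_mul_monic_left ?_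
    rw [← hTL]
    simpa using monic_X_pow_sub_C (1 : F) hs.ne'
  have hLT : IsCoprime (X - 1 : F[X]) T := by
    have hirr : Irreducible (X - 1 : F[X]) := by simpa using irreducible_X_sub_C (1 : F)
    rw [hirr.coprime_iff_not_dvd]
    intro hd
    have hd' : (X - C 1 : F[X]) ∣ T := by simpa using hd
    rw [dvd_iff_isRoot, hTdef, IsRoot.def] at hd'
    simp only [eval_finsetSum, eval_pow, eval_X, one_pow, Finset.sum_const, Finset.card_range,
      nsmul_eq_mul, mul_one] at hd'
    rw [CharP.cast_eq_zero_iff F p] at hd'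
    have := Nat.dvd_gcd dvd_rfl hd'
    rw [hps] at this
    exact hp.one_lt.ne' (Nat.dvd_one.1 this)
  have hXp : (X ^ p - 1 : F[X]) = (X - 1) ^ p := by
    rw [sub_pow_char, one_pow]
  have hXn : (X ^ (p * s) - 1 : F[X]) = (X - 1) ^ p * T ^ p := by
    rw [← mul_pow, ← hTL, sub_pow_char, one_pow, ← pow_mul, mul_comm]
  have hS : ∑ i ∈ Finset.range s, (X ^ p : F[X]) ^ i = T ^ p := by
    apply mul_left_cancel₀ (hL.pow p).ne_zero
    rw [← hXn, ← hXp, mul_geom_sum, pow_mul]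
  have hpp : (X - 1 : F[X]) ^ p = (X - 1) * (X - 1) ^ (p - 1) := by
    rw [← pow_succ']; congr 1; have := hp.pos; omega
  have hd1 : (X ^ (p * s) - 1 : F[X]) /ₘ (X - 1) = (X - 1) ^ (p - 1) * T ^ p := by
    rw [hXn, hpp, mul_assoc, mul_divByMonic_cancel_left _ hL]
  have hd2 : (X ^ s - 1 : F[X]) /ₘ (X - 1) = T := by
    rw [hTL, mul_divByMonic_cancel_left _ hL]
  have hd3 : (X ^ p - 1 : F[X]) /ₘ (X - 1) = (X - 1) ^ (p - 1) := by
    rw [hXp, hpp, mul_divByMonic_cancel_left _ hL]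
  rw [hd1, hd2, hd3]
  have hann : aeval (frobEnd F K) ((X - 1 : F[X]) ^ p * T ^ p) α = 0 := by
    rw [← hXn, map_sub, map_pow, aeval_X, map_one, LinearMap.sub_apply, frobEnd_pow,
      Module.End.one_apply, sub_eq_zero, ← hrK, ← Nat.card_eq_fintype_card,
      ← Module.natCard_eq_pow_finrank]
    have := Fintype.ofFinite K
    rw [Nat.card_eq_fintype_card, FiniteField.pow_card]
  obtain ⟨g, hg⟩ := exists_frobMinimal _ ((hL.pow p).mul (hT.pow p)) α hann
  have hg' := (isFrobMinimal_iff g α).1 hg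
  have huniq : ∀ g' : F[X], IsFrobMinimal (Fintype.card F) g' α ↔ g = g' := by
    intro g'
    constructor
    · intro h
      have h' := (isFrobMinimal_iff g' α).1 h
      refine eq_of_monic_of_associated hg'.1 h'.1 (associated_of_dvd_dvd ?_ ?_)
      · exact (hg'.2 _).1 ((h'.2 _).2 dvd_rfl)
      · exact (h'.2 _).1 ((hg'.2 _).2 dvd_rfl)
    · rintro rfl; exact hg
  have htr : ∀ h : F[X], aeval (frobEnd F E) h (Algebra.trace E K α) = 0 ↔ g ∣ h * T ^ p := by
    intro h
    rw [← hg'.2, map_mul, Module.End.mul_apply, ← hS]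
    have := trace_poly (F := F) (E := E) α
    rw [hrE, hEK] at this
    rw [← this, ← algebraMap_aeval_frobEnd, map_eq_zero (algebraMap E K)]
  rw [huniq, main_core _ T p hp.pos hL hT hLT g hg'.1 ((hg'.2 _).1 hann), isFrobMinimal_iff]
  simp only [htr]
  unfold IsPolyFree
  simp only [huniq, forall_eq', hXn]
  simp only [hL.pow (p - 1), true_and]

end
end

section
/- Let q be a power of a prime p and n = ps, where s ≥ 2 is a positive integer not divisible by p, and set T(x) = (x^s − 1)/(x − 1) ∈ F_q[x]. If W(T) · W(q^{ps} − 1) ≤ q^{p(s/2 − 1)}, then there exists a primitive 1-normal element of F_{q^n} over F_q. -/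
open Polynomial

noncomputable section

def Expands {A : Type} [AddCommGroup A] (f : A → ℂ) (c0 B : ℝ) : Prop :=
  ∃ (J : Type) (_ : Fintype J) (a : J → ℂ) (χ : J → AddChar A ℂ) (j0 : J),
    χ j0 = 1 ∧ (∀ j, j ≠ j0 → χ j ≠ 1) ∧ a j0 = c0 ∧ (∑ j, ‖a j‖ ≤ B) ∧
    ∀ x, f x = ∑ j, a j * χ j x

/-- expansion with respect to a subgroup -/
def ExpandsOn {A : Type} [AddCommGroup A] (H : AddSubgroup A) (f : A → ℂ) (c0 B : ℝ) : Prop :=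
  ∃ (J : Type) (_ : Fintype J) (a : J → ℂ) (χ : J → AddChar A ℂ) (j0 : J),
    χ j0 = 1 ∧ (∀ j, j ≠ j0 → χ j ≠ 1) ∧ (∀ j, ∀ h ∈ H, χ j h = 1) ∧
    a j0 = c0 ∧ (∑ j, ‖a j‖ = B) ∧
    ∀ x, f x = ∑ j, a j * χ j x

theorem expands_prod {A ι : Type} [AddCommGroup A] [Fintype ι] (H : ι → AddSubgroup A)
    (hH : ∀ i, ∀ x, ∃ y z, x = y + z ∧ y ∈ H i ∧ ∀ j, j ≠ i → z ∈ H j)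
    (f : ι → A → ℂ) (c B : ι → ℝ) (h : ∀ i, ExpandsOn (H i) (f i) (c i) (B i)) :
    Expands (fun x => ∏ i, f i x) (∏ i, c i) (∏ i, B i) := by
  classical
  choose J hJ a χ j0 h1 h2 h3 h4 h5 h6 using h
  refine ⟨∀ i, J i, inferInstance, fun j => ∏ i, a i (j i), fun j => ∏ i, χ i (j i), j0,
    ?_, ?_, ?_, ?_, ?_⟩
  · simp [h1]
  · intro j hj hprod
    apply hj
    funext i
    by_contra hne
    apply h2 i _ hne
    ext x
    obtain ⟨y, z, rfl, hy, hz⟩ := hH i x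
    rw [AddChar.map_add_eq_mul, h3 i _ y hy]
    have := DFunLike.congr_fun hprod z
    rw [AddChar.prod_apply, Finset.prod_eq_single i] at this
    · simpa using this
    · intro k _ hk
      exact h3 k _ z (hz k hk)
    · simp
  · simp [h4]
  · simp only [norm_prod]
    simp_rw [← h5]
    rw [Finset.prod_univ_sum]
    simp
  · intro x
    simp_rw [h6]
    rw [Finset.prod_univ_sum]
    simp [Finset.prod_mul_distrib, AddChar.prod_apply]

theorem indic_sum {A : Type} [AddCommGroup A] [Finite A] (H : AddSubgroup A) [Fintype (A ⧸ H)]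
   (x : A) [Decidable (x ∈ H)] :
    ∑ ψ : AddChar (A ⧸ H) ℂ, ψ (QuotientAddGroup.mk x) = if x ∈ H then (H.index : ℂ) else 0 := by
  classical
  rw [AddChar.sum_apply_eq_ite]
  simp [AddSubgroup.index, QuotientAddGroup.eq_zero_iff]

theorem pullback_ne {A : Type} [AddCommGroup A] (H : AddSubgroup A) (ψ : AddChar (A ⧸ H) ℂ)
    (h : ψ ≠ 1) : ψ.compAddMonoidHom (QuotientAddGroup.mk' H) ≠ 1 := by
  intro h'
  apply h
  ext x
  obtain ⟨x, rfl⟩ := QuotientAddGroup.mk_surjective x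
  simpa using DFunLike.congr_fun h' x

open Classical in
/-- indicator of a coset -/
def onInd {A : Type} [AddCommGroup A] (H : AddSubgroup A) (g x : A) : ℂ :=
  if x - g ∈ H then 1 else 0

open Classical in
/-- indicator of the complement of a subgroup -/
def offInd {A : Type} [AddCommGroup A] (H : AddSubgroup A) (x : A) : ℂ :=
  if x ∈ H then 0 else 1

open Classical in
theorem expandsOn_coset {A : Type} [AddCommGroup A] [Finite A] (H : AddSubgroup A) (g : A) :
    ExpandsOn H (onInd H g) (1 / (H.index : ℝ)) 1 := by
  have : Fintype (A ⧸ H) := Fintype.ofFinite _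
  have hi : (H.index : ℂ) ≠ 0 := by exact_mod_cast H.index_ne_zero_of_finite
  have hc : Fintype.card (A ⧸ H) = H.index := by simp [AddSubgroup.index]
  refine ⟨AddChar (A ⧸ H) ℂ, inferInstance,
    fun ψ => ψ (QuotientAddGroup.mk (-g)) / H.index,
    fun ψ => ψ.compAddMonoidHom (QuotientAddGroup.mk' H), 1, ?_, ?_, ?_, ?_, ?_, ?_⟩
  · ext; simp
  · intro ψ hψ
    exact pullback_ne H ψ hψ
  · intro ψ h hh
    simp [(QuotientAddGroup.eq_zero_iff h).2 hh]
  · simp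
  · simp only [norm_div, AddChar.norm_apply]
    have hi' : (H.index : ℝ) ≠ 0 := by exact_mod_cast H.index_ne_zero_of_finite
    simp [AddChar.card_eq, hc, hi']
  · intro x
    unfold onInd
    have := indic_sum H (x - g)
    calc _ = (if x - g ∈ H then (H.index : ℂ) else 0) / H.index := by
            by_cases hx : x - g ∈ H <;> simp [hi, hx]
      _ = _ := by
        rw [← this, Finset.sum_div]
        refine Finset.sum_congr rfl fun ψ _ => ?_
        rw [sub_eq_neg_add, QuotientAddGroup.mk_add, AddChar.map_add_eq_mul]
        simp
        ring

open Classical in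
theorem expandsOn_compl {A : Type} [AddCommGroup A] [Finite A] (H : AddSubgroup A) :
    ExpandsOn H (offInd H) (1 - 1 / (H.index : ℝ))
      (2 * (1 - 1 / (H.index : ℝ))) := by
  have : Fintype (A ⧸ H) := Fintype.ofFinite _
  have hi : (H.index : ℂ) ≠ 0 := by exact_mod_cast H.index_ne_zero_of_finite
  have hi1 : (1 : ℝ) ≤ (H.index : ℝ) := by
    exact_mod_cast Nat.one_le_iff_ne_zero.2 H.index_ne_zero_of_finite
  have hc : Fintype.card (A ⧸ H) = H.index := by simp [AddSubgroup.index]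
  refine ⟨AddChar (A ⧸ H) ℂ, inferInstance,
    fun ψ => (if ψ = 1 then 1 else 0) - 1 / H.index,
    fun ψ => ψ.compAddMonoidHom (QuotientAddGroup.mk' H), 1, ?_, ?_, ?_, ?_, ?_, ?_⟩
  · ext; simp
  · intro ψ hψ
    exact pullback_ne H ψ hψ
  · intro ψ h hh
    simp [(QuotientAddGroup.eq_zero_iff h).2 hh]
  · simp
  · have h0 : ∀ ψ : AddChar (A ⧸ H) ℂ, ‖(if ψ = 1 then (1:ℂ) else 0) - 1 / H.index‖
        = (if ψ = 1 then 1 - 2 / (H.index : ℝ) else 0) + 1 / H.index := by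
      intro ψ
      split_ifs with h
      · have : (1 : ℂ) - 1 / H.index = ((1 - 1 / H.index : ℝ) : ℂ) := by simp
        rw [this, Complex.norm_real, Real.norm_of_nonneg]
        · ring
        · rw [sub_nonneg, div_le_one (by linarith)]; exact hi1
      · simp
    simp_rw [h0]
    rw [Finset.sum_add_distrib]
    simp [AddChar.card_eq, hc]
    field_simp
    ring
  · intro x
    unfold offInd
    have := indic_sum H x
    simp only [sub_mul, Finset.sum_sub_distrib]
    have h2 : ∑ ψ : AddChar (A ⧸ H) ℂ, 1 / (H.index : ℂ) *
        (ψ.compAddMonoidHom (QuotientAddGroup.mk' H)) x = if x ∈ H then 1 else 0 := by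
      rw [← Finset.mul_sum]
      simp only [AddChar.compAddMonoidHom_apply, QuotientAddGroup.mk'_apply, this]
      split_ifs <;> simp [hi]
    rw [h2]
    simp
    split_ifs <;> simp

theorem charsum_bound {K : Type} [Field K] [Fintype K] [Fintype Kˣ]
    (χ : AddChar (Additive Kˣ) ℂ) (ψ : AddChar K ℂ) (h : χ ≠ 1 ∨ ψ ≠ 1) :
    ‖∑ u : Kˣ, χ (Additive.ofMul u) * ψ (u : K)‖ ≤ Real.sqrt (Fintype.card K) := by
  classical
  let χ' : MulChar K ℂ := MulChar.ofUnitHom (MonoidHom.toHomUnits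
    { toFun := fun u : Kˣ => χ (Additive.ofMul u)
      map_one' := by simp
      map_mul' := fun u v => by simp [AddChar.map_add_eq_mul] })
  have hχ' : ∀ u : Kˣ, χ' u = χ (Additive.ofMul u) := by
    intro u; simp [χ']
  have hS : ∑ u : Kˣ, χ (Additive.ofMul u) * ψ (u : K) = gaussSum χ' ψ := by
    unfold gaussSum
    rw [← Finset.sum_subset (Finset.subset_univ (Finset.univ.image (fun u : Kˣ => (u : K))))]
    · rw [Finset.sum_image (fun a _ b _ hab => Units.ext hab)]
      simp [hχ']
    · intro x _ hx
      have : x = 0 := by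
        by_contra h0
        exact hx (Finset.mem_image.2 ⟨Units.mk0 x h0, by simp⟩)
      rw [this, MulChar.map_zero, zero_mul]
  rw [hS]
  have hχ1 : χ ≠ 1 → χ' ≠ 1 := by
    intro hne h1
    apply hne
    ext u
    have := hχ' u.toMul
    rw [h1] at this
    simpa using this.symm
  have hone : (1:ℝ) ≤ Real.sqrt (Fintype.card K) := by
    rw [Real.one_le_sqrt]; exact_mod_cast Fintype.card_pos
  by_cases h1 : χ' = 1
  · have hψ : ψ ≠ 1 := by
      rcases h with h | h
      · exact absurd h1 (hχ1 h)
      · exact h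
    rw [h1, gaussSum_one_left hψ]
    simpa using hone
  by_cases h2 : ψ = 1
  · rw [h2, gaussSum_one_right h1]; simp
  have h3 := gaussSum_mul_gaussSum_eq_card h1 (AddChar.IsPrimitive.of_ne_one h2)
  rw [← star_gaussSum_eq] at h3
  apply Real.le_sqrt_of_sq_le
  have h4 := congrArg norm h3
  rw [norm_mul, norm_star] at h4
  simp at h4
  rw [sq, h4]

theorem main_ineq {K : Type} [Field K] [Fintype K] [Fintype Kˣ] (f : Additive Kˣ → ℂ) (g : K → ℂ)
    (a A b B : ℝ) (ha : 0 < a) (hb : 0 < b) (hf : Expands f a A) (hg : Expands g b B)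
    (hz : ∀ u : Kˣ, f (Additive.ofMul u) * g u = 0) :
    a * b * (Fintype.card K - 1) ≤ (A * B - a * b) * Real.sqrt (Fintype.card K) := by
  classical
  obtain ⟨J, _, α, χ, j0, hχ0, hχ1, hα0, hα, hf⟩ := hf
  obtain ⟨I, _, β, ψ, i0, hψ0, hψ1, hβ0, hβ, hg⟩ := hg
  set S : J × I → ℂ := fun x => ∑ u : Kˣ, χ x.1 (Additive.ofMul u) * ψ x.2 (u : K) with hSdef
  have h0 : ∑ x : J × I, α x.1 * β x.2 * S x = 0 := by
    have : ∑ u : Kˣ, f (Additive.ofMul u) * g u = 0 := by simp [hz]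
    rw [← this]
    simp only [hf, hg, hSdef, Finset.mul_sum, Finset.sum_mul]
    rw [Finset.sum_comm]
    refine Finset.sum_congr rfl fun u _ => ?_
    rw [Fintype.sum_prod_type, Finset.sum_comm]
    refine Finset.sum_congr rfl fun i _ => Finset.sum_congr rfl fun j _ => ?_
    ring
  rw [← Finset.add_sum_erase _ _ (Finset.mem_univ (j0, i0))] at h0
  have hS0 : S (j0, i0) = ((Fintype.card K - 1 : ℝ) : ℂ) := by
    simp [hSdef, hχ0, hψ0]
    have hcu : Fintype.card Kˣ = Fintype.card K - 1 := by
      rw [← Nat.card_eq_fintype_card, Nat.card_units, Nat.card_eq_fintype_card]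
    rw [hcu, Nat.cast_sub Fintype.card_pos]; simp
  have hnn : (0:ℝ) ≤ (Fintype.card K - 1 : ℝ) := by
    rw [sub_nonneg]; exact_mod_cast Fintype.card_pos
  have h1 : a * b * (Fintype.card K - 1) =
      ‖∑ x ∈ Finset.univ.erase (j0, i0), α x.1 * β x.2 * S x‖ := by
    rw [← neg_eq_of_add_eq_zero_right h0, norm_neg, hS0]
    simp only [hα0, hβ0, norm_mul, Complex.norm_real, Real.norm_of_nonneg hnn,
      Real.norm_of_nonneg ha.le, Real.norm_of_nonneg hb.le]
  rw [h1]
  refine (norm_sum_le _ _).trans ?_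
  have h2 : ∀ x ∈ Finset.univ.erase (j0, i0), ‖α x.1 * β x.2 * S x‖ ≤
      ‖α x.1‖ * ‖β x.2‖ * Real.sqrt (Fintype.card K) := by
    rintro ⟨j, i⟩ hx
    rw [norm_mul, norm_mul]
    refine mul_le_mul_of_nonneg_left (charsum_bound _ _ ?_) (by positivity)
    by_contra hcon
    push Not at hcon
    apply Finset.ne_of_mem_erase hx
    have e1 : j = j0 := by by_contra hh; exact hχ1 j hh hcon.1
    have e2 : i = i0 := by by_contra hh; exact hψ1 i hh hcon.2
    rw [e1, e2]
  refine (Finset.sum_le_sum h2).trans ?_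
  rw [← Finset.sum_mul]
  refine mul_le_mul_of_nonneg_right ?_ (Real.sqrt_nonneg _)
  have h3 := Finset.add_sum_erase Finset.univ (fun x : J × I => ‖α x.1‖ * ‖β x.2‖)
    (Finset.mem_univ (j0, i0))
  simp only [hα0, hβ0, Complex.norm_real, Real.norm_of_nonneg ha.le, Real.norm_of_nonneg hb.le]
    at h3
  have h4 : ∑ x : J × I, ‖α x.1‖ * ‖β x.2‖ ≤ A * B := by
    rw [Fintype.sum_prod_type]
    simp only
    rw [← Finset.sum_mul_sum]
    exact mul_le_mul hα hβ (by positivity) ((by positivity : (0:ℝ) ≤ ∑ j, ‖α j‖).trans hα)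
  linarith

theorem indep_aux {R A ι : Type} [CommRing R] [AddCommGroup A] [Module R A] [Fintype ι]
    (P : ι → R) (hP : ∀ i j, i ≠ j → IsCoprime (P i) (P j)) (i : ι) (x : A) :
    ∃ y z, x = y + z ∧ y ∈ (DistribSMul.toAddMonoidHom A (P i)).range ∧
      ∀ j, j ≠ i → z ∈ (DistribSMul.toAddMonoidHom A (P j)).range := by
  classical
  have h : IsCoprime (P i) (∏ j ∈ Finset.univ.erase i, P j) :=
    IsCoprime.prod_right fun j hj => hP i j (Finset.ne_of_mem_erase hj).symm
  obtain ⟨u, v, huv⟩ := h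
  refine ⟨(u * P i) • x, (v * ∏ j ∈ Finset.univ.erase i, P j) • x, ?_, ?_, ?_⟩
  · rw [← add_smul, huv, one_smul]
  · exact ⟨u • x, by simp [smul_smul, mul_comm]⟩
  · intro j hj
    refine ⟨(v * ∏ k ∈ (Finset.univ.erase i).erase j, P k) • x, ?_⟩
    rw [← Finset.mul_prod_erase (Finset.univ.erase i) P (a := j) (by simp [hj])]
    simp only [DistribSMul.toAddMonoidHom_apply, smul_smul]
    congr 1
    ring

theorem index_pos_aux {A : Type} [AddCommGroup A] [Finite A] (H : AddSubgroup A) (h : H ≠ ⊤) :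
    0 < 1 - 1 / (H.index : ℝ) := by
  have h1 : H.index ≠ 1 := by rwa [Ne, AddSubgroup.index_eq_one]
  have h0 := H.index_ne_zero_of_finite
  have h2 : (1:ℝ) < H.index := by
    have : 1 < H.index := by omega
    exact_mod_cast this
  rw [sub_pos, div_lt_one (by linarith)]
  exact h2

theorem mul_side (K : Type) [Field K] [Fintype K] :
    ∃ (f : Additive Kˣ → ℂ) (a : ℝ), 0 < a ∧
      Expands f a (a * 2 ^ (Fintype.card K - 1).primeFactors.card) ∧
      ∀ u : Kˣ, f (Additive.ofMul u) ≠ 0 → IsPrimitiveElt (u : K) := by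
  classical
  set N := Fintype.card K - 1 with hN
  have hNu : Nat.card Kˣ = N := by rw [Nat.card_units, Nat.card_eq_fintype_card]
  have hNpos : 0 < N := by rw [← hNu]; exact Nat.card_pos
  let ι := {l // l ∈ N.primeFactors}
  have hcard : Fintype.card ι = N.primeFactors.card := Fintype.card_coe _
  let H : ι → AddSubgroup (Additive Kˣ) :=
    fun i => (DistribSMul.toAddMonoidHom (Additive Kˣ) ((i.1 : ℕ) : ℤ)).range
  have hmem : ∀ i (u : Kˣ), Additive.ofMul u ∈ H i ↔ ∃ v : Kˣ, v ^ i.1 = u := by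
    intro i u
    constructor
    · rintro ⟨v, hv⟩
      refine ⟨v.toMul, ?_⟩
      have := congrArg Additive.toMul hv
      simpa using this
    · rintro ⟨v, rfl⟩
      exact ⟨Additive.ofMul v, by simp⟩
  obtain ⟨g, hg⟩ := IsCyclic.exists_generator (α := Kˣ)
  have hgo : orderOf g = N := by rw [orderOf_eq_card_of_forall_mem_zpowers hg, hNu]
  have htop : ∀ i, H i ≠ ⊤ := by
    intro i hi
    have : Additive.ofMul g ∈ H i := by rw [hi]; trivial
    obtain ⟨v, hv⟩ := (hmem i g).1 this
    have hl := (Nat.mem_primeFactors.1 i.2)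
    have h1 : g ^ (N / i.1) = 1 := by
      rw [← hv, ← pow_mul, Nat.mul_div_cancel' hl.2.1, ← hNu, pow_card_eq_one']
    have h2 := orderOf_dvd_of_pow_eq_one h1
    rw [hgo] at h2
    have h3 := Nat.le_of_dvd (Nat.div_pos (Nat.le_of_dvd hNpos hl.2.1) hl.1.pos) h2
    exact absurd (Nat.div_lt_self hNpos hl.1.one_lt) (not_lt.2 h3)
  have hE : Expands (fun x => ∏ i : ι, offInd (H i) x)
      (∏ i, (1 - 1 / ((H i).index : ℝ)))
      ((∏ i, (1 - 1 / ((H i).index : ℝ))) * 2 ^ N.primeFactors.card) := by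
    have hprod : (∏ i : ι, 2 * (1 - 1 / ((H i).index : ℝ))) =
        (∏ i, (1 - 1 / ((H i).index : ℝ))) * 2 ^ N.primeFactors.card := by
      rw [Finset.prod_mul_distrib, mul_comm, Finset.prod_const, Finset.card_univ, hcard]
    rw [← hprod]
    refine expands_prod H ?_ _ _ _ (fun i => expandsOn_compl (H i))
    refine indep_aux (R := ℤ) (fun i : ι => ((i.1 : ℕ) : ℤ)) ?_
    intro i j hij
    rw [Nat.isCoprime_iff_coprime]
    exact (Nat.coprime_primes (Nat.prime_of_mem_primeFactors i.2)
      (Nat.prime_of_mem_primeFactors j.2)).2 (fun h => hij (Subtype.ext h))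
 
  refine ⟨_, _, ?_, hE, ?_⟩
  rotate_left
  · intro u hu b hb
    have hu' : ∀ i : ι, ¬ ∃ v : Kˣ, v ^ i.1 = u := by
      intro i hv
      apply hu
      apply Finset.prod_eq_zero (Finset.mem_univ i)
      exact if_pos ((hmem i u).2 hv)
    have hgen : ∀ w : Kˣ, w ∈ Submonoid.powers u := by
      obtain ⟨k, hk⟩ := mem_powers_iff_mem_zpowers.2 (hg u)
      have hk : g ^ k = u := hk
      have hcop : (orderOf g).Coprime k := by
        rw [hgo]
        rw [Nat.coprime_iff_gcd_eq_one]
        by_contra hne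
        obtain ⟨l, hl, hld⟩ := Nat.exists_prime_and_dvd hne
        have hlN := hld.trans (Nat.gcd_dvd_left _ _)
        obtain ⟨c, hc⟩ := hld.trans (Nat.gcd_dvd_right _ _)
        refine hu' ⟨l, Nat.mem_primeFactors.2 ⟨hl, hlN, hNpos.ne'⟩⟩ ⟨g ^ c, ?_⟩
        rw [← hk, hc, ← pow_mul, mul_comm]
      have ho : orderOf u = Nat.card Kˣ := by
        rw [← hk, Nat.Coprime.orderOf_pow hcop, hgo, hNu]
      intro w
      rw [mem_powers_iff_mem_zpowers]
      have := (Subgroup.eq_top_of_card_eq (Subgroup.zpowers u) (by rw [Nat.card_zpowers, ho]))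
      rw [this]; trivial
    obtain ⟨m, hm⟩ := hgen (Units.mk0 b hb)
    refine ⟨m, ?_⟩
    have := congrArg Units.val hm
    simpa using this
  · exact Finset.prod_pos fun i _ => index_pos_aux _ (htop i)

theorem Wint_ge (N : ℕ) (hN : 0 < N) : 2 ^ N.primeFactors.card ≤ Wint N := by
  classical
  rw [← Finset.card_powerset, Wint]
  have hfin : {d : ℕ | d ∣ N ∧ Squarefree d}.Finite :=
    (Set.finite_Iic N).subset fun d hd => Nat.le_of_dvd hN hd.1
  rw [← Set.ncard_coe_finset]
  have hpr : ∀ S ∈ N.primeFactors.powerset, ∀ l ∈ S, l.Prime := fun S hS l hl =>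
    Nat.prime_of_mem_primeFactors (Finset.mem_powerset.1 hS hl)
  refine Set.ncard_le_ncard_of_injOn (fun S => ∏ l ∈ S, l) ?_ ?_ hfin
  · intro S hS
    have hS' : S ∈ N.primeFactors.powerset := hS
    refine ⟨?_, ?_⟩
    · exact (Finset.prod_dvd_prod_of_subset _ _ _ (Finset.mem_powerset.1 hS')).trans
        (Nat.prod_primeFactors_dvd N)
    · refine (Finset.squarefree_prod_of_pairwise_isCoprime ?_ fun l hl => (hpr S hS' l hl).squarefree)
      intro a ha b hb hab
      exact Nat.coprime_iff_isRelPrime.1 ((Nat.coprime_primes (hpr S hS' a ha) (hpr S hS' b hb)).2 hab)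
  · intro S hS S' hS' h
    have := congrArg Nat.primeFactors h
    simp only at this
    rwa [Nat.primeFactors_prod (hpr S hS), Nat.primeFactors_prod (hpr S' hS')] at this

theorem Wpoly_ge {F : Type} [Field F] [Fintype F] (T : F[X]) (hT : T ≠ 0) (S : Finset F[X])
    (hS : ∀ P ∈ S, Irreducible P ∧ P.Monic ∧ P ∣ T) : 2 ^ S.card ≤ Wpoly T := by
  classical
  rw [← Finset.card_powerset, Wpoly]
  have hfin : {h : F[X] | h.Monic ∧ h ∣ T}.Finite := by
    have : Finite (Polynomial.degreeLT F (T.natDegree + 1)) :=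
      Finite.of_equiv _ (Polynomial.degreeLTEquiv F (T.natDegree + 1)).symm.toEquiv
    refine (Set.toFinite (Polynomial.degreeLT F (T.natDegree + 1) : Set F[X])).subset ?_
    intro h hh
    rw [SetLike.mem_coe, Polynomial.mem_degreeLT]
    have h1 := Polynomial.natDegree_le_of_dvd hh.2 hT
    exact (Polynomial.natDegree_lt_iff_degree_lt hh.1.ne_zero).1 (by omega)
  rw [← Set.ncard_coe_finset]
  have hcop : ∀ P ∈ S, ∀ Q ∈ S, P ≠ Q → IsCoprime P Q := by
    intro P hP Q hQ hPQ
    refine (hS P hP).1.coprime_iff_not_dvd.2 fun hd => hPQ ?_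
    exact Polynomial.eq_of_monic_of_associated (hS P hP).2.1 (hS Q hQ).2.1
      ((hS P hP).1.associated_of_dvd (hS Q hQ).1 hd)
  refine Set.ncard_le_ncard_of_injOn (fun S => ∏ l ∈ S, l) ?_ ?_ hfin
  · intro U hU
    have hU' : U ⊆ S := Finset.mem_powerset.1 hU
    refine ⟨Polynomial.monic_prod_of_monic _ _ fun P hP => (hS P (hU' hP)).2.1, ?_⟩
    exact Finset.prod_dvd_of_coprime (fun a ha b hb hab => hcop a (hU' ha) b (hU' hb) hab)
      fun P hP => (hS P (hU' hP)).2.2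
  · intro U hU V hV h
    have hU' : U ⊆ S := Finset.mem_powerset.1 hU
    have hV' : V ⊆ S := Finset.mem_powerset.1 hV
    have key : ∀ U V : Finset F[X], U ⊆ S → V ⊆ S → ∏ l ∈ U, l = ∏ l ∈ V, l → U ⊆ V := by
      intro U V hU' hV' h P hP
      by_contra hPV
      have h1 : P ∣ ∏ l ∈ V, l := h ▸ Finset.dvd_prod_of_mem _ hP
      have h2 : IsCoprime P (∏ l ∈ V, l) := IsCoprime.prod_right fun Q hQ =>
        hcop P (hU' hP) Q (hV' hQ) (fun e => hPV (e ▸ hQ))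
      exact (hS P (hU' hP)).1.not_isUnit (h2.isUnit_of_dvd' dvd_rfl h1)
    exact (key U V hU' hV' h).antisymm (key V U hV' hU' h.symm)

theorem card_fixed (K : Type) [Field K] [Fintype K] (Q : ℕ) (hQ : 1 < Q) :
    Nat.card {x : K // x ^ Q = x} ≤ Q := by
  classical
  have h0 : (X ^ Q - X : K[X]) ≠ 0 := FiniteField.X_pow_card_sub_X_ne_zero K hQ
  have hd : (X ^ Q - X : K[X]).natDegree = Q := FiniteField.X_pow_card_sub_X_natDegree_eq K hQ
  rw [Nat.card_eq_fintype_card, Fintype.card_subtype]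
  calc _ ≤ (X ^ Q - X : K[X]).roots.toFinset.card := by
        apply Finset.card_le_card
        intro x hx
        simp only [Finset.mem_filter, Finset.mem_univ, true_and] at hx
        simp [h0, hx]
    _ ≤ _ := (Multiset.toFinset_card_le _).trans ((Polynomial.card_roots' _).trans hd.le)

/-- Frobenius as a linear map -/
def frobL (F K : Type) [Field F] [Fintype F] [Field K] [Fintype K] [Algebra F K] : K →ₗ[F] K :=
  (FiniteField.frobeniusAlgHom F K).toLinearMap

section
variable (F K : Type) [Field F] [Fintype F] [Field K] [Fintype K] [Algebra F K]

theorem frobL_apply (x : K) : frobL F K x = x ^ Fintype.card F := rfl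

theorem frobL_pow_apply (k : ℕ) (x : K) : (frobL F K ^ k) x = x ^ Fintype.card F ^ k := by
  induction k with
  | zero => simp
  | succ k ih =>
    rw [pow_succ', Module.End.mul_apply, ih, frobL_apply, ← pow_mul, ← pow_succ]

theorem frobL_minpoly : minpoly F (frobL F K) = X ^ Module.finrank F K - 1 := by
  have := FiniteField.minpoly_frobeniusAlgHom F K
  simpa [frobL] using this

theorem frobL_cyclic : ∃ δ : K, ∀ x : K, ∃ a : F[X], aeval (frobL F K) a δ = x := by
  have : FiniteDimensional F K := Module.Finite.of_finite
  let B := IsGalois.normalBasis F K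
  refine ⟨B 1, fun x => ?_⟩
  have hx : x ∈ Submodule.span F (Set.range B) := by rw [B.span_eq]; trivial
  induction hx using Submodule.span_induction with
  | mem x h =>
    obtain ⟨τ, rfl⟩ := h
    obtain ⟨i, hi⟩ := (FiniteField.bijective_frobeniusAlgEquivOfAlgebraic_pow F K).2 τ
    refine ⟨X ^ i.1, ?_⟩
    have h1 : B τ = τ (B 1) := IsGalois.normalBasis_apply (K := F) (L := K) τ
    rw [h1, ← hi]
    simp only [map_pow, aeval_X, frobL_pow_apply]
    rw [AlgEquiv.coe_pow, FiniteField.coe_frobeniusAlgEquivOfAlgebraic_iterate]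
  | zero => exact ⟨0, by simp⟩
  | add x y _ _ hx hy =>
    obtain ⟨a, ha⟩ := hx
    obtain ⟨b, hb⟩ := hy
    exact ⟨a + b, by simp [ha, hb]⟩
  | smul c x _ hx =>
    obtain ⟨a, ha⟩ := hx
    exact ⟨C c * a, by simp [ha, Module.algebraMap_end_apply]⟩

/-- the polynomial action -/
@[reducible] def frobMod : Module F[X] K := Module.compHom K (aeval (frobL F K)).toRingHom

theorem aeval_mul_apply (P Q : F[X]) (x : K) :
    aeval (frobL F K) (P * Q) x = aeval (frobL F K) P (aeval (frobL F K) Q x) := by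
  rw [map_mul, Module.End.mul_apply]

theorem aeval_not_surj (P : F[X]) (hP : 0 < P.natDegree) (hd : P ∣ X ^ Module.finrank F K - 1) :
    ∃ y : K, ∀ x, aeval (frobL F K) P x ≠ y := by
  by_contra hcon
  push Not at hcon
  obtain ⟨R, hR⟩ := hd
  have hne : (X ^ Module.finrank F K - 1 : F[X]) ≠ 0 := by
    have : FiniteDimensional F K := Module.Finite.of_finite
    rw [← frobL_minpoly]
    exact minpoly.ne_zero (Algebra.IsIntegral.isIntegral _)
  have h0 : aeval (frobL F K) R = 0 := by
    ext y
    obtain ⟨x, rfl⟩ := hcon y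
    rw [← aeval_mul_apply, mul_comm, ← hR, ← frobL_minpoly, minpoly.aeval]
    simp
  have h1 : P * R ∣ R := by
    rw [← hR, ← frobL_minpoly]
    exact minpoly.dvd _ _ h0
  have hR0 : R ≠ 0 := by rintro rfl; simp at hR; exact hne hR
  have hP0 : P ≠ 0 := by rintro rfl; simp at hP
  have h2 := Polynomial.natDegree_le_of_dvd h1 hR0
  rw [Polynomial.natDegree_mul hP0 hR0] at h2
  omega

theorem aeval_mem_span (h : F[X]) (x : K) : aeval (frobL F K) h x ∈
    Submodule.span F (Set.range fun i : Fin (Module.finrank F K) =>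
      x ^ Fintype.card F ^ (i : ℕ)) := by
  have hfd : FiniteDimensional F K := Module.Finite.of_finite
  have hpos : 0 < Module.finrank F K := Module.finrank_pos
  have hm : (X ^ Module.finrank F K - 1 : F[X]).Monic := monic_X_pow_sub_C 1 hpos.ne'
  have hdeg : (X ^ Module.finrank F K - 1 : F[X]).natDegree = Module.finrank F K :=
    natDegree_X_pow_sub_C (r := (1 : F))
  have h1 : aeval (frobL F K) h =
      aeval (frobL F K) (h %ₘ (X ^ Module.finrank F K - 1)) := by
    conv_lhs => rw [← modByMonic_add_div h (X ^ Module.finrank F K - 1 : F[X])]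
    rw [map_add, map_mul, ← frobL_minpoly, minpoly.aeval]
    simp
  have h2 : (h %ₘ (X ^ Module.finrank F K - 1)).natDegree < Module.finrank F K := by
    conv_rhs => rw [← hdeg]
    apply natDegree_modByMonic_lt _ hm
    intro h1
    rw [h1] at hdeg
    simp at hdeg
    omega
  rw [h1, aeval_eq_sum_range' h2, LinearMap.sum_apply]
  refine Submodule.sum_mem _ fun i hi => ?_
  rw [LinearMap.smul_apply, frobL_pow_apply]
  exact Submodule.smul_mem _ _ (Submodule.subset_span ⟨⟨i, Finset.mem_range.1 hi⟩, rfl⟩)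

theorem isOneNormal (δ : K) (hδ : ∀ x : K, ∃ a : F[X], aeval (frobL F K) a δ = x) (c : F[X])
    (hc : IsCoprime c (X ^ Module.finrank F K - 1)) :
    IskNormal (Fintype.card F) (Module.finrank F K) 1 F (aeval (frobL F K) ((X - 1 : F[X]) * c) δ) := by
  have hfd : FiniteDimensional F K := Module.Finite.of_finite
  set x := aeval (frobL F K) ((X - 1 : F[X]) * c) δ with hx
  set D : K →ₗ[F] K := aeval (frobL F K) (X - 1 : F[X]) with hD
  have hspan : Submodule.span F (Set.range fun i : Fin (Module.finrank F K) =>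
      x ^ Fintype.card F ^ (i : ℕ)) = LinearMap.range D := by
    apply le_antisymm
    · rw [Submodule.span_le]
      rintro _ ⟨i, rfl⟩
      refine ⟨aeval (frobL F K) (X ^ i.1 * c) δ, ?_⟩
      rw [hD, ← aeval_mul_apply]
      simp only
      have e : frobL F K ^ i.1 = aeval (frobL F K) (X ^ i.1 : F[X]) := by simp
      rw [← frobL_pow_apply, hx, e, ← aeval_mul_apply]
      congr 2
      ring
    · rintro _ ⟨y, rfl⟩
      obtain ⟨h, rfl⟩ := hδ y
      obtain ⟨u, v, huv⟩ := hc
      have : D (aeval (frobL F K) h δ) = aeval (frobL F K) (h * u) x := by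
        rw [hx, hD, ← aeval_mul_apply, ← aeval_mul_apply]
        have e : (X - 1 : F[X]) * h = h * u * ((X - 1) * c) +
            (h * (X - 1) * v) * (X ^ Module.finrank F K - 1) := by
          linear_combination (-(X - 1) * h) * huv
        rw [e, map_add, LinearMap.add_apply, map_mul _ (h * (X - 1) * v), ← frobL_minpoly,
          minpoly.aeval]
        simp
      rw [this]
      exact aeval_mem_span F K _ _
  unfold IskNormal
  rw [hspan]
  have hrn := LinearMap.finrank_range_add_finrank_ker D
  have hker : ∀ y, y ∈ LinearMap.ker D ↔ y ^ Fintype.card F = y := by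
    intro y
    simp [hD, frobL_apply, sub_eq_zero]
  have hle : Nat.card (LinearMap.ker D) ≤ Fintype.card F := by
    have h1 := card_fixed K (Fintype.card F) Fintype.one_lt_card
    rwa [Nat.card_congr (Equiv.subtypeEquivRight hker)]
  rw [Module.natCard_eq_pow_finrank (K := F), Nat.card_eq_fintype_card] at hle
  have h1 : Module.finrank F (LinearMap.ker D) ≤ 1 :=
    (Nat.pow_le_pow_iff_right Fintype.one_lt_card).1 (by simpa using hle)
  have h2 : 0 < Module.finrank F (LinearMap.ker D) := by
    have : Nontrivial (LinearMap.ker D) :=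
      ⟨⟨⟨1, by simp [hker]⟩, 0, by simp [Subtype.ext_iff]⟩⟩
    exact Module.finrank_pos
  omega

theorem index_U (p : ℕ) (hp : p.Prime) [CharP F p] :
    letI := frobMod F K
    (DistribSMul.toAddMonoidHom K ((X - 1) ^ p : F[X])).range.index ≤ Fintype.card F ^ p := by
  letI := frobMod F K
  have : Fact p.Prime := ⟨hp⟩
  rw [AddSubgroup.index_range]
  have hker : ∀ y, y ∈ (DistribSMul.toAddMonoidHom K ((X - 1) ^ p : F[X])).ker ↔
      y ^ Fintype.card F ^ p = y := by
    intro y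
    rw [AddMonoidHom.mem_ker]
    change aeval (frobL F K) ((X - 1) ^ p : F[X]) y = 0 ↔ _
    rw [sub_pow_char, one_pow]
    simp [frobL_pow_apply, sub_eq_zero]
  rw [Nat.card_congr (Equiv.subtypeEquivRight hker)]
  exact card_fixed K _ (Nat.one_lt_pow hp.ne_zero Fintype.one_lt_card)

theorem add_side (p s : ℕ) (hp : p.Prime) [CharP F p] (hs : 2 ≤ s) (hpns : ¬ p ∣ s)
    (hrK : Module.finrank F K = p * s) (T : F[X]) (hT : (X - 1) * T = X ^ s - 1) :
    ∃ (g : K → ℂ) (b : ℝ) (m : ℕ) (S : Finset F[X]), 0 < b ∧ m ≤ Fintype.card F ^ p ∧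
      (∀ P ∈ S, Irreducible P ∧ P.Monic ∧ P ∣ T) ∧ Expands g b (b * m * 2 ^ S.card) ∧
      ∀ x, g x ≠ 0 → IskNormal (Fintype.card F) (Module.finrank F K) 1 F x := by
  classical
  have : Fact p.Prime := ⟨hp⟩
  letI := frobMod F K
  have hn : (X ^ Module.finrank F K - 1 : F[X]) = ((X - 1) * T) ^ p := by
    rw [hT, sub_pow_char, one_pow, hrK, ← pow_mul, mul_comm]
  have hT0 : T ≠ 0 := by
    rintro rfl
    have := congrArg natDegree hT
    have h2 : (X ^ s - 1 : F[X]).natDegree = s := natDegree_X_pow_sub_C (r := (1 : F))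
    rw [mul_zero, natDegree_zero, h2] at this
    omega
  have hirr1 : Irreducible (X - 1 : F[X]) := irreducible_X_sub_C (1 : F)
  have hcop1 : IsCoprime (X - 1 : F[X]) T := by
    have hsep : (X ^ s - 1 : F[X]).Separable := by
      rw [X_pow_sub_one_separable_iff]
      rwa [Ne, CharP.cast_eq_zero_iff F p]
    rw [← hT] at hsep
    exact hsep.isCoprime
  let S : Finset F[X] := (UniqueFactorizationMonoid.normalizedFactors T).toFinset
  have hS : ∀ P ∈ S, Irreducible P ∧ P.Monic ∧ P ∣ T := by
    intro P hP
    have hP := Multiset.mem_toFinset.1 hP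
    have hi := UniqueFactorizationMonoid.irreducible_of_normalized_factor P hP
    refine ⟨hi, ?_, UniqueFactorizationMonoid.dvd_of_mem_normalizedFactors hP⟩
    have := UniqueFactorizationMonoid.normalize_normalized_factor P hP
    rw [← this]
    exact Polynomial.monic_normalize hi.ne_zero
  have hcop : ∀ P ∈ S, ∀ Q ∈ S, P ≠ Q → IsCoprime P Q := by
    intro P hP Q hQ hPQ
    refine (hS P hP).1.coprime_iff_not_dvd.2 fun hd => hPQ ?_
    exact Polynomial.eq_of_monic_of_associated (hS P hP).2.1 (hS Q hQ).2.1
      ((hS P hP).1.associated_of_dvd (hS Q hQ).1 hd)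
  let ι := {P // P ∈ S}
  have hcard : Fintype.card ι = S.card := Fintype.card_coe _
  let P : Option ι → F[X] := fun o => o.elim ((X - 1) ^ p) (fun i => i.1)
  have hP : ∀ i j, i ≠ j → IsCoprime (P i) (P j) := by
    have key : ∀ i : ι, IsCoprime ((X - 1 : F[X]) ^ p) i.1 := fun i =>
      (hcop1.of_isCoprime_of_dvd_right (hS i.1 i.2).2.2).pow_left
    rintro (_ | i) (_ | j) hij
    · exact absurd rfl hij
    · exact key j
    · exact (key i).symm
    · exact hcop _ i.2 _ j.2 fun h => hij (congrArg some (Subtype.ext h))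
  let H : Option ι → AddSubgroup K := fun i => (DistribSMul.toAddMonoidHom K (P i)).range
  have hmem : ∀ i x, x ∈ H i ↔ ∃ y, aeval (frobL F K) (P i) y = x := fun i x => Iff.rfl
  have htop : ∀ i : ι, H (some i) ≠ ⊤ := by
    intro i hi
    obtain ⟨y, hy⟩ := aeval_not_surj F K i.1 (hS i.1 i.2).1.natDegree_pos (by
      rw [hn]
      exact ((hS i.1 i.2).2.2.mul_left _).trans (dvd_pow_self _ hp.ne_zero))
    have : y ∈ H (some i) := by rw [hi]; trivial
    obtain ⟨x, hx⟩ := (hmem _ _).1 this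
    exact hy x hx
  obtain ⟨δ, hδ⟩ := frobL_cyclic F K
  let γ : K := aeval (frobL F K) (X - 1 : F[X]) δ
  let f : Option ι → K → ℂ := fun o => match o with
    | none => onInd (H none) γ
    | some i => offInd (H (some i))
  let c : Option ι → ℝ := fun o => match o with
    | none => 1 / ((H none).index : ℝ)
    | some i => 1 - 1 / ((H (some i)).index : ℝ)
  let B : Option ι → ℝ := fun o => match o with
    | none => 1
    | some i => 2 * (1 - 1 / ((H (some i)).index : ℝ))
  have hE : Expands (fun x => ∏ i, f i x) (∏ i, c i) (∏ i, B i) := by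
    refine expands_prod H (indep_aux (R := F[X]) P hP) f c B ?_
    rintro (_ | i)
    · exact expandsOn_coset _ _
    · exact expandsOn_compl _
  have hipos : (0:ℝ) < ((H none).index : ℝ) := by
    exact_mod_cast Nat.pos_of_ne_zero (H none).index_ne_zero_of_finite
  have hB : ∏ i, B i = (∏ i, c i) * ((H none).index : ℕ) * 2 ^ S.card := by
    rw [Fintype.prod_option, Fintype.prod_option]
    have : ∏ i : ι, B (some i) = 2 ^ S.card * ∏ i : ι, c (some i) := by
      rw [← hcard, ← Finset.card_univ, ← Finset.prod_const, ← Finset.prod_mul_distrib]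
    rw [this]
    change 1 * _ = 1 / ((H none).index : ℝ) * _ * _ * _
    field_simp
  refine ⟨_, _, (H none).index, S, ?_, ?_, hS, hB ▸ hE, ?_⟩
  · refine Finset.prod_pos ?_
    rintro (_ | i) _
    · exact div_pos one_pos hipos
    · exact index_pos_aux _ (htop i)
  · exact index_U F K p hp
  · intro x hx
    have hx' : ∀ i, f i x ≠ 0 := fun i => Finset.prod_ne_zero_iff.1 hx i (Finset.mem_univ i)
    have h0 : x - γ ∈ H none := by
      by_contra hh
      exact hx' none (if_neg hh)
    have h1 : ∀ i : ι, x ∉ H (some i) := by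
      intro i hh
      exact hx' (some i) (if_pos hh)
    obtain ⟨y, hy⟩ := (hmem _ _).1 h0
    obtain ⟨b, rfl⟩ := hδ y
    have hp1 : p = (p - 1) + 1 := by have := hp.one_lt; omega
    set d : F[X] := 1 + (X - 1) ^ (p - 1) * b with hd
    have hxe : x = aeval (frobL F K) ((X - 1 : F[X]) * d) δ := by
      have e : (X - 1 : F[X]) * d = (X - 1) + (X - 1) ^ p * b := by
        rw [hd]
        conv_rhs => rw [hp1, pow_succ]
        ring
      rw [e, map_add, LinearMap.add_apply, aeval_mul_apply]
      change aeval (frobL F K) ((X - 1 : F[X]) ^ p) _ = x - γ at hy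
      rw [hy]
      change x = γ + (x - γ)
      ring
    rw [hxe]
    apply isOneNormal F K δ hδ
    rw [hn]
    apply IsCoprime.pow_right
    apply IsCoprime.mul_right
    · refine ⟨1, -((X - 1) ^ (p - 2) * b), ?_⟩
      have hp2 : p - 1 = (p - 2) + 1 := by have := hp.two_le; omega
      rw [hd, hp2, pow_succ]
      ring
    · by_contra hnc
      obtain ⟨Q, hQ, hQd, hQT⟩ : ∃ Q : F[X], Irreducible Q ∧ Q ∣ d ∧ Q ∣ T := by
        by_contra hno
        push Not at hno
        apply hnc
        exact isCoprime_of_irreducible_dvd (fun h => hT0 h.2) fun Q hQ h1 h2 => hno Q hQ h1 h2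
      obtain ⟨P', hP', hass⟩ :=
        UniqueFactorizationMonoid.exists_mem_normalizedFactors_of_dvd hT0 hQ hQT
      have hP'S : P' ∈ S := Multiset.mem_toFinset.2 hP'
      obtain ⟨e, he⟩ := hass.symm.dvd.trans hQd
      apply h1 ⟨P', hP'S⟩
      rw [hmem]
      refine ⟨aeval (frobL F K) ((X - 1 : F[X]) * e) δ, ?_⟩
      change aeval (frobL F K) P' _ = x
      rw [← aeval_mul_apply, hxe, he]
      congr 2
      ring
end

/-- Sieve criterion for `n = ps`, `p ∤ s`, `s ≥ 2`, `T = (xˢ-1)/(x-1)`: if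
`W(T)·W(q^{ps}-1) ≤ q^{p(s/2 - 1)}`, then there is a primitive `1`-normal element of
`F_{qⁿ}` over `F_q`. -/
theorem stmt_14 (p e q s : ℕ) (hp : p.Prime) (he : 0 < e) (hq : q = p ^ e)
    (hs : 2 ≤ s) (hpns : ¬ p ∣ s)
    (F K : Type) [Field F] [Fintype F] [Field K] [Fintype K] [Algebra F K]
    (hcF : Fintype.card F = q) (hrK : Module.finrank F K = p * s)
    (hsieve : (Wpoly ((X ^ s - 1 : F[X]) /ₘ (X - 1)) : ℝ) * (Wint (q ^ (p * s) - 1) : ℝ) ≤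
      (q : ℝ) ^ ((p : ℝ) * ((s : ℝ) / 2 - 1))) :
    ∃ α : K, IsPrimitiveElt α ∧ IskNormal q (p * s) 1 F α := by
  classical
  have : Fact p.Prime := ⟨hp⟩
  have hchar : CharP F p := by
    obtain ⟨p', hp'⟩ := CharP.exists F
    obtain ⟨k, hp'p, hk⟩ := FiniteField.card F p'
    have : p ∣ p' ^ (k : ℕ) := by
      rw [← hk, hcF, hq]; exact dvd_pow_self _ he.ne'
    have := (Nat.prime_dvd_prime_iff_eq hp hp'p).1 (hp.dvd_of_dvd_pow this)
    rwa [this]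
  have hm1 : (X - 1 : F[X]).Monic := monic_X_sub_C (1 : F)
  set T : F[X] := (X ^ s - 1 : F[X]) /ₘ (X - 1) with hTdef
  have hT : (X - 1) * T = X ^ s - 1 := by
    have h1 := modByMonic_add_div (X ^ s - 1 : F[X]) (X - 1 : F[X])
    rwa [(modByMonic_eq_zero_iff_dvd hm1).2 (sub_one_dvd_pow_sub_one X s), zero_add] at h1
  have hQ : Fintype.card K = q ^ (p * s) := by
    rw [Module.card_eq_pow_finrank (K := F), hcF, hrK]
  have hq1 : 1 < q := by rw [← hcF]; exact Fintype.one_lt_card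
  have hQ1 : 1 < q ^ (p * s) := by rw [← hQ]; exact Fintype.one_lt_card
  obtain ⟨f, a, ha, hf, hf'⟩ := mul_side K
  obtain ⟨g, b, m, S, hb, hm, hS, hg, hg'⟩ := add_side F K p s hp hs hpns hrK T hT
  have hT0 : T ≠ 0 := by
    intro h0
    rw [h0, mul_zero] at hT
    exact (monic_X_pow_sub_C (1 : F) (by omega : s ≠ 0)).ne_zero (by simpa using hT.symm)
  by_contra hcon
  have hz : ∀ u : Kˣ, f (Additive.ofMul u) * g u = 0 := by
    intro u
    by_contra hne
    refine hcon ⟨u, hf' u (left_ne_zero_of_mul hne), ?_⟩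
    have := hg' u (right_ne_zero_of_mul hne)
    rwa [hcF, hrK] at this
  have hmain := main_ineq f g a _ b _ ha hb hf hg hz
  have hW1 : ((2:ℝ) ^ S.card) ≤ Wpoly T := by exact_mod_cast Wpoly_ge T hT0 S hS
  have hW2 : ((2:ℝ) ^ (Fintype.card K - 1).primeFactors.card) ≤ Wint (q ^ (p * s) - 1) := by
    rw [hQ]
    exact_mod_cast Wint_ge (q ^ (p * s) - 1) (by omega)
  have hm' : (m : ℝ) ≤ (q : ℝ) ^ p := by rw [← hcF]; exact_mod_cast hm
  set R : ℝ := Real.sqrt (Fintype.card K) with hR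
  have hRsq : R * R = Fintype.card K := Real.mul_self_sqrt (by positivity)
  have hq0 : (0:ℝ) < q := by exact_mod_cast (by omega : 0 < q)
  have hRq : (q : ℝ) ^ p * (q : ℝ) ^ ((p : ℝ) * ((s : ℝ) / 2 - 1)) = R := by
    rw [hR, hQ, Real.sqrt_eq_rpow, Nat.cast_pow, ← Real.rpow_natCast, ← Real.rpow_natCast,
      ← Real.rpow_add hq0, ← Real.rpow_mul hq0.le]
    congr 1
    push_cast
    ring
  have hR1 : 1 < R := by
    rw [hR, Real.lt_sqrt (by norm_num), hQ]
    simp only [one_pow]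
    exact_mod_cast hQ1
  have hprod : (m : ℝ) * (2 ^ S.card * 2 ^ (Fintype.card K - 1).primeFactors.card) ≤ R := by
    rw [← hRq]
    refine mul_le_mul hm' (le_trans ?_ hsieve) (by positivity) (by positivity)
    exact mul_le_mul hW1 hW2 (by positivity) (by positivity)
  have hab : 0 < a * b := mul_pos ha hb
  have h3 : (Fintype.card K - 1 : ℝ) ≤
      ((m : ℝ) * (2 ^ S.card * 2 ^ (Fintype.card K - 1).primeFactors.card) - 1) * R := by
    refine le_of_mul_le_mul_left (hmain.trans_eq ?_) hab
    ring
  rw [← hRsq] at h3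
  nlinarith

end
end

section
/- Let q be a power of a prime p and let n = ps, where s ≥ 3 and gcd(p, s) = 1. Then there exists a primitive 1-normal element of F_{q^n} over F_q. -/
open Polynomial

noncomputable section

noncomputable section

/-- Dual form of an `ℓ¹` bound for the Fourier coefficients of `f`. -/
def RepB {G : Type*} [AddCommGroup G] [Fintype G] (f : G → ℂ) (c : ℝ) : Prop :=
  ∀ (g : G → ℂ) (B : ℝ), (∀ ψ : AddChar G ℂ, ‖∑ x, ψ x * g x‖ ≤ B) → ‖∑ x, f x * g x‖ ≤ c * B

lemma RepB.mul {G : Type*} [AddCommGroup G] [Fintype G] {f₁ f₂ : G → ℂ} {c₁ c₂ : ℝ}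
    (h₁ : RepB f₁ c₁) (h₂ : RepB f₂ c₂) : RepB (fun x => f₁ x * f₂ x) (c₁ * c₂) := by
  intro g B hB
  have := h₁ (fun x => f₂ x * g x) (c₂ * B) (by
    intro ψ
    have := h₂ (fun x => ψ x * g x) B (by
      intro ψ'
      have := hB (ψ' * ψ)
      simpa [AddChar.mul_apply, mul_assoc] using this)
    simpa [mul_left_comm] using this)
  simpa [mul_assoc] using this

lemma RepB.one {G : Type*} [AddCommGroup G] [Fintype G] : RepB (fun _ : G => (1 : ℂ)) 1 := by
  intro g B hB
  simpa using hB 1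

lemma RepB.prod {G ι : Type*} [AddCommGroup G] [Fintype G] (S : Finset ι) (f : ι → G → ℂ)
    (c : ι → ℝ) (h : ∀ i ∈ S, RepB (f i) (c i)) :
    RepB (fun x => ∏ i ∈ S, f i x) (∏ i ∈ S, c i) := by
  classical
  induction S using Finset.induction_on with
  | empty => simpa using RepB.one
  | insert a S ha ih =>
    simp only [Finset.prod_insert ha]
    exact (h a (by simp)).mul (ih fun i hi => h i (by simp [hi]))

lemma RepB.comp {G H : Type*} [AddCommGroup G] [Fintype G] [AddCommGroup H] [Fintype H]
    {f : H → ℂ} {c : ℝ} (h : RepB f c) (φ : G →+ H) : RepB (fun x => f (φ x)) c := by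
  classical
  intro g B hB
  have key : ∀ u : H → ℂ, ∑ y, u y * (∑ x with φ x = y, g x) = ∑ x, u (φ x) * g x := by
    intro u
    rw [← Finset.sum_fiberwise (s := Finset.univ) (g := fun x => φ x)]
    refine Finset.sum_congr rfl fun y _ => ?_
    rw [Finset.mul_sum]
    refine Finset.sum_congr rfl fun x hx => ?_
    rw [(Finset.mem_filter.1 hx).2]
  have := h (fun y => ∑ x with φ x = y, g x) B (by
    intro ψ
    rw [key]
    exact hB (ψ.compAddMonoidHom φ))
  rwa [key] at this

open Classical in
lemma indicator_eq {G : Type*} [AddCommGroup G] [Fintype G] (U : AddSubgroup G) (x : G) :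
    (if x ∈ U then (1 : ℂ) else 0) =
      (1 / (U.index : ℂ)) * ∑ ψ : AddChar (G ⧸ U) ℂ, ψ (QuotientAddGroup.mk' U x) := by
  rw [AddChar.sum_apply_eq_ite]
  have hne : (U.index : ℂ) ≠ 0 := by exact_mod_cast U.index_ne_zero_of_finite
  have hc : Fintype.card (G ⧸ U) = U.index := by
    rw [AddSubgroup.index, Nat.card_eq_fintype_card]
  rw [hc]
  by_cases hx : x ∈ U
  · have : (QuotientAddGroup.mk' U x) = 0 := by simpa using hx
    rw [if_pos hx, if_pos this]; field_simp
  · have : ¬ (QuotientAddGroup.mk' U x) = 0 := by simpa using hx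
    rw [if_neg hx, if_neg this]; simp

open Classical in
lemma RepB.ind {G : Type*} [AddCommGroup G] [Fintype G] (U : AddSubgroup G) :
    RepB (fun x => if x ∈ U then (1 : ℂ) else 0) 1 := by
  intro g B hB
  have hne : (U.index : ℝ) ≠ 0 := by exact_mod_cast U.index_ne_zero_of_finite
  have hc : Fintype.card (G ⧸ U) = U.index := by
    rw [AddSubgroup.index, Nat.card_eq_fintype_card]
  have e : ∑ x, (if x ∈ U then (1 : ℂ) else 0) * g x = (1 / (U.index : ℂ)) *
      ∑ ψ : AddChar (G ⧸ U) ℂ, ∑ x, ψ (QuotientAddGroup.mk' U x) * g x := by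
    rw [Finset.sum_comm, Finset.mul_sum]
    refine Finset.sum_congr rfl fun x _ => ?_
    rw [indicator_eq, mul_assoc, Finset.sum_mul]
  rw [e, norm_mul]
  have h2 : ‖∑ ψ : AddChar (G ⧸ U) ℂ, ∑ x, ψ (QuotientAddGroup.mk' U x) * g x‖ ≤ U.index * B := by
    refine (norm_sum_le _ _).trans ((Finset.sum_le_sum (g := fun _ => B) fun ψ _ =>
      hB (ψ.compAddMonoidHom (QuotientAddGroup.mk' U))).trans ?_)
    simp [hc]
  calc _ ≤ ‖1 / (U.index : ℂ)‖ * (U.index * B) := by gcongr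
    _ = 1 * B := by simp; field_simp

open Classical in
lemma RepB.one_sub_ind {G : Type*} [AddCommGroup G] [Fintype G] (U : AddSubgroup G) :
    RepB (fun x => 1 - if x ∈ U then (1 : ℂ) else 0) (2 * (1 - 1 / (U.index : ℝ))) := by
  intro g B hB
  have hpos : 0 < U.index := Nat.pos_of_ne_zero U.index_ne_zero_of_finite
  have hne : (U.index : ℝ) ≠ 0 := by positivity
  have hneC : (U.index : ℂ) ≠ 0 := by exact_mod_cast U.index_ne_zero_of_finite
  have hc : Fintype.card (G ⧸ U) = U.index := by
    rw [AddSubgroup.index, Nat.card_eq_fintype_card]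
  have e : ∑ x, (1 - if x ∈ U then (1 : ℂ) else 0) * g x = ((1 - 1 / (U.index : ℝ) : ℝ) : ℂ) *
      (∑ x, (1 : AddChar G ℂ) x * g x) - (1 / (U.index : ℂ)) *
      ∑ ψ ∈ (Finset.univ : Finset (AddChar (G ⧸ U) ℂ)).erase 1,
        ∑ x, ψ (QuotientAddGroup.mk' U x) * g x := by
    have h1 : ∑ x, (if x ∈ U then (1 : ℂ) else 0) * g x = (1 / (U.index : ℂ)) *
        ∑ ψ : AddChar (G ⧸ U) ℂ, ∑ x, ψ (QuotientAddGroup.mk' U x) * g x := by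
      rw [Finset.sum_comm, Finset.mul_sum]
      refine Finset.sum_congr rfl fun x _ => ?_
      rw [indicator_eq, mul_assoc, Finset.sum_mul]
    simp only [sub_mul, Finset.sum_sub_distrib]
    rw [h1, ← Finset.add_sum_erase _ _ (Finset.mem_univ (1 : AddChar (G ⧸ U) ℂ))]
    simp
    ring
  rw [e]
  have h2 : ‖∑ ψ ∈ (Finset.univ : Finset (AddChar (G ⧸ U) ℂ)).erase 1,
      ∑ x, ψ (QuotientAddGroup.mk' U x) * g x‖ ≤ (U.index - 1) * B := by
    refine (norm_sum_le _ _).trans ((Finset.sum_le_sum (g := fun _ => B) fun ψ _ =>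
      hB (ψ.compAddMonoidHom (QuotientAddGroup.mk' U))).trans ?_)
    rw [Finset.sum_const, Finset.card_erase_of_mem (Finset.mem_univ _), Finset.card_univ,
      AddChar.card_eq, hc, nsmul_eq_mul, Nat.cast_sub hpos]
    simp
  have h3 : (0 : ℝ) ≤ 1 - 1 / (U.index : ℝ) := by
    rw [sub_nonneg, div_le_one (by positivity)]
    exact_mod_cast hpos
  refine (norm_sub_le _ _).trans ?_
  rw [norm_mul, norm_mul, Complex.norm_real, Real.norm_of_nonneg h3]
  calc _ ≤ (1 - 1 / (U.index : ℝ)) * B + ‖1 / (U.index : ℂ)‖ * ((U.index - 1) * B) := by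
        gcongr
        exact hB 1
    _ = _ := by simp; field_simp; ring

lemma RepB.mean {G : Type*} [AddCommGroup G] [Fintype G] {f : G → ℂ} {c d : ℝ} (h : RepB f c)
    (hd : 0 ≤ d) (hf : ∑ x, f x = d * Fintype.card G)
    (g : G → ℂ) (B : ℝ) (hB0 : 0 ≤ B) (hB : ∀ ψ : AddChar G ℂ, ψ ≠ 1 → ‖∑ x, ψ x * g x‖ ≤ B) :
    ‖∑ x, f x * g x - d * ∑ x, g x‖ ≤ (c - d) * B := by
  classical
  set Y := ∑ x, f x * g x - d * ∑ x, g x with hY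
  obtain ⟨u, hu, hYu⟩ : ∃ u : ℂ, ‖u‖ = 1 ∧ Y = ‖Y‖ * u := by
    by_cases h0 : Y = 0
    · exact ⟨1, by simp, by simp [h0]⟩
    · have : (‖Y‖ : ℂ) ≠ 0 := by simpa using h0
      refine ⟨Y / ‖Y‖, ?_, by field_simp⟩
      rw [norm_div, Complex.norm_real, norm_norm, div_self (by simpa using h0)]
  have hcard : (Fintype.card G : ℂ) ≠ 0 := by exact_mod_cast Fintype.card_ne_zero
  set τ : ℂ := (B * u - ∑ x, g x) / Fintype.card G with hτ
  have hsum : ∑ x, (g x + τ) = B * u := by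
    rw [Finset.sum_add_distrib, Finset.sum_const, Finset.card_univ, nsmul_eq_mul, hτ]
    field_simp; ring
  have key := h (fun x => g x + τ) B (by
    intro ψ
    by_cases hψ : ψ = 1
    · subst hψ
      simp only [AddChar.one_apply, one_mul]
      rw [hsum]; simp [hu, abs_of_nonneg hB0]
    · have := hB ψ hψ
      have h0 : ∑ x, ψ x = 0 := by
        have := AddChar.sum_eq_zero_iff_ne_zero (ψ := ψ)
        exact this.2 (by simpa [AddChar.one_eq_zero] using hψ)
      simp only [mul_add, Finset.sum_add_distrib, ← Finset.sum_mul, h0, zero_mul, add_zero]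
      exact this)
  have e : ∑ x, f x * (g x + τ) = ((‖Y‖ + d * B : ℝ) : ℂ) * u := by
    simp only [mul_add, Finset.sum_add_distrib, ← Finset.sum_mul, hf]
    have : ∑ x, f x * g x = Y + d * ∑ x, g x := by rw [hY]; ring
    rw [this, hτ]
    push_cast
    rw [add_mul, ← hYu]
    field_simp; ring
  rw [e, norm_mul, hu, mul_one, Complex.norm_real, Real.norm_of_nonneg (by positivity)] at key
  linarith

open Classical in
/-- the sieve indicator function -/
def sieveFun {G ι : Type*} [AddCommGroup G] (S : Finset ι) (U : ι → AddSubgroup G) (x : G) : ℂ :=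
  if ∀ i ∈ S, x ∉ U i then 1 else 0

open Classical in
lemma sieveFun_eq {G ι : Type*} [AddCommGroup G] (S : Finset ι) (U : ι → AddSubgroup G) (x : G) :
    sieveFun S U x = ∏ i ∈ S, (1 - if x ∈ U i then (1 : ℂ) else 0) := by
  unfold sieveFun
  split_ifs with h
  · exact (Finset.prod_eq_one fun i hi => by simp [h i hi]).symm
  · push Not at h
    obtain ⟨i, hi, hx⟩ := h
    exact (Finset.prod_eq_zero hi (by simp [hx])).symm

lemma sieveFun_sum {G ι : Type*} [AddCommGroup G] [Fintype G] (S : Finset ι)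
    (U : ι → AddSubgroup G) (m : ι → ℕ) (hm : ∀ i ∈ S, m i ≠ 0)
    (H : ∀ S' ⊆ S, Nat.card {x : G // ∀ i ∈ S', x ∈ U i} * ∏ i ∈ S', m i = Fintype.card G) :
    ∑ x, sieveFun S U x = ((∏ i ∈ S, (1 - 1 / (m i : ℝ)) : ℝ) : ℂ) * Fintype.card G := by
  classical
  simp only [sieveFun_eq]
  simp only [Finset.prod_sub, Finset.prod_const_one, mul_one]
  rw [Finset.sum_comm, Complex.ofReal_sum, Finset.sum_mul]
  refine Finset.sum_congr rfl fun S' hS' => ?_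
  have hS := Finset.mem_powerset.1 hS'
  rw [← Finset.mul_sum]
  have e : ∑ x : G, ∏ i ∈ S', (if x ∈ U i then (1 : ℂ) else 0)
      = Nat.card {x : G // ∀ i ∈ S', x ∈ U i} := by
    simp only [Finset.prod_ite_zero, Finset.prod_const_one]
    rw [Nat.card_eq_fintype_card, Fintype.card_subtype]
    simp
  rw [e]
  have h1 := H S' hS
  have h2 : (∏ i ∈ S', (m i : ℂ)) ≠ 0 :=
    Finset.prod_ne_zero_iff.2 fun i hi => by exact_mod_cast hm i (hS hi)
  rw [← h1]
  push_cast
  simp only [one_div, Finset.prod_inv_distrib]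
  field_simp

lemma sieveFun_rep {G ι : Type*} [AddCommGroup G] [Fintype G] (S : Finset ι)
    (U : ι → AddSubgroup G) (m : ι → ℕ) 
    (H : ∀ S' ⊆ S, Nat.card {x : G // ∀ i ∈ S', x ∈ U i} * ∏ i ∈ S', m i = Fintype.card G) :
    RepB (sieveFun S U) (2 ^ S.card * ∏ i ∈ S, (1 - 1 / (m i : ℝ))) := by
  classical
  have h1 := RepB.prod S (fun i x => 1 - if x ∈ U i then (1 : ℂ) else 0)
    (fun i => 2 * (1 - 1 / (m i : ℝ))) (by
      intro i hi
      have h1 := H {i} (by simpa using hi)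
      have h2 : (U i).index = m i := by
        have h3 := (U i).card_mul_index
        simp only [Finset.mem_singleton, forall_eq, Finset.prod_singleton] at h1
        have h4 : Nat.card {x : G // x ∈ U i} = Nat.card (U i) := rfl
        rw [h4, ← Nat.card_eq_fintype_card, ← h3] at h1
        exact (Nat.eq_of_mul_eq_mul_left Nat.card_pos h1).symm
      rw [← h2]
      exact RepB.one_sub_ind (U i))
  rw [Finset.prod_mul_distrib, Finset.prod_const] at h1
  have e : sieveFun S U = fun x => ∏ i ∈ S, (1 - if x ∈ U i then (1 : ℂ) else 0) :=
    funext fun x => sieveFun_eq S U x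
  rw [e]; exact h1

end

noncomputable section

lemma gauss_le {K : Type*} [Field K] [Fintype K] (χ : MulChar K ℂ) (hχ : χ ≠ 1)
    (ψ : AddChar K ℂ) : ‖∑ x, ψ x * χ x‖ ≤ Real.sqrt (Fintype.card K) := by
  have e : ∑ x, ψ x * χ x = gaussSum χ ψ := by
    unfold gaussSum
    exact Finset.sum_congr rfl fun x _ => mul_comm _ _
  rw [e]
  by_cases hψ : ψ = 1
  · rw [hψ, gaussSum_one_right hχ]; simp
  · have h := gaussSum_mul_gaussSum_eq_card hχ (AddChar.IsPrimitive.of_ne_one hψ)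
    rw [← star_gaussSum_eq] at h
    have h2 : ‖gaussSum χ ψ‖ ^ 2 = Fintype.card K := by
      have := congrArg norm h
      rw [norm_mul, norm_star] at this
      rw [sq, this]; simp
    rw [← h2, Real.sqrt_sq (norm_nonneg _)]

/-- subgroup of elements killed by the exponent `d` -/
def killU (K : Type*) [Field K] (d : ℕ) : AddSubgroup (Additive Kˣ) :=
  Subgroup.toAddSubgroup (powMonoidHom d : Kˣ →* Kˣ).ker

lemma mem_killU {K : Type*} [Field K] (d : ℕ) (x : Additive Kˣ) :
    x ∈ killU K d ↔ (x.toMul) ^ d = 1 := by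
  unfold killU
  rfl

lemma killU_iff {K : Type*} [Field K] [Fintype K] (M : ℕ) (hM : M = Fintype.card K - 1)
    (S : Finset ℕ) (hS : ∀ l ∈ S, l.Prime ∧ l ∣ M) (x : Kˣ) :
    (∀ l ∈ S, x ^ (M / l) = 1) ↔ x ^ (M / ∏ l ∈ S, l) = 1 := by
  classical
  have hM0 : 0 < M := by have := Fintype.one_lt_card (α := K); omega
  have hx : orderOf x ∣ M := by
    rw [hM, ← Fintype.card_units]; exact orderOf_dvd_card
  have hP : ∏ l ∈ S, l ∣ M :=
    Finset.prod_primes_dvd M (fun l hl => (hS l hl).1.prime) fun l hl => (hS l hl).2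
  have key : ∀ d, d ∣ M → (x ^ (M / d) = 1 ↔ d ∣ M / orderOf x) := by
    intro d hd
    rw [← orderOf_dvd_iff_pow_eq_one, Nat.dvd_div_iff_mul_dvd hd, Nat.dvd_div_iff_mul_dvd hx,
      mul_comm]
  rw [key _ hP]
  constructor
  · intro h
    exact Finset.prod_primes_dvd _ (fun l hl => (hS l hl).1.prime) fun l hl =>
      (key l (hS l hl).2).1 (h l hl)
  · intro h l hl
    exact (key l (hS l hl).2).2 ((Finset.dvd_prod_of_mem _ hl).trans h)

lemma killU_card {K : Type*} [Field K] [Fintype K] (M : ℕ) (hM : M = Fintype.card K - 1)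
    (S : Finset ℕ) (hS : ∀ l ∈ S, l.Prime ∧ l ∣ M) :
    Nat.card {x : Additive Kˣ // ∀ l ∈ S, x ∈ killU K (M / l)} * ∏ l ∈ S, l = M := by
  classical
  have hP : ∏ l ∈ S, l ∣ M :=
    Finset.prod_primes_dvd M (fun l hl => (hS l hl).1.prime) fun l hl => (hS l hl).2
  have e : Nat.card {x : Additive Kˣ // ∀ l ∈ S, x ∈ killU K (M / l)} =
      Nat.card (powMonoidHom (M / ∏ l ∈ S, l) : Kˣ →* Kˣ).ker := by
    refine Nat.card_congr (Equiv.subtypeEquiv Additive.toMul ?_)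
    intro x
    simp only [mem_killU]
    rw [killU_iff M hM S hS, MonoidHom.mem_ker, powMonoidHom_apply]
  rw [e, IsCyclic.card_powMonoidHom_ker, Nat.card_eq_fintype_card, Fintype.card_units, ← hM,
    Nat.gcd_eq_right (Nat.div_dvd_of_dvd hP), Nat.div_mul_cancel hP]

lemma mult_sieve {K : Type*} [Field K] [Fintype K] (M : ℕ) (hM : M = Fintype.card K - 1)
    (S : Finset ℕ) (hS : ∀ l ∈ S, l.Prime ∧ l ∣ M) (A : Finset K) (hA : 0 ∉ A) (B : ℝ)
    (hB0 : 0 ≤ B) (hB : ∀ χ : MulChar K ℂ, χ ≠ 1 → ‖∑ a ∈ A, χ a‖ ≤ B)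
    (hlt : (2 ^ S.card - 1) * B < A.card) :
    ∃ a ∈ A, ∀ l ∈ S, a ^ (M / l) ≠ 1 := by
  classical
  have hM0 : 0 < M := by have := Fintype.one_lt_card (α := K); omega
  by_contra hcon
  push Not at hcon
  have hcard : Fintype.card (Additive Kˣ) = M := by
    rw [hM, ← Fintype.card_units]; exact Fintype.card_congr Additive.toMul
  have H : ∀ S' ⊆ S, Nat.card {x : Additive Kˣ // ∀ l ∈ S', x ∈ killU K (M / l)} * ∏ l ∈ S', l
      = Fintype.card (Additive Kˣ) := by
    intro S' hS'
    rw [hcard]; exact killU_card M hM S' fun l hl => hS l (hS' hl)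
  have hsum := sieveFun_sum S (fun l => killU K (M / l)) (fun l => l)
    (fun l hl => (hS l hl).1.ne_zero) H
  have hrep := sieveFun_rep S (fun l => killU K (M / l)) (fun l => l) H
  set d : ℝ := ∏ l ∈ S, (1 - 1 / (l : ℝ)) with hd
  have hdpos : 0 < d := by
    refine Finset.prod_pos fun l hl => ?_
    have : (1 : ℝ) < l := by exact_mod_cast (hS l hl).1.one_lt
    rw [sub_pos, div_lt_one (by linarith)]; exact this
  set g : Additive Kˣ → ℂ := fun x => if ((x.toMul : Kˣ) : K) ∈ A then 1 else 0 with hg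
  have conv : ∀ u : K → ℂ, ∑ x : Additive Kˣ, u ((x.toMul : Kˣ) : K) * g x = ∑ a ∈ A, u a := by
    intro u
    have h1 : ∑ x : Additive Kˣ, u ((x.toMul : Kˣ) : K) * g x
        = ∑ x : Additive Kˣ with ((x.toMul : Kˣ) : K) ∈ A, u ((x.toMul : Kˣ) : K) := by
      rw [Finset.sum_filter]
      exact Finset.sum_congr rfl fun x _ => by simp [hg]
    rw [h1]
    refine Finset.sum_bij (fun x _ => ((x.toMul : Kˣ) : K)) ?_ ?_ ?_ ?_
    · intro x hx; exact (Finset.mem_filter.1 hx).2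
    · intro x _ y _ hxy
      exact Additive.toMul.injective (Units.ext hxy)
    · intro a ha
      have ha0 : a ≠ 0 := fun h => hA (h ▸ ha)
      exact ⟨Additive.ofMul (Units.mk0 a ha0), by simp [ha], by simp⟩
    · intro x _; rfl
  have hmean := hrep.mean hdpos.le hsum g B hB0 (by
    intro ψ hψ
    set f : Kˣ →* ℂ := 
      { toFun := fun x => ψ (Additive.ofMul x)
        map_one' := by simp
        map_mul' := fun x y => by rw [ofMul_mul, AddChar.map_add_eq_mul] } with hf
    set χ : MulChar K ℂ := MulChar.ofUnitHom f.toHomUnits with hχ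
    have hχv : ∀ x : Additive Kˣ, χ ((x.toMul : Kˣ) : K) = ψ x := by
      intro x
      rw [hχ, MulChar.ofUnitHom_coe]
      rfl
    have hχ1 : χ ≠ 1 := by
      intro h1
      apply hψ
      ext x
      rw [← hχv x, h1]; simp
    have := hB χ hχ1
    rw [← conv (fun a => χ a)] at this
    simpa only [hχv] using this)
  have hz : ∑ x, sieveFun S (fun l => killU K (M / l)) x * g x = 0 := by
    refine Finset.sum_eq_zero fun x _ => ?_
    by_cases hx : ((x.toMul : Kˣ) : K) ∈ A
    · obtain ⟨l, hl, h⟩ := hcon _ hx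
      have : sieveFun S (fun l => killU K (M / l)) x = 0 := by
        unfold sieveFun
        rw [if_neg]
        push Not
        refine ⟨l, hl, ?_⟩
        rw [mem_killU]
        exact Units.ext (by simpa using h)
      rw [this, zero_mul]
    · simp [hg, hx]
  have hgA : ∑ x, g x = A.card := by
    have := conv (fun _ => 1)
    simpa using this
  rw [hz, hgA, zero_sub, norm_neg, norm_mul, Complex.norm_real, Real.norm_of_nonneg hdpos.le,
    Complex.norm_natCast] at hmean
  have : d * ((2 ^ S.card - 1) * B) < d * A.card := by gcongr
  nlinarith
end

noncomputable section

/-- Frobenius as a linear map -/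
abbrev frobT (F K : Type*) [Field F] [Fintype F] [Field K] [Algebra F K] : K →ₗ[F] K :=
  (FiniteField.frobeniusAlgHom F K).toLinearMap

lemma frobT_pow_apply {F K : Type*} [Field F] [Fintype F] [Field K] [Algebra F K] (i : ℕ) (a : K) :
    (frobT F K ^ i) a = a ^ (Fintype.card F) ^ i := by
  induction i with
  | zero => simp
  | succ i ih =>
    rw [pow_succ', Module.End.mul_apply, ih]
    simp [pow_succ, pow_mul]

/-- kernel of a polynomial in Frobenius -/
abbrev kerP (F K : Type*) [Field F] [Fintype F] [Field K] [Algebra F K] (h : F[X]) :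
    Submodule F K := LinearMap.ker (aeval (frobT F K) h)

lemma mem_kerP_of_dvd {F K : Type*} [Field F] [Fintype F] [Field K] [Algebra F K] {h k : F[X]}
    (hk : h ∣ k) {x : K} (hx : x ∈ kerP F K h) : x ∈ kerP F K k := by
  obtain ⟨c, rfl⟩ := hk
  rw [LinearMap.mem_ker] at *
  rw [mul_comm, map_mul, Module.End.mul_apply, hx, map_zero]

lemma kerP_lincomb {F K : Type*} [Field F] [Fintype F] [Field K] [Algebra F K] {h k : F[X]}
    (a b : F[X]) {x : K} (hx : x ∈ kerP F K h) (hx' : x ∈ kerP F K k) :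
    x ∈ kerP F K (a * h + b * k) := by
  rw [LinearMap.mem_ker] at *
  rw [map_add, LinearMap.add_apply, map_mul, map_mul, Module.End.mul_apply, Module.End.mul_apply,
    hx, hx']
  simp

lemma aeval_frob {F K : Type*} [Field F] [Fintype F] [Field K] [Algebra F K] (h : F[X]) (x : K) :
    aeval (frobT F K) h x =
      ∑ i ∈ Finset.range (h.natDegree + 1), h.coeff i • x ^ (Fintype.card F) ^ i := by
  rw [aeval_eq_sum_range, LinearMap.sum_apply]
  refine Finset.sum_congr rfl fun i _ => ?_
  rw [LinearMap.smul_apply, frobT_pow_apply]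

lemma kerP_card_le {F K : Type*} [Field F] [Fintype F] [Field K] [Fintype K] [Algebra F K]
    (h : F[X]) (h0 : h ≠ 0) : Nat.card (kerP F K h) ≤ (Fintype.card F) ^ h.natDegree := by
  classical
  set q := Fintype.card F with hq
  have hq1 : 1 < q := Fintype.one_lt_card
  set P : K[X] := ∑ i ∈ Finset.range (h.natDegree + 1),
    C (algebraMap F K (h.coeff i)) * X ^ q ^ i with hP
  have hcoeff : P.coeff (q ^ h.natDegree) = algebraMap F K h.leadingCoeff := by
    rw [hP, finsetSum_coeff, Finset.sum_eq_single h.natDegree]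
    · simp
    · intro i _ hi
      rw [coeff_C_mul_X_pow, if_neg]
      intro he
      exact hi (Nat.pow_right_injective hq1 he).symm
    · simp
  have hP0 : P ≠ 0 := by
    intro h1
    rw [h1, coeff_zero] at hcoeff
    exact h0 (leadingCoeff_eq_zero.1 ((map_eq_zero _).1 hcoeff.symm))
  have hdeg : P.natDegree ≤ q ^ h.natDegree := by
    refine natDegree_sum_le_of_forall_le _ _ fun i hi => ?_
    refine (natDegree_C_mul_X_pow_le _ _).trans ?_
    exact Nat.pow_le_pow_right hq1.le (by simpa [Nat.lt_succ_iff] using hi)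
  have hsub : (Finset.univ.filter fun x : K => x ∈ kerP F K h) ⊆ P.roots.toFinset := by
    intro x hx
    have hx := (Finset.mem_filter.1 hx).2
    rw [LinearMap.mem_ker, aeval_frob] at hx
    rw [Multiset.mem_toFinset, mem_roots hP0, IsRoot, hP, eval_finsetSum, ← hx]
    exact Finset.sum_congr rfl fun i _ => by simp [Algebra.smul_def, hq]
  calc Nat.card (kerP F K h) = (Finset.univ.filter fun x : K => x ∈ kerP F K h).card := by
        rw [Nat.card_eq_fintype_card, Fintype.card_subtype]
    _ ≤ P.roots.toFinset.card := Finset.card_le_card hsub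
    _ ≤ P.natDegree := (Multiset.toFinset_card_le _).trans (card_roots' _)
    _ ≤ _ := hdeg

lemma kerP_top {F K : Type*} [Field F] [Fintype F] [Field K] [Fintype K] [Algebra F K] (x : K) :
    x ∈ kerP F K (X ^ Module.finrank F K - 1) := by
  rw [LinearMap.mem_ker, map_sub, map_pow, aeval_X, map_one, LinearMap.sub_apply, frobT_pow_apply,
    ← Module.card_eq_pow_finrank, FiniteField.pow_card]
  simp

lemma kerP_card {F K : Type*} [Field F] [Fintype F] [Field K] [Fintype K] [Algebra F K]
    (h : F[X]) (hd : h ∣ X ^ Module.finrank F K - 1) :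
    Nat.card (kerP F K h) = (Fintype.card F) ^ h.natDegree := by
  classical
  set q := Fintype.card F with hq
  have hn : 0 < Module.finrank F K := Module.finrank_pos
  have hX0 : (X ^ Module.finrank F K - 1 : F[X]) ≠ 0 := X_pow_sub_C_ne_zero hn 1
  obtain ⟨k, hk⟩ := hd
  have hh0 : h ≠ 0 := by rintro rfl; simp [hX0] at hk
  have hk0 : k ≠ 0 := by rintro rfl; simp [hX0] at hk
  have hdeg : h.natDegree + k.natDegree = Module.finrank F K := by
    rw [← natDegree_mul hh0 hk0, ← hk]; exact natDegree_X_pow_sub_C (r := (1 : F))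
  refine le_antisymm (kerP_card_le h hh0) ?_
  have hr : Nat.card (LinearMap.range (aeval (frobT F K) h)) ≤ q ^ k.natDegree := by
    refine le_trans ?_ (kerP_card_le (K := K) k hk0)
    refine Nat.card_mono (Set.toFinite _) ?_
    rintro _ ⟨x, rfl⟩
    show _ ∈ kerP F K k
    rw [LinearMap.mem_ker, ← Module.End.mul_apply, ← map_mul, mul_comm, ← hk]
    exact kerP_top x
  have hprod : Nat.card (kerP F K h) * Nat.card (LinearMap.range (aeval (frobT F K) h))
      = q ^ Module.finrank F K := by
    rw [← Module.card_eq_pow_finrank (K := F) (V := K), ← Nat.card_eq_fintype_card,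
      Submodule.card_eq_card_quotient_mul_card (kerP F K h)]
    congr 1
    exact Nat.card_congr (LinearMap.quotKerEquivRange _).toEquiv.symm
  rw [← hdeg, pow_add] at hprod
  have hq0 : 0 < q := Fintype.card_pos
  by_contra hlt
  push Not at hlt
  have : Nat.card (kerP F K h) * Nat.card (LinearMap.range (aeval (frobT F K) h))
      < q ^ h.natDegree * q ^ k.natDegree :=
    Nat.mul_lt_mul_of_lt_of_le hlt hr (by positivity)
  omega

lemma kerP_inter {F K : Type*} [Field F] [Fintype F] [Field K] [Algebra F K]
    (g : F[X]) (S : Finset F[X]) (hS0 : ∀ f ∈ S, f ≠ 0)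
    (hcop : (S : Set F[X]).Pairwise IsCoprime) (hdvd : ∏ f ∈ S, f ∣ g) (x : K) :
    (x ∈ kerP F K g ∧ ∀ f ∈ S, x ∈ kerP F K (g / f)) ↔ x ∈ kerP F K (g / ∏ f ∈ S, f) := by
  classical
  constructor
  · induction S using Finset.induction_on with
    | empty => simp
    | insert f S hf ih =>
      rintro ⟨hg, hall⟩
      rw [Finset.prod_insert hf] at hdvd ⊢
      have hcop' : IsCoprime f (∏ f ∈ S, f) := by
        refine IsCoprime.prod_right fun k hk => hcop (by simp) (by simp [hk]) ?_
        rintro rfl; exact hf hk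
      have h1 := ih (fun k hk => hS0 k (by simp [hk])) (hcop.mono (by simp))
        ((dvd_mul_left _ _).trans hdvd) ⟨hg, fun k hk => hall k (by simp [hk])⟩
      have h2 := hall f (by simp)
      obtain ⟨c, rfl⟩ := hdvd
      obtain ⟨a, b, hab⟩ := hcop'
      have hf0 : f ≠ 0 := hS0 f (by simp)
      have hp0 : ∏ f ∈ S, f ≠ 0 := Finset.prod_ne_zero_iff.2 fun k hk => hS0 k (by simp [hk])
      have e1 : f * (∏ f ∈ S, f) * c / (f * ∏ f ∈ S, f) = c :=
        mul_div_cancel_left₀ _ (mul_ne_zero hf0 hp0)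
      have e2 : f * (∏ f ∈ S, f) * c / f = (∏ f ∈ S, f) * c := by
        rw [mul_assoc]; exact mul_div_cancel_left₀ _ hf0
      have e3 : f * (∏ f ∈ S, f) * c / (∏ f ∈ S, f) = f * c := by
        rw [mul_comm f, mul_assoc]; exact mul_div_cancel_left₀ _ hp0
      rw [e1]; rw [e2] at h2; rw [e3] at h1
      have := kerP_lincomb a b h1 h2
      rwa [← mul_assoc, ← mul_assoc, ← add_mul, hab, one_mul] at this
  · intro hx
    have hp0 : ∏ f ∈ S, f ≠ 0 := Finset.prod_ne_zero_iff.2 fun k hk => hS0 k hk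
    refine ⟨mem_kerP_of_dvd (EuclideanDomain.div_dvd_of_dvd hdvd) hx, fun f hf => ?_⟩
    refine mem_kerP_of_dvd ?_ hx
    obtain ⟨c, rfl⟩ := hdvd
    rw [mul_div_cancel_left₀ _ hp0, ← Finset.mul_prod_erase S _ hf, mul_assoc,
      mul_div_cancel_left₀ _ (hS0 f hf)]
    exact dvd_mul_left _ _

open Classical in
/-- elements of Frobenius order exactly `g` -/
def setA (F K : Type*) [Field F] [Fintype F] [Field K] [Fintype K] [Algebra F K]
    (g : F[X]) (S : Finset F[X]) : Finset K :=
  Finset.univ.filter fun x => x ∈ kerP F K g ∧ ∀ f ∈ S, x ∉ kerP F K (g / f)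

lemma add_bound {F K : Type*} [Field F] [Fintype F] [Field K] [Fintype K] [Algebra F K]
    (g : F[X]) (hg : g ∣ X ^ Module.finrank F K - 1) (S : Finset F[X]) (hS0 : ∀ f ∈ S, f ≠ 0)
    (hS1 : ∀ f ∈ S, 0 < f.natDegree)
    (hcop : (S : Set F[X]).Pairwise IsCoprime) (hdvd : ∏ f ∈ S, f ∣ g) (δ : ℝ)
    (hδ : δ = ∏ f ∈ S, (1 - 1 / (((Fintype.card F) ^ f.natDegree : ℕ) : ℝ))) :
    ((setA F K g S).card : ℝ) = δ * (Fintype.card F) ^ g.natDegree ∧ 0 < δ ∧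
    ∀ χ : MulChar K ℂ, χ ≠ 1 → ‖∑ a ∈ setA F K g S, χ a‖ ≤
      (2 ^ S.card * δ - δ * (Fintype.card F) ^ g.natDegree / Fintype.card K) *
        Real.sqrt (Fintype.card K) := by
  classical
  set q := Fintype.card F with hq
  have hq1 : 1 < q := Fintype.one_lt_card
  have hg0 : g ≠ 0 := by
    rintro rfl
    exact X_pow_sub_C_ne_zero (Module.finrank_pos (R := F) (M := K)) (1 : F) (by simpa using hg)
  set G := kerP F K g with hG
  set U : F[X] → AddSubgroup G := fun f => ((kerP F K (g / f)).comap G.subtype).toAddSubgroup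
    with hU
  have hmemU : ∀ f (x : G), x ∈ U f ↔ (x : K) ∈ kerP F K (g / f) := fun f x => Iff.rfl
  have hcardG : Fintype.card G = q ^ g.natDegree := by
    rw [← Nat.card_eq_fintype_card]; exact kerP_card g hg
  have H : ∀ S' ⊆ S, Nat.card {x : G // ∀ f ∈ S', x ∈ U f} * ∏ f ∈ S', q ^ f.natDegree
      = Fintype.card G := by
    intro S' hS'
    have hd' : ∏ f ∈ S', f ∣ g := (Finset.prod_dvd_prod_of_subset _ _ _ hS').trans hdvd
    have e : Nat.card {x : G // ∀ f ∈ S', x ∈ U f} = Nat.card (kerP F K (g / ∏ f ∈ S', f)) := by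
      refine Nat.card_congr ⟨fun x => ⟨x.1.1, ?_⟩, fun x => ⟨⟨x.1, ?_⟩, ?_⟩, ?_, ?_⟩
      · exact (kerP_inter g S' (fun f hf => hS0 f (hS' hf)) (hcop.mono hS') hd' _).1
          ⟨x.1.2, fun f hf => x.2 f hf⟩
      · exact ((kerP_inter g S' (fun f hf => hS0 f (hS' hf)) (hcop.mono hS') hd' _).2 x.2).1
      · intro f hf
        exact ((kerP_inter g S' (fun f hf => hS0 f (hS' hf)) (hcop.mono hS') hd' _).2 x.2).2 f hf
      · intro x; rfl
      · intro x; rfl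
    rw [e, kerP_card _ ((EuclideanDomain.div_dvd_of_dvd hd').trans hg), hcardG,
      Finset.prod_pow_eq_pow_sum, ← pow_add, ← natDegree_prod _ _ fun f hf => hS0 f (hS' hf)]
    congr 1
    have hp0 : ∏ f ∈ S', f ≠ 0 := Finset.prod_ne_zero_iff.2 fun k hk => hS0 k (hS' hk)
    obtain ⟨c, rfl⟩ := hd'
    rw [mul_div_cancel_left₀ _ hp0, natDegree_mul hp0 (right_ne_zero_of_mul hg0), add_comm]
  have hsum := sieveFun_sum S U (fun f => q ^ f.natDegree) (fun f _ => by positivity) H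
  have hrep := sieveFun_rep S U (fun f => q ^ f.natDegree) H
  rw [← hδ] at hsum hrep
  have hδpos : 0 < δ := by
    rw [hδ]
    refine Finset.prod_pos fun f hf => ?_
    have : (1 : ℝ) < ((q ^ f.natDegree : ℕ) : ℝ) := by
      exact_mod_cast Nat.one_lt_pow (hS1 f hf).ne' hq1
    rw [sub_pos, div_lt_one (by linarith)]; exact this
  obtain ⟨π, hπ⟩ := LinearMap.exists_leftInverse_of_injective G.subtype
    (LinearMap.ker_eq_bot.2 G.subtype_injective)
  have hπ' : ∀ x : G, π (x : K) = x := fun x => by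
    simpa using LinearMap.congr_fun hπ x
  have hrepK := (RepB.ind G.toAddSubgroup).mul (hrep.comp π.toAddMonoidHom)
  set fK : K → ℂ := fun x => (if x ∈ G.toAddSubgroup then (1 : ℂ) else 0) *
    sieveFun S U (π.toAddMonoidHom x) with hfK
  have hfA : ∀ x, fK x = if x ∈ setA F K g S then 1 else 0 := by
    intro x
    by_cases hx : x ∈ G
    · have h1 : π.toAddMonoidHom x = (⟨x, hx⟩ : G) := hπ' ⟨x, hx⟩
      have h2 : x ∈ G.toAddSubgroup := hx
      simp only [hfK, h1, if_pos h2, one_mul, sieveFun, setA, Finset.mem_filter, Finset.mem_univ,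
        true_and, hmemU]
      have : (x ∈ kerP F K g ∧ ∀ f ∈ S, x ∉ kerP F K (g / f)) ↔
        ∀ f ∈ S, x ∉ kerP F K (g / f) := ⟨fun h => h.2, fun h => ⟨hx, h⟩⟩
      simp only [this]
    · have h2 : x ∉ G.toAddSubgroup := hx
      have h3 : x ∉ setA F K g S := fun h => hx (Finset.mem_filter.1 h).2.1
      simp only [hfK, if_neg h2, if_neg h3, zero_mul]
  have hconv : ∀ u : K → ℂ, ∑ x, fK x * u x = ∑ x ∈ setA F K g S, u x := by
    intro u
    simp [hfA]
  have hsumK : ∑ x, fK x = ∑ y : G, sieveFun S U y := by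
    have h1 : ∀ x : K, fK x = if x ∈ G then sieveFun S U (π x) else 0 := by
      intro x
      by_cases hx : x ∈ G
      · have h2 : x ∈ G.toAddSubgroup := hx
        simp only [hfK, if_pos h2, if_pos hx, one_mul]; rfl
      · have h2 : x ∉ G.toAddSubgroup := hx
        simp only [hfK, if_neg h2, if_neg hx, zero_mul]
    simp only [h1]
    rw [← Finset.sum_filter, Finset.sum_subtype (p := fun x => x ∈ G) _ (by simp)]
    exact Finset.sum_congr rfl fun x _ => by rw [hπ']
  have hcardA : ((setA F K g S).card : ℝ) = δ * q ^ g.natDegree := by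
    have h1 := hconv (fun _ => 1)
    simp only [mul_one, Finset.sum_const, nsmul_eq_mul] at h1
    rw [hsumK, hsum, hcardG] at h1
    have : (((δ * q ^ g.natDegree : ℝ)) : ℂ) = (((setA F K g S).card : ℝ) : ℂ) := by
      push_cast at h1 ⊢; exact h1
    exact (Complex.ofReal_injective this).symm
  refine ⟨hcardA, hδpos, fun χ hχ => ?_⟩
  have hK0 : (Fintype.card K : ℝ) ≠ 0 := by exact_mod_cast Fintype.card_ne_zero
  have hK0C : (Fintype.card K : ℂ) ≠ 0 := by exact_mod_cast Fintype.card_ne_zero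
  have := hrepK.mean (d := δ * q ^ g.natDegree / Fintype.card K) (by positivity) (by
    show ∑ x, fK x = _
    rw [hsumK, hsum, hcardG]
    push_cast; field_simp) χ (Real.sqrt (Fintype.card K)) (Real.sqrt_nonneg _)
    fun ψ _ => gauss_le χ hχ ψ
  have hc := hconv χ
  have h0 : ∑ x, χ x = 0 := MulChar.sum_eq_zero_of_ne_one hχ
  rw [h0, mul_zero, sub_zero, one_mul] at this
  rw [← hc]
  exact this
end

noncomputable section

lemma kerP_order {F K : Type*} [Field F] [Fintype F] [Field K] [Algebra F K]
    (g : F[X]) (hg0 : g ≠ 0) (S : Finset F[X]) (hS0 : ∀ f ∈ S, f ≠ 0)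
    (hS : ∀ f, Irreducible f → f ∣ g → ∃ k ∈ S, k ∣ f) (x : K) (hx : x ∈ kerP F K g)
    (hx' : ∀ f ∈ S, x ∉ kerP F K (g / f)) (h : F[X]) (hh : x ∈ kerP F K h) : g ∣ h := by
  classical
  set d := EuclideanDomain.gcd h g with hd
  have hxd : x ∈ kerP F K d := by
    have e := EuclideanDomain.gcd_eq_gcd_ab h g
    have := kerP_lincomb (EuclideanDomain.gcdA h g) (EuclideanDomain.gcdB h g) hh hx
    rw [hd, e]
    rwa [mul_comm h, mul_comm g]
  obtain ⟨c, hc⟩ : d ∣ g := EuclideanDomain.gcd_dvd_right h g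
  by_cases hcu : IsUnit c
  · have : Associated d g := ⟨hcu.unit, by simpa using hc.symm⟩
    exact this.symm.dvd.trans (EuclideanDomain.gcd_dvd_left h g)
  · exfalso
    have hc0 : c ≠ 0 := by rintro rfl; simp at hc; exact hg0 hc
    obtain ⟨f, hf, hfc⟩ := WfDvdMonoid.exists_irreducible_factor hcu hc0
    obtain ⟨k, hk, hkf⟩ := hS f hf (hfc.trans ⟨d, by rw [mul_comm]; exact hc⟩)
    obtain ⟨e, rfl⟩ := hkf.trans hfc
    refine hx' k hk (mem_kerP_of_dvd (h := d) ⟨e, ?_⟩ hxd)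
    rw [hc, mul_left_comm, mul_div_cancel_left₀ _ (hS0 k hk)]

lemma one_normal_of_order {F K : Type*} [Field F] [Fintype F] [Field K] [Fintype K] [Algebra F K]
    (n : ℕ) (hn : n = Module.finrank F K)
    (g : F[X]) (hg0 : g ≠ 0) (hgd : g ∣ X ^ n - 1) (hdeg : g.natDegree = n - 1) (x : K)
    (hx : x ∈ kerP F K g) (hord : ∀ h : F[X], x ∈ kerP F K h → g ∣ h) :
    IskNormal (Fintype.card F) n 1 F x := by
  classical
  set q := Fintype.card F with hq
  have hq1 : 1 < q := Fintype.one_lt_card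
  unfold IskNormal
  set v : Fin (n - 1) → K := fun i => x ^ q ^ (i : ℕ) with hv
  have hli : LinearIndependent F v := by
    rw [Fintype.linearIndependent_iff]
    intro c hc i
    set h : F[X] := ∑ i : Fin (n - 1), monomial (i : ℕ) (c i) with hh
    have hxh : x ∈ kerP F K h := by
      rw [LinearMap.mem_ker, hh, map_sum, LinearMap.sum_apply, ← hc]
      refine Finset.sum_congr rfl fun i _ => ?_
      rw [aeval_monomial, ← Algebra.smul_def, LinearMap.smul_apply, frobT_pow_apply]
    have hgh := hord h hxh
    have h0 : h = 0 := by
      by_contra hne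
      have h1 := natDegree_le_of_dvd hgh hne
      have h2 : h.degree < (n - 1 : ℕ) := by
        rw [hh]
        refine (degree_sum_le _ _).trans_lt ((Finset.sup_lt_iff (WithBot.bot_lt_coe _)).2 ?_)
        intro i _
        refine (degree_monomial_le _ _).trans_lt ?_
        exact_mod_cast i.2
      rw [degree_eq_natDegree hne] at h2
      have h3 : h.natDegree < n - 1 := by exact_mod_cast h2
      omega
    have := congrArg (fun p => coeff p (i : ℕ)) h0
    simp only [hh, finsetSum_coeff, coeff_monomial, coeff_zero] at this
    simpa [Fin.val_inj] using this
  have h1 : Submodule.span F (Set.range v) ≤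
      Submodule.span F (Set.range fun i : Fin n => x ^ q ^ (i : ℕ)) := by
    refine Submodule.span_mono ?_
    rintro _ ⟨i, rfl⟩
    exact ⟨⟨i, by omega⟩, rfl⟩
  have h2 : Submodule.span F (Set.range fun i : Fin n => x ^ q ^ (i : ℕ)) ≤ kerP F K g := by
    rw [Submodule.span_le]
    rintro _ ⟨i, rfl⟩
    show _ ∈ kerP F K g
    have : x ^ q ^ (i : ℕ) = aeval (frobT F K) (X ^ (i : ℕ) : F[X]) x := by
      rw [map_pow, aeval_X, frobT_pow_apply]
    rw [LinearMap.mem_ker] at hx ⊢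
    simp only [this]
    rw [← Module.End.mul_apply, ← map_mul, mul_comm, map_mul, Module.End.mul_apply, hx, map_zero]
  have h3 : Module.finrank F (kerP F K g) = n - 1 := by
    have e1 := kerP_card (K := K) g (hn ▸ hgd)
    rw [Nat.card_eq_fintype_card, Module.card_eq_pow_finrank (K := F), hdeg] at e1
    exact Nat.pow_right_injective hq1 e1
  have h4 := finrank_span_eq_card hli
  rw [Fintype.card_fin] at h4
  have h5 := Submodule.finrank_mono h1
  have h6 := Submodule.finrank_mono h2
  omega

lemma mem_F_of_pow {F K : Type*} [Field F] [Fintype F] [Field K] [Fintype K] [Algebra F K]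
    (c : K) (hc : c ^ Fintype.card F = c) : ∃ b : F, algebraMap F K b = c := by
  classical
  have hmem : ∀ y : K, y ∈ kerP F K (X - 1) ↔ y ^ Fintype.card F = y := by
    intro y
    rw [LinearMap.mem_ker]
    simp [sub_eq_zero]
  set φ : F → kerP F K (X - 1) := fun b => ⟨algebraMap F K b, by
    rw [hmem, ← map_pow, FiniteField.pow_card]⟩ with hφ
  have hinj : Function.Injective φ := by
    intro a b hab
    have : algebraMap F K a = algebraMap F K b := congrArg Subtype.val hab
    exact (algebraMap F K).injective this
  have hX : (X - 1 : F[X]) = X - C 1 := by simp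
  have hcard := kerP_card_le (F := F) (K := K) (X - 1) (by rw [hX]; exact X_sub_C_ne_zero 1)
  rw [hX, natDegree_X_sub_C, pow_one, ← hX] at hcard
  have hb := hinj.bijective_of_nat_card_le (by rw [Nat.card_eq_fintype_card (α := F)]; exact hcard)
  obtain ⟨b, hb⟩ := hb.2 ⟨c, (hmem c).2 hc⟩
  exact ⟨b, congrArg Subtype.val hb⟩

lemma isPrimitiveElt_of_orderOf {K : Type*} [Field K] [Fintype K] (u : Kˣ)
    (hu : orderOf u = Fintype.card K - 1) : IsPrimitiveElt (u : K) := by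
  classical
  intro b hb
  have h1 : Subgroup.zpowers u = ⊤ := by
    rw [← Subgroup.card_eq_iff_eq_top, Nat.card_zpowers, hu, Nat.card_eq_fintype_card,
      Fintype.card_units]
  have h2 : Units.mk0 b hb ∈ Subgroup.zpowers u := by rw [h1]; trivial
  obtain ⟨m, hm⟩ := mem_powers_iff_mem_zpowers.2 h2
  refine ⟨m, ?_⟩
  have := congrArg Units.val hm
  simpa using this

lemma exists_scale {F K : Type*} [Field F] [Fintype F] [Field K] [Fintype K] [Algebra F K]
    (M N : ℕ) (hM : M = Fintype.card K - 1) (hN : M = N * (Fintype.card F - 1)) (a : K)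
    (ha : a ≠ 0) (hfree : ∀ l ∈ N.primeFactors, a ^ (M / l) ≠ 1) :
    ∃ c : F, c ≠ 0 ∧ IsPrimitiveElt (c • a) := by
  classical
  have hM0 : 0 < M := by have := Fintype.one_lt_card (α := K); omega
  have hN0 : 0 < N := Nat.pos_of_ne_zero (by rintro h; rw [h, zero_mul] at hN; omega)
  have hNM : N ∣ M := ⟨_, hN⟩
  obtain ⟨γ, hγ⟩ := IsCyclic.exists_ofOrder_eq_natCard (α := Kˣ)
  rw [Nat.card_eq_fintype_card, Fintype.card_units, ← hM] at hγ
  have hgen : Subgroup.zpowers γ = ⊤ := by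
    rw [← Subgroup.card_eq_iff_eq_top, Nat.card_zpowers, hγ, Nat.card_eq_fintype_card,
      Fintype.card_units, hM]
  obtain ⟨i, hi⟩ := mem_powers_iff_mem_zpowers.2
    (by rw [hgen]; trivial : Units.mk0 a ha ∈ Subgroup.zpowers γ)
  simp only at hi
  have hai : a = ((γ ^ i : Kˣ) : K) := by rw [hi]; rfl
  have hcop : Nat.Coprime i N := by
    refine Nat.Coprime.symm (Nat.coprime_of_dvd ?_)
    intro l hl hlN hli
    refine hfree l (Nat.mem_primeFactors.2 ⟨hl, hlN, hN0.ne'⟩) ?_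
    rw [hai, ← Units.val_pow_eq_pow_val, ← pow_mul, ← Units.val_one]
    congr 1
    rw [← orderOf_dvd_iff_pow_eq_one, hγ]
    obtain ⟨j, rfl⟩ := hli
    have : l ∣ M := hlN.trans hNM
    exact ⟨j, by rw [mul_right_comm, Nat.mul_div_cancel' this]⟩
  have : NeZero M := ⟨hM0.ne'⟩
  have : NeZero N := ⟨hN0.ne'⟩
  obtain ⟨u, hu⟩ := ZMod.unitsMap_surjective hNM (ZMod.unitOfCoprime i hcop)
  set b := (u : ZMod M).val with hb
  have hbcop : Nat.Coprime b M := ZMod.val_coe_unit_coprime u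
  have hbi : b ≡ i [MOD N] := by
    rw [← ZMod.natCast_eq_natCast_iff]
    have h1 := congrArg Units.val hu
    rw [ZMod.unitsMap_val, ZMod.coe_unitOfCoprime] at h1
    rw [← h1, hb, ZMod.natCast_val]
  set c : Kˣ := γ ^ b * (γ ^ i)⁻¹ with hc
  have hcq : c ^ (Fintype.card F - 1) = 1 := by
    rw [hc, mul_pow, inv_pow, mul_inv_eq_one, ← pow_mul, ← pow_mul, pow_eq_pow_iff_modEq, hγ, hN]
    exact hbi.mul_right' _
  have hcF : (c : K) ^ Fintype.card F = c := by
    have h1 : Fintype.card F = (Fintype.card F - 1) + 1 := by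
      have := Fintype.one_lt_card (α := F); omega
    rw [h1, pow_succ, ← Units.val_pow_eq_pow_val, hcq]; simp
  obtain ⟨c0, hc0⟩ := mem_F_of_pow (F := F) (c : K) hcF
  refine ⟨c0, ?_, ?_⟩
  · rintro rfl
    rw [map_zero] at hc0
    exact c.ne_zero hc0.symm
  · have : c0 • a = ((γ ^ b : Kˣ) : K) := by
      rw [Algebra.smul_def, hc0, hai, ← Units.val_mul, hc]; simp
    rw [this]
    refine isPrimitiveElt_of_orderOf _ ?_
    rw [orderOf_pow, hγ, ← hM, Nat.Coprime.gcd_eq_one hbcop.symm, Nat.div_one]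

/-- The main sieve criterion. -/
lemma criterion {F K : Type*} [Field F] [Fintype F] [Field K] [Fintype K] [Algebra F K]
    (n q N : ℕ) (hn : n = Module.finrank F K) (hq : q = Fintype.card F)
    (hN : q ^ n - 1 = N * (q - 1))
    (g : F[X]) (hgd : g ∣ X ^ n - 1) (hdeg : g.natDegree = n - 1) (S : Finset F[X])
    (hne : S.Nonempty) (hirr : ∀ f ∈ S, Irreducible f)
    (hcop : (S : Set F[X]).Pairwise IsCoprime) (hdvd : ∏ f ∈ S, f ∣ g)
    (hS : ∀ f, Irreducible f → f ∣ g → ∃ k ∈ S, k ∣ f)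
    (hlt : ((2 ^ N.primeFactors.card - 1) * (2 ^ S.card * q - 1)) ^ 2 < q ^ n) :
    ∃ α : K, IsPrimitiveElt α ∧ IskNormal q n 1 F α := by
  classical
  have hn0 : 0 < n := hn ▸ Module.finrank_pos
  have hq1 : 1 < q := hq ▸ Fintype.one_lt_card
  have hcK : Fintype.card K = q ^ n := by rw [hn, hq]; exact Module.card_eq_pow_finrank
  have hX0 : (X ^ n - 1 : F[X]) ≠ 0 := X_pow_sub_C_ne_zero hn0 1
  have hg0 : g ≠ 0 := by rintro rfl; exact hX0 (zero_dvd_iff.1 hgd)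
  have hS0 : ∀ f ∈ S, f ≠ 0 := fun f hf => (hirr f hf).ne_zero
  obtain ⟨hA, hδ, hB⟩ := add_bound (K := K) g (hn ▸ hgd) S hS0
    (fun f hf => (hirr f hf).natDegree_pos) hcop hdvd _ rfl
  set δ := ∏ f ∈ S, (1 - 1 / (((Fintype.card F) ^ f.natDegree : ℕ) : ℝ)) with hδd
  clear_value δ
  rw [← hq, hdeg] at hA hB
  rw [hcK] at hB
  have hM0 : 0 < q ^ n - 1 := by have := Nat.one_lt_pow hn0.ne' hq1; omega
  have hN0 : N ≠ 0 := by rintro rfl; omega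
  have hNd : N ∣ q ^ n - 1 := ⟨_, hN⟩
  have hqn : ((q : ℝ) ^ n) = q ^ (n - 1) * q := by
    rw [← pow_succ, Nat.sub_add_cancel hn0]
  have hqR : (1 : ℝ) < q := by exact_mod_cast hq1
  set R := Real.sqrt ((q ^ n : ℕ) : ℝ) with hR
  have hRsq : R * R = q ^ n := by
    rw [hR, Real.mul_self_sqrt (by positivity)]; push_cast; rfl
  have hR0 : 0 < R := Real.sqrt_pos.2 (by positivity)
  have h2S : (1 : ℝ) ≤ 2 ^ S.card := one_le_pow₀ (by norm_num)
  have h2N : (1 : ℝ) ≤ 2 ^ N.primeFactors.card := one_le_pow₀ (by norm_num)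
  have hltR : ((2 : ℝ) ^ N.primeFactors.card - 1) * (2 ^ S.card * q - 1) < R := by
    rw [hR]
    refine Real.lt_sqrt_of_sq_lt ?_
    have h1 : 1 ≤ 2 ^ N.primeFactors.card := Nat.one_le_two_pow
    have h2 : 1 ≤ 2 ^ S.card * q := Nat.mul_pos Nat.one_le_two_pow (by omega)
    have := (Nat.cast_lt (α := ℝ)).2 hlt
    push_cast [Nat.cast_sub h1, Nat.cast_sub h2] at this ⊢
    exact this
  have hBeq : (2 ^ S.card * δ - δ * (q : ℝ) ^ (n - 1) / ((q ^ n : ℕ) : ℝ)) * R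
      = δ * (2 ^ S.card * q - 1) * R / q := by
    push_cast
    rw [hqn]
    field_simp
  rw [hBeq] at hB
  obtain ⟨a, haA, hfree⟩ := mult_sieve (K := K) (q ^ n - 1) (by rw [hcK]) N.primeFactors
    (fun l hl => ⟨Nat.prime_of_mem_primeFactors hl, (Nat.dvd_of_mem_primeFactors hl).trans hNd⟩)
    (setA F K g S) (by
      intro h0
      obtain ⟨f, hf⟩ := hne
      exact (Finset.mem_filter.1 h0).2.2 f hf (Submodule.zero_mem _))
    (δ * (2 ^ S.card * q - 1) * R / q) (by
      have : (0 : ℝ) ≤ 2 ^ S.card * q - 1 := by nlinarith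
      positivity) hB (by
      rw [hA]
      have : (q : ℝ) ^ (n - 1) = R * R / q := by rw [hRsq, hqn]; field_simp
      rw [this]
      calc (2 ^ N.primeFactors.card - 1) * (δ * (2 ^ S.card * q - 1) * R / q)
          = ((2 ^ N.primeFactors.card - 1) * (2 ^ S.card * q - 1)) * (δ * R / q) := by ring
        _ < R * (δ * R / q) := by gcongr
        _ = _ := by ring)
  have ha := (Finset.mem_filter.1 haA).2
  have ha0 : a ≠ 0 := by
    rintro rfl
    obtain ⟨f, hf⟩ := hne
    exact ha.2 f hf (Submodule.zero_mem _)
  obtain ⟨c, hc0, hprim⟩ := exists_scale (F := F) (q ^ n - 1) N (by rw [hcK]) (by rw [hN, hq]) a ha0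
    hfree
  refine ⟨c • a, hprim, ?_⟩
  rw [hq]
  have hxg : c • a ∈ kerP F K g := Submodule.smul_mem _ c ha.1
  refine one_normal_of_order n hn g hg0 hgd hdeg (c • a) hxg fun h hh => ?_
  refine kerP_order g hg0 S hS0 hS (c • a) hxg (fun f hf hcon => ha.2 f hf ?_) h hh
  have := Submodule.smul_mem (kerP F K (g / f)) c⁻¹ hcon
  rwa [smul_smul, inv_mul_cancel₀ hc0, one_smul] at this
end

noncomputable section

open UniqueFactorizationMonoid in
/-- the distinct monic irreducible factors of `X^s - 1`. -/
def facS (F : Type*) [Field F] (s : ℕ) : Finset F[X] := by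
  classical exact (normalizedFactors (X ^ s - 1 : F[X])).toFinset

lemma mem_facS {F : Type*} [Field F] {s : ℕ} (hs : 0 < s) {f : F[X]} :
    f ∈ facS F s ↔ Irreducible f ∧ f.Monic ∧ f ∣ X ^ s - 1 := by
  classical
  have h0 : (X ^ s - 1 : F[X]) ≠ 0 := X_pow_sub_C_ne_zero hs 1
  unfold facS
  rw [Multiset.mem_toFinset, UniqueFactorizationMonoid.mem_normalizedFactors_iff' h0]
  constructor
  · rintro ⟨h1, h2, h3⟩
    refine ⟨h1, ?_, h3⟩
    rw [← h2]; exact monic_normalize h1.ne_zero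
  · rintro ⟨h1, h2, h3⟩
    exact ⟨h1, h2.normalize_eq_self, h3⟩

lemma facS_cop {F : Type*} [Field F] {s : ℕ} (hs : 0 < s) :
    (facS F s : Set F[X]).Pairwise IsCoprime := by
  intro f hf g hg hne
  rw [Finset.mem_coe, mem_facS hs] at hf hg
  refine ((hf.1.coprime_iff_not_dvd).2 fun h => hne ?_)
  exact eq_of_monic_of_associated hf.2.1 hg.2.1 (hf.1.associated_of_dvd hg.1 h)

lemma facS_prod {F : Type*} [Field F] {s : ℕ} (hs : 0 < s) :
    ∏ f ∈ facS F s, f ∣ X ^ s - 1 :=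
  Finset.prod_dvd_of_coprime (facS_cop hs) fun _ hf => ((mem_facS hs).1 hf).2.2

lemma facS_deg {F : Type*} [Field F] {s : ℕ} (hs : 0 < s) :
    ∑ f ∈ facS F s, f.natDegree ≤ s := by
  have h0 : (X ^ s - 1 : F[X]) ≠ 0 := X_pow_sub_C_ne_zero hs 1
  have h1 := natDegree_le_of_dvd (facS_prod (F := F) hs) h0
  rw [natDegree_prod _ _ fun f hf => ((mem_facS hs).1 hf).1.ne_zero] at h1
  have : (X ^ s - 1 : F[X]).natDegree = s := natDegree_X_pow_sub_C (r := (1 : F))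
  rwa [this] at h1

lemma facS_eval0 {F : Type*} [Field F] {s : ℕ} (hs : 0 < s) {f : F[X]} (hf : f ∈ facS F s) :
    f.coeff 0 ≠ 0 := by
  obtain ⟨c, hc⟩ := ((mem_facS hs).1 hf).2.2
  intro h
  have := congrArg (fun p => coeff p 0) hc
  simp [mul_coeff_zero, h, hs.ne] at this

lemma facS_card1 {F : Type*} [Field F] {s : ℕ} (hs : 0 < s) : (facS F s).card ≤ s := by
  refine le_trans ?_ (facS_deg (F := F) hs)
  rw [Finset.card_eq_sum_ones]
  exact Finset.sum_le_sum fun f hf => ((mem_facS hs).1 hf).1.natDegree_pos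

lemma facS_lin {F : Type*} [Field F] [Fintype F] {s : ℕ} (hs : 0 < s) :
    ((facS F s).filter fun f => f.natDegree = 1).card ≤ Fintype.card F - 1 := by
  classical
  rw [← Finset.card_univ, ← Finset.card_erase_of_mem (Finset.mem_univ (0 : F))]
  refine Finset.card_le_card_of_injOn (fun f => f.coeff 0) ?_ ?_
  · intro f hf
    rw [Finset.mem_coe, Finset.mem_filter] at hf
    simpa using facS_eval0 hs hf.1
  · intro f hf g hg h
    rw [Finset.mem_coe, Finset.mem_filter, mem_facS hs] at hf hg
    rw [hf.1.2.1.eq_X_add_C hf.2, hg.1.2.1.eq_X_add_C hg.2]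
    simp only at h
    rw [h]

lemma facS_card2 {F : Type*} [Field F] [Fintype F] {s : ℕ} (hs : 0 < s) :
    2 * (facS F s).card ≤ s + (Fintype.card F - 1) := by
  classical
  refine le_trans ?_ (Nat.add_le_add (facS_deg (F := F) hs) (facS_lin hs))
  rw [Finset.card_filter, ← Finset.sum_add_distrib, mul_comm, ← smul_eq_mul, ← Finset.sum_const]
  refine Finset.sum_le_sum fun f hf => ?_
  have := ((mem_facS hs).1 hf).1.natDegree_pos
  split_ifs <;> omega

lemma facS_quad {F : Type*} [Field F] [Fintype F] {s : ℕ} (hs : 0 < s) (h2 : Fintype.card F = 2) :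
    ((facS F s).filter fun f => f.natDegree = 2).card ≤ 1 := by
  classical
  have hF : ∀ a : F, a ≠ 0 → a = 1 := by
    intro a ha
    have := FiniteField.pow_card_sub_one_eq_one a ha
    rwa [h2, pow_one] at this
  have key : ∀ f ∈ (facS F s).filter (fun f => f.natDegree = 2), f = X ^ 2 + X + 1 := by
    intro f hf
    rw [Finset.mem_filter] at hf
    obtain ⟨hf, hd⟩ := hf
    have hb := hF _ (facS_eval0 hs hf)
    obtain ⟨h1, hm, -⟩ := (mem_facS hs).1 hf
    have hc2 : f.coeff 2 = 1 := by rw [← hd]; exact hm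
    have he : f = C (f.coeff 2) * X ^ 2 + C (f.coeff 1) * X + C (f.coeff 0) := by
      conv_lhs => rw [f.as_sum_range, hd]
      simp [Finset.sum_range_succ, ← C_mul_X_pow_eq_monomial]
      ring
    have hr : f.eval 1 ≠ 0 := by
      intro h
      have := degree_eq_one_of_irreducible_of_root h1 h
      rw [degree_eq_natDegree h1.ne_zero, hd] at this
      exact absurd this (by decide)
    have ha : f.coeff 1 ≠ 0 := by
      intro ha
      apply hr
      rw [he, hc2, hb, ha]
      have : (2 : F) = 0 := by
        have := FiniteField.cast_card_eq_zero F
        rw [h2] at this; exact_mod_cast this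
      simp; linear_combination this
    rw [he, hc2, hb, hF _ ha]; simp
  refine Finset.card_le_one.2 fun f hf g hg => ?_
  rw [key f hf, key g hg]

lemma facS_card3 {F : Type*} [Field F] [Fintype F] {s : ℕ} (hs : 0 < s) (h2 : Fintype.card F = 2) :
    3 * (facS F s).card ≤ s + 3 := by
  classical
  have hl := facS_lin (F := F) hs
  have hq := facS_quad (F := F) hs h2
  rw [h2] at hl
  have hd := facS_deg (F := F) hs
  have : 3 * (facS F s).card ≤ ∑ f ∈ facS F s, f.natDegree +
      (2 * ((facS F s).filter fun f => f.natDegree = 1).card +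
      ((facS F s).filter fun f => f.natDegree = 2).card) := by
    rw [Finset.card_filter, Finset.card_filter, Finset.mul_sum, ← Finset.sum_add_distrib,
      ← Finset.sum_add_distrib, mul_comm 3, ← smul_eq_mul, ← Finset.sum_const]
    refine Finset.sum_le_sum fun f hf => ?_
    have := ((mem_facS hs).1 hf).1.natDegree_pos
    split_ifs <;> omega
  omega

/-- the polynomial `(X^(ps)-1)/(X-1)` -/
def polyG (F : Type*) [Field F] (p s : ℕ) : F[X] :=
  (X ^ s - 1) ^ (p - 1) * ∑ i ∈ Finset.range s, X ^ i

lemma polyG_mul {F : Type*} [Field F] {p s : ℕ} (hp : p.Prime) [CharP F p] :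
    polyG F p s * (X - 1) = X ^ (p * s) - 1 := by
  have : Fact p.Prime := ⟨hp⟩
  unfold polyG
  rw [mul_assoc, geom_sum_mul, ← pow_succ, Nat.sub_add_cancel hp.one_le, sub_pow_char, ← pow_mul,
    one_pow, mul_comm]

lemma polyG_deg {F : Type*} [Field F] {p s : ℕ} (hp : p.Prime) [CharP F p] (hs : 0 < s) :
    (polyG F p s).natDegree = p * s - 1 := by
  have h := polyG_mul (F := F) (s := s) hp
  have hn : p * s ≠ 0 := by have := hp.pos; positivity
  have h0 : (X ^ (p * s) - 1 : F[X]) ≠ 0 := X_pow_sub_C_ne_zero (Nat.pos_of_ne_zero hn) 1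
  have h1 : polyG F p s ≠ 0 := by intro h'; rw [h', zero_mul] at h; exact h0 h.symm
  have hX : (X - 1 : F[X]) = X - C 1 := by simp
  have h3 := congrArg natDegree h
  rw [natDegree_mul h1 (by rw [hX]; exact X_sub_C_ne_zero 1)] at h3
  have e : (X ^ (p * s) - 1 : F[X]).natDegree = p * s := natDegree_X_pow_sub_C (r := (1 : F))
  rw [e, hX, natDegree_X_sub_C] at h3
  omega

lemma facS_cover {F : Type*} [Field F] {p s : ℕ} (hp : p.Prime) [CharP F p] (hs : 0 < s)
    (f : F[X]) (hf : Irreducible f) (hfg : f ∣ polyG F p s) : ∃ k ∈ facS F s, k ∣ f := by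
  classical
  have : Fact p.Prime := ⟨hp⟩
  have h1 : f ∣ (X ^ s - 1) ^ p := by
    refine hfg.trans ⟨X - 1, ?_⟩
    rw [polyG_mul hp, sub_pow_char, ← pow_mul, one_pow, mul_comm]
  have h2 := hf.prime.dvd_of_dvd_pow h1
  refine ⟨normalize f, (mem_facS hs).2 ⟨?_, monic_normalize hf.ne_zero, ?_⟩, ?_⟩
  · exact (associated_normalize f).irreducible hf
  · exact normalize_dvd_iff.2 h2
  · exact normalize_dvd_iff.2 dvd_rfl

lemma crit2 {F K : Type*} [Field F] [Fintype F] [Field K] [Fintype K] [Algebra F K]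
    (p q s N w r : ℕ) (hp : p.Prime) [CharP F p] (hs : 0 < s) (hn : Module.finrank F K = p * s)
    (hq : Fintype.card F = q)
    (hN : q ^ (p * s) - 1 = N * (q - 1)) (hw : N.primeFactors.card ≤ w)
    (hr : (facS F s).card ≤ r)
    (hlt : ((2 ^ w - 1) * (2 ^ r * q - 1)) ^ 2 < q ^ (p * s)) :
    ∃ α : K, IsPrimitiveElt α ∧ IskNormal q (p * s) 1 F α := by
  have hdv : (X ^ s - 1 : F[X]) ∣ polyG F p s := by
    unfold polyG
    exact (dvd_pow_self _ (by have := hp.two_le; omega)).mul_right _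
  refine criterion (p * s) q N hn.symm hq.symm hN (polyG F p s) ⟨_, (polyG_mul hp).symm⟩
    (polyG_deg hp hs) (facS F s) ?_ (fun f hf => ((mem_facS hs).1 hf).1) (facS_cop hs)
    ((facS_prod hs).trans hdv) (facS_cover hp hs) ?_
  · refine ⟨X - 1, (mem_facS hs).2 ⟨?_, ?_, ?_⟩⟩
    · have : (X - 1 : F[X]) = X - C 1 := by simp
      rw [this]; exact irreducible_X_sub_C 1
    · have : (X - 1 : F[X]) = X - C 1 := by simp
      rw [this]; exact monic_X_sub_C 1
    · exact sub_one_dvd_pow_sub_one X s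
  · refine lt_of_le_of_lt ?_ hlt
    gcongr <;> norm_num
end

noncomputable section

lemma omega_bound (N c : ℕ) (hN : N ≠ 0) (B : Finset ℕ) (hB : ∀ b ∈ B, b ≤ c)
    (hP : ∀ p < c, p.Prime → p ∣ N → p ∈ B) :
    c ^ N.primeFactors.card * ∏ b ∈ B, b ≤ c ^ B.card * N := by
  set P := N.primeFactors with hPd
  have h1 : ∏ p ∈ P, p ≤ N := Nat.le_of_dvd (Nat.pos_of_ne_zero hN) (Nat.prod_primeFactors_dvd N)
  refine le_trans ?_ (Nat.mul_le_mul_left _ h1)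
  rw [← Finset.card_sdiff_add_card_inter P B, ← Finset.card_sdiff_add_card_inter B P,
    ← Finset.prod_inter_mul_prod_sdiff B P, ← Finset.prod_inter_mul_prod_sdiff P B,
    Finset.inter_comm B P, pow_add, pow_add]
  have h2 : c ^ (P \ B).card ≤ ∏ p ∈ P \ B, p := by
    rw [← Finset.prod_const]
    refine Finset.prod_le_prod' fun p hp => ?_
    rw [Finset.mem_sdiff] at hp
    by_contra hlt
    have := Nat.mem_primeFactors.1 hp.1
    exact hp.2 (hP p (by omega) this.1 this.2.1)
  have h3 : ∏ p ∈ B \ P, p ≤ c ^ (B \ P).card := by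
    rw [← Finset.prod_const]
    refine Finset.prod_le_prod' fun p hp => hB p (Finset.mem_sdiff.1 hp).1
  calc c ^ (P \ B).card * c ^ (P ∩ B).card * ((∏ x ∈ P ∩ B, x) * ∏ x ∈ B \ P, x)
      ≤ (∏ p ∈ P \ B, p) * c ^ (P ∩ B).card * ((∏ x ∈ P ∩ B, x) * c ^ (B \ P).card) := by gcongr
    _ = _ := by ring

lemma omega_le (N c : ℕ) (hN : N ≠ 0) (hc : 1 < c) (B : Finset ℕ) (hB : ∀ b ∈ B, b ≤ c)
    (hP : ∀ p < c, p.Prime → p ∣ N → p ∈ B) (hlt : N < c * ∏ b ∈ B, b) :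
    N.primeFactors.card ≤ B.card := by
  by_contra! h
  have h1 := omega_bound N c hN B hB hP
  have h2 : c ^ (B.card + 1) ≤ c ^ N.primeFactors.card := Nat.pow_le_pow_right (by omega) h
  have h3 : c ^ B.card * N < c ^ B.card * (c * ∏ b ∈ B, b) := by gcongr
  have h4 : c ^ (B.card + 1) * ∏ b ∈ B, b ≤ c ^ N.primeFactors.card * ∏ b ∈ B, b := by gcongr
  rw [pow_succ, mul_assoc] at h4
  omega

lemma omega_gen (N : ℕ) (hN : N ≠ 0) : 30030 * 16 ^ N.primeFactors.card ≤ 16 ^ 6 * N := by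
  have := omega_bound N 16 hN {2, 3, 5, 7, 11, 13} (by decide) (by
    intro p hp hpp _
    interval_cases p <;> first | decide | (exfalso; revert hpp; norm_num))
  have e : ∏ b ∈ ({2, 3, 5, 7, 11, 13} : Finset ℕ), b = 30030 := by decide
  have e2 : ({2, 3, 5, 7, 11, 13} : Finset ℕ).card = 6 := by decide
  rw [e, e2] at this
  omega

lemma omega_odd (N : ℕ) (hN : N % 2 = 1) : 15015 * 16 ^ N.primeFactors.card ≤ 16 ^ 5 * N := by
  have := omega_bound N 16 (by omega) {3, 5, 7, 11, 13} (by decide) (by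
    intro p hp hpp hd
    interval_cases p <;> first | decide | (exfalso; revert hpp; norm_num; done) | (exfalso; omega))
  have e : ∏ b ∈ ({3, 5, 7, 11, 13} : Finset ℕ), b = 15015 := by decide
  have e2 : ({3, 5, 7, 11, 13} : Finset ℕ).card = 5 := by decide
  rw [e, e2] at this
  omega

lemma num_gen (q n w r N A B : ℕ) (hq : 1 < q) (hn : 0 < n) (hN : q ^ n - 1 = N * (q - 1))
    (hA : 0 < A)
    (hw : A * 16 ^ w ≤ B * N) (hb : B * 16 ^ r * q ^ 4 ≤ A * q ^ n * (q - 1)) :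
    ((2 ^ w - 1) * (2 ^ r * q - 1)) ^ 2 < q ^ n := by
  have h0 : N * (q - 1) ≤ q ^ n := by omega
  have h1 : 16 ^ w * 16 ^ r * q ^ 4 ≤ q ^ n * q ^ n := by
    have hpos : 0 < A * (q - 1) := Nat.mul_pos hA (by omega)
    refine Nat.le_of_mul_le_mul_left ?_ hpos
    calc A * (q - 1) * (16 ^ w * 16 ^ r * q ^ 4)
        = (A * 16 ^ w) * ((q - 1) * (16 ^ r * q ^ 4)) := by ring
      _ ≤ (B * N) * ((q - 1) * (16 ^ r * q ^ 4)) := by gcongr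
      _ = (N * (q - 1)) * (B * 16 ^ r * q ^ 4) := by ring
      _ ≤ q ^ n * (A * q ^ n * (q - 1)) := by gcongr
      _ = _ := by ring
  have h2 : (2 ^ w * (2 ^ r * q)) ^ 2 ≤ q ^ n := by
    refine (Nat.pow_le_pow_iff_left (by norm_num : 2 ≠ 0)).1 ?_
    have e : (16 : ℕ) = 2 ^ 4 := by norm_num
    rw [e, ← pow_mul, ← pow_mul] at h1
    calc ((2 ^ w * (2 ^ r * q)) ^ 2) ^ 2 = 2 ^ (4 * w) * 2 ^ (4 * r) * q ^ 4 := by ring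
      _ ≤ q ^ n * q ^ n := h1
      _ = _ := by ring
  refine lt_of_lt_of_le ?_ h2
  refine Nat.pow_lt_pow_left ?_ (by norm_num)
  have h3 : 0 < 2 ^ w := by positivity
  have h4 : 0 < 2 ^ r * q := by positivity
  exact Nat.mul_lt_mul'' (by omega) (by omega)
end

noncomputable section

lemma N_exists (q n : ℕ) : ∃ N, q ^ n - 1 = N * (q - 1) := by
  obtain ⟨N, hN⟩ := Nat.sub_dvd_pow_sub_pow q 1 n
  exact ⟨N, by rw [one_pow] at hN; rw [hN, mul_comm]⟩

lemma fam_gen {F K : Type*} [Field F] [Fintype F] [Field K] [Fintype K] [Algebra F K]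
    (p q s r : ℕ) (hp : p.Prime) [CharP F p] (hs : 0 < s) (hn : Module.finrank F K = p * s)
    (hq : Fintype.card F = q) (hr : (facS F s).card ≤ r)
    (hb : 16 ^ 6 * 16 ^ r * q ^ 4 ≤ 30030 * q ^ (p * s) * (q - 1)) :
    ∃ α : K, IsPrimitiveElt α ∧ IskNormal q (p * s) 1 F α := by
  have hq1 : 1 < q := hq ▸ Fintype.one_lt_card
  have hn0 : 0 < p * s := Nat.mul_pos hp.pos hs
  obtain ⟨N, hN⟩ := N_exists q (p * s)
  have h1 := Nat.one_lt_pow hn0.ne' hq1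
  have hN0 : N ≠ 0 := by rintro rfl; omega
  exact crit2 p q s N _ r hp hs hn hq hN le_rfl hr
    (num_gen q (p * s) _ r N _ _ hq1 hn0 hN (by norm_num) (omega_gen N hN0) hb)

lemma fam_two {F K : Type*} [Field F] [Fintype F] [Field K] [Fintype K] [Algebra F K]
    (q s e r : ℕ) [CharP F 2] (he : 0 < e) (hqe : q = 2 ^ e) (hs : 0 < s)
    (hn : Module.finrank F K = 2 * s)
    (hq : Fintype.card F = q) (hr : (facS F s).card ≤ r)
    (hb : 20 + 4 * r + 4 * e ≤ 13 + 2 * (e * s) + (e - 1)) :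
    ∃ α : K, IsPrimitiveElt α ∧ IskNormal q (2 * s) 1 F α := by
  have hq1 : 1 < q := hq ▸ Fintype.one_lt_card
  have hn0 : 0 < 2 * s := by omega
  obtain ⟨N, hN⟩ := N_exists q (2 * s)
  have h1 := Nat.one_lt_pow hn0.ne' hq1
  have hN2 : N % 2 = 1 := by
    have : 2 ∣ q ^ (2 * s) := by
      rw [hqe, ← pow_mul]
      exact dvd_pow_self 2 (by positivity)
    by_contra hc
    have h2 : 2 ∣ N * (q - 1) := (Nat.dvd_of_mod_eq_zero (by omega)).mul_right _
    rw [← hN] at h2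
    omega
  refine crit2 2 q s N _ r Nat.prime_two hs hn hq hN le_rfl hr
    (num_gen q (2 * s) _ r N 15015 (16 ^ 5) hq1 hn0 hN (by norm_num) (omega_odd N hN2) ?_)
  have h3 : 2 ^ (e - 1) ≤ q - 1 := by
    have : q = 2 * 2 ^ (e - 1) := by rw [hqe, ← pow_succ', Nat.sub_add_cancel he]
    have := Nat.one_le_two_pow (n := e - 1)
    omega
  calc 16 ^ 5 * 16 ^ r * q ^ 4 = 2 ^ (20 + 4 * r + 4 * e) := by
        rw [hqe, show (16 : ℕ) = 2 ^ 4 by norm_num, ← pow_mul, ← pow_mul, ← pow_mul, ← pow_add,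
          ← pow_add, mul_comm e 4]
    _ ≤ 2 ^ (13 + 2 * (e * s) + (e - 1)) := Nat.pow_le_pow_right (by norm_num) hb
    _ = 2 ^ 13 * q ^ (2 * s) * 2 ^ (e - 1) := by
        rw [hqe, ← pow_mul, ← pow_add, ← pow_add, mul_left_comm]
    _ ≤ 15015 * q ^ (2 * s) * (q - 1) := by gcongr; norm_num

lemma case_ge5 {F K : Type*} [Field F] [Fintype F] [Field K] [Fintype K] [Algebra F K]
    (p q s : ℕ) (hp : p.Prime) [CharP F p] (hs : 3 ≤ s) (hn : Module.finrank F K = p * s)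
    (hq : Fintype.card F = q) (hp5 : 5 ≤ p) (hpq : p ≤ q) :
    ∃ α : K, IsPrimitiveElt α ∧ IskNormal q (p * s) 1 F α := by
  refine fam_gen p q s s hp (by omega) hn hq (facS_card1 (by omega)) ?_
  have h1 : q ^ (5 * s) ≤ q ^ (p * s) := Nat.pow_le_pow_right (by omega) (by gcongr)
  obtain ⟨t, rfl⟩ := Nat.exists_eq_add_of_le hs
  have h2 : 5 ^ 11 ≤ q ^ 11 := Nat.pow_le_pow_left (by omega) _
  have h3 : 16 ^ t ≤ (q ^ 5) ^ t := Nat.pow_le_pow_left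
    ((by norm_num : 16 ≤ 5 ^ 5).trans (Nat.pow_le_pow_left (by omega) _)) _
  calc 16 ^ 6 * 16 ^ (3 + t) * q ^ 4 = 16 ^ 9 * 16 ^ t * q ^ 4 := by ring
    _ ≤ (30030 * 5 ^ 11 * 4) * (q ^ 5) ^ t * q ^ 4 := by gcongr; norm_num
    _ ≤ (30030 * q ^ 11 * (q - 1)) * (q ^ 5) ^ t * q ^ 4 := by gcongr; omega
    _ = 30030 * q ^ (5 * (3 + t)) * (q - 1) := by ring
    _ ≤ _ := by gcongr

lemma case_3a {F K : Type*} [Field F] [Fintype F] [Field K] [Fintype K] [Algebra F K]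
    (q s : ℕ) [CharP F 3] (hs : 4 ≤ s) (hn : Module.finrank F K = 3 * s)
    (hq : Fintype.card F = q) (hpq : 9 ≤ q) :
    ∃ α : K, IsPrimitiveElt α ∧ IskNormal q (3 * s) 1 F α := by
  refine fam_gen 3 q s s Nat.prime_three (by omega) hn hq (facS_card1 (by omega)) ?_
  obtain ⟨t, rfl⟩ := Nat.exists_eq_add_of_le hs
  have h2 : 9 ^ 8 ≤ q ^ 8 := Nat.pow_le_pow_left (by omega) _
  have h3 : 16 ^ t ≤ (q ^ 3) ^ t := Nat.pow_le_pow_left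
    ((by norm_num : 16 ≤ 9 ^ 3).trans (Nat.pow_le_pow_left (by omega) _)) _
  calc 16 ^ 6 * 16 ^ (4 + t) * q ^ 4 = 16 ^ 10 * 16 ^ t * q ^ 4 := by ring
    _ ≤ (30030 * 9 ^ 8 * 8) * (q ^ 3) ^ t * q ^ 4 := by gcongr; norm_num
    _ ≤ (30030 * q ^ 8 * (q - 1)) * (q ^ 3) ^ t * q ^ 4 := by gcongr; omega
    _ = 30030 * q ^ (3 * (4 + t)) * (q - 1) := by ring

lemma case_3b {F K : Type*} [Field F] [Fintype F] [Field K] [Fintype K] [Algebra F K]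
    (s : ℕ) [CharP F 3] (hs : 4 ≤ s) (hs6 : s ≠ 6) (hn : Module.finrank F K = 3 * s)
    (hq : Fintype.card F = 3) :
    ∃ α : K, IsPrimitiveElt α ∧ IskNormal 3 (3 * s) 1 F α := by
  have hr := facS_card2 (F := F) (s := s) (by omega)
  rw [hq] at hr
  by_cases h7 : 7 ≤ s
  · refine fam_gen 3 3 s _ Nat.prime_three (by omega) hn hq le_rfl ?_
    have h1 : 16 ^ (facS F s).card ≤ 4 ^ (s + 2) := by
      rw [show (16 : ℕ) = 4 ^ 2 by norm_num, ← pow_mul]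
      exact Nat.pow_le_pow_right (by norm_num) (by omega)
    obtain ⟨t, rfl⟩ := Nat.exists_eq_add_of_le h7
    have h3 : 4 ^ t ≤ 27 ^ t := Nat.pow_le_pow_left (by norm_num) _
    calc 16 ^ 6 * 16 ^ (facS F (7 + t)).card * 3 ^ 4 ≤ 16 ^ 6 * 4 ^ (7 + t + 2) * 3 ^ 4 := by gcongr
      _ = (16 ^ 6 * 4 ^ 9 * 3 ^ 4) * 4 ^ t := by ring
      _ ≤ (30030 * 27 ^ 7 * 2) * 27 ^ t := Nat.mul_le_mul (by norm_num) h3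
      _ = 30030 * (3 ^ 3) ^ (7 + t) * (3 - 1) := by norm_num; ring
      _ = _ := by rw [pow_mul]
  · obtain rfl | rfl : s = 4 ∨ s = 5 := by omega
    · refine crit2 3 3 4 265720 5 3 Nat.prime_three (by omega) hn hq (by norm_num) ?_ (by omega)
        (by norm_num)
      refine (omega_le 265720 73 (by norm_num) (by norm_num) {2, 5, 7, 13, 73} (by decide) ?_
        (by decide)).trans (by decide)
      intro p hp hpp hd
      interval_cases p <;> first | decide | (exfalso; revert hpp; norm_num; done) | (exfalso; omega)
    · refine crit2 3 3 5 7174453 7 3 Nat.prime_three (by omega) hn hq (by norm_num) ?_ (by omega)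
        (by norm_num)
      refine (omega_le 7174453 19 (by norm_num) (by norm_num) {2, 3, 5, 7, 11, 13, 17} (by decide) ?_
        (by decide)).trans (by decide)
      intro p hp hpp hd
      interval_cases p <;> first | decide | (exfalso; revert hpp; norm_num; done) | (exfalso; omega)

lemma fin2 {F K : Type*} [Field F] [Fintype F] [Field K] [Fintype K] [Algebra F K]
    (q s N c w r : ℕ) (B : Finset ℕ) [CharP F 2] (hs : 0 < s) (hn : Module.finrank F K = 2 * s)
    (hq : Fintype.card F = q) (hr : (facS F s).card ≤ r)
    (hN : q ^ (2 * s) - 1 = N * (q - 1)) (hN0 : N ≠ 0) (hc : 1 < c) (hB : ∀ b ∈ B, b ≤ c)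
    (hP : ∀ p < c, p.Prime → p ∣ N → p ∈ B) (hNB : N < c * ∏ b ∈ B, b) (hw : B.card = w)
    (hlt : ((2 ^ w - 1) * (2 ^ r * q - 1)) ^ 2 < q ^ (2 * s)) :
    ∃ α : K, IsPrimitiveElt α ∧ IskNormal q (2 * s) 1 F α :=
  crit2 2 q s N w r Nat.prime_two hs hn hq hN ((omega_le N c hN0 hc B hB hP hNB).trans hw.le) hr hlt

lemma case_2_2 {F K : Type*} [Field F] [Fintype F] [Field K] [Fintype K] [Algebra F K]
    (s : ℕ) [CharP F 2] (hs : 7 ≤ s) (hodd : s % 2 = 1) (hn : Module.finrank F K = 2 * s)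
    (hq : Fintype.card F = 2) :
    ∃ α : K, IsPrimitiveElt α ∧ IskNormal 2 (2 * s) 1 F α := by
  have hr := facS_card3 (F := F) (s := s) (by omega) hq
  by_cases h23 : 23 ≤ s
  · exact fam_two 2 s 1 _ (by norm_num) (by norm_num) (by omega) hn hq le_rfl (by omega)
  obtain rfl | rfl | rfl | rfl | rfl | rfl | rfl | rfl :
    s = 7 ∨ s = 9 ∨ s = 11 ∨ s = 13 ∨ s = 15 ∨ s = 17 ∨ s = 19 ∨ s = 21 := by omega
  · refine fin2 2 7 (2 ^ 14 - 1) 127 3 3 {3, 43, 127} (by omega) hn hq (by omega) (by norm_num)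
      (by norm_num) (by norm_num) (by decide) ?_ (by decide) (by decide) (by norm_num)
    intro p hp hpp hd
    interval_cases p <;> first | decide | (exfalso; revert hpp; norm_num; done) | (exfalso; omega)
  · refine fin2 2 9 (2 ^ 18 - 1) 73 4 4 {3, 7, 19, 73} (by omega) hn hq (by omega) (by norm_num)
      (by norm_num) (by norm_num) (by decide) ?_ (by decide) (by decide) (by norm_num)
    intro p hp hpp hd
    interval_cases p <;> first | decide | (exfalso; revert hpp; norm_num; done) | (exfalso; omega)
  · refine fin2 2 11 (2 ^ 22 - 1) 19 6 4 {3, 5, 7, 11, 13, 17} (by omega) hn hq (by omega)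
      (by norm_num)
      (by norm_num) (by norm_num) (by decide) ?_ (by decide) (by decide) (by norm_num)
    intro p hp hpp hd
    interval_cases p <;> first | decide | (exfalso; revert hpp; norm_num; done) | (exfalso; omega)
  · refine fin2 2 13 (2 ^ 26 - 1) 23 7 5 {3, 5, 7, 11, 13, 17, 19} (by omega) hn hq (by omega)
      (by norm_num)
      (by norm_num) (by norm_num) (by decide) ?_ (by decide) (by decide) (by norm_num)
    intro p hp hpp hd
    interval_cases p <;> first | decide | (exfalso; revert hpp; norm_num; done) | (exfalso; omega)
  · refine fin2 2 15 (2 ^ 30 - 1) 29 8 6 {3, 5, 7, 11, 13, 17, 19, 23} (by omega) hn hq (by omega)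
      (by norm_num)
      (by norm_num) (by norm_num) (by decide) ?_ (by decide) (by decide) (by norm_num)
    intro p hp hpp hd
    interval_cases p <;> first | decide | (exfalso; revert hpp; norm_num; done) | (exfalso; omega)
  · refine fin2 2 17 (2 ^ 34 - 1) 31 9 6 {3, 5, 7, 11, 13, 17, 19, 23, 29} (by omega) hn hq
      (by omega) (by norm_num)
      (by norm_num) (by norm_num) (by decide) ?_ (by decide) (by decide) (by norm_num)
    intro p hp hpp hd
    interval_cases p <;> first | decide | (exfalso; revert hpp; norm_num; done) | (exfalso; omega)
  · refine fin2 2 19 (2 ^ 38 - 1) 37 10 7 {3, 5, 7, 11, 13, 17, 19, 23, 29, 31} (by omega) hn hq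
      (by omega) (by norm_num)
      (by norm_num) (by norm_num) (by decide) ?_ (by decide) (by decide) (by norm_num)
    intro p hp hpp hd
    interval_cases p <;> first | decide | (exfalso; revert hpp; norm_num; done) | (exfalso; omega)
  · refine fin2 2 21 (2 ^ 42 - 1) 41 11 8 {3, 5, 7, 11, 13, 17, 19, 23, 29, 31, 37} (by omega) hn hq
      (by omega) (by norm_num)
      (by norm_num) (by norm_num) (by decide) ?_ (by decide) (by decide) (by norm_num)
    intro p hp hpp hd
    interval_cases p <;> first | decide | (exfalso; revert hpp; norm_num; done) | (exfalso; omega)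

lemma case_2_4 {F K : Type*} [Field F] [Fintype F] [Field K] [Fintype K] [Algebra F K]
    (s : ℕ) [CharP F 2] (hs : 5 ≤ s) (hodd : s % 2 = 1) (hn : Module.finrank F K = 2 * s)
    (hq : Fintype.card F = 4) :
    ∃ α : K, IsPrimitiveElt α ∧ IskNormal 4 (2 * s) 1 F α := by
  have hr := facS_card2 (F := F) (s := s) (by omega)
  rw [hq] at hr
  by_cases h11 : 11 ≤ s
  · exact fam_two 4 s 2 _ (by norm_num) (by norm_num) (by omega) hn hq le_rfl (by omega)
  obtain rfl | rfl | rfl : s = 5 ∨ s = 7 ∨ s = 9 := by omega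
  · refine fin2 4 5 349525 43 4 4 {5, 11, 31, 41} (by omega) hn hq (by omega) (by norm_num)
      (by norm_num) (by norm_num) (by decide) ?_ (by decide) (by decide) (by norm_num)
    intro p hp hpp hd
    interval_cases p <;> first | decide | (exfalso; revert hpp; norm_num; done) | (exfalso; omega)
  · refine fin2 4 7 ((4 ^ 14 - 1) / 3) 23 7 5 {3, 5, 7, 11, 13, 17, 19} (by omega) hn hq (by omega)
      (by norm_num)
      (by norm_num) (by norm_num) (by decide) ?_ (by decide) (by decide) (by norm_num)
    intro p hp hpp hd
    interval_cases p <;> first | decide | (exfalso; revert hpp; norm_num; done) | (exfalso; omega)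
  · refine fin2 4 9 ((4 ^ 18 - 1) / 3) 31 9 6 {3, 5, 7, 11, 13, 17, 19, 23, 29} (by omega) hn hq
      (by omega) (by norm_num)
      (by norm_num) (by norm_num) (by decide) ?_ (by decide) (by decide) (by norm_num)
    intro p hp hpp hd
    interval_cases p <;> first | decide | (exfalso; revert hpp; norm_num; done) | (exfalso; omega)

lemma case_2_8 {F K : Type*} [Field F] [Fintype F] [Field K] [Fintype K] [Algebra F K]
    (s : ℕ) [CharP F 2] (hs : 3 ≤ s) (hodd : s % 2 = 1) (hn : Module.finrank F K = 2 * s)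
    (hq : Fintype.card F = 8) :
    ∃ α : K, IsPrimitiveElt α ∧ IskNormal 8 (2 * s) 1 F α := by
  have hr := facS_card1 (F := F) (s := s) (by omega)
  by_cases h9 : 9 ≤ s
  · exact fam_two 8 s 3 _ (by norm_num) (by norm_num) (by omega) hn hq le_rfl (by omega)
  obtain rfl | rfl | rfl : s = 3 ∨ s = 5 ∨ s = 7 := by omega
  · refine fin2 8 3 37449 73 3 3 {3, 19, 73} (by omega) hn hq (by omega) (by norm_num)
      (by norm_num) (by norm_num) (by decide) ?_ (by decide) (by decide) (by norm_num)
    intro p hp hpp hd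
    interval_cases p <;> first | decide | (exfalso; revert hpp; norm_num; done) | (exfalso; omega)
  · refine fin2 8 5 153391689 31 7 5 {3, 11, 13, 17, 19, 23, 29} (by omega) hn hq (by omega)
      (by norm_num)
      (by norm_num) (by norm_num) (by decide) ?_ (by decide) (by decide) (by norm_num)
    intro p hp hpp hd
    interval_cases p <;> first | decide | (exfalso; revert hpp; norm_num; done) | (exfalso; omega)
  · refine fin2 8 7 ((8 ^ 14 - 1) / 7) 37 10 7 {3, 5, 7, 11, 13, 17, 19, 23, 29, 31} (by omega) hn hq
      (by omega) (by norm_num)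
      (by norm_num) (by norm_num) (by decide) ?_ (by decide) (by decide) (by norm_num)
    intro p hp hpp hd
    interval_cases p <;> first | decide | (exfalso; revert hpp; norm_num; done) | (exfalso; omega)

lemma case_2_big {F K : Type*} [Field F] [Fintype F] [Field K] [Fintype K] [Algebra F K]
    (q s e : ℕ) (he : 4 ≤ e) (hqe : q = 2 ^ e)
    [CharP F 2] (hs : 3 ≤ s) (hodd : s % 2 = 1) (hn : Module.finrank F K = 2 * s)
    (hq : Fintype.card F = q) :
    ∃ α : K, IsPrimitiveElt α ∧ IskNormal q (2 * s) 1 F α := by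
  have hr := facS_card1 (F := F) (s := s) (by omega)
  by_cases h5 : 5 ≤ s
  · refine fam_two q s e s (by omega) hqe (by omega) hn hq hr ?_
    obtain ⟨a, rfl⟩ := Nat.exists_eq_add_of_le he
    obtain ⟨b, rfl⟩ := Nat.exists_eq_add_of_le h5
    have : 4 + a - 1 = 3 + a := by omega
    rw [this]
    nlinarith [Nat.zero_le (a * b)]
  obtain rfl : s = 3 := by omega
  by_cases h7 : 7 ≤ e
  · exact fam_two q 3 e 3 (by omega) hqe (by omega) hn hq hr (by omega)
  obtain rfl | rfl | rfl : e = 4 ∨ e = 5 ∨ e = 6 := by omega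
  · norm_num at hqe
    subst hqe
    refine fin2 16 3 1118481 29 5 3 {3, 7, 13, 17, 29} (by omega) hn hq (by omega) (by norm_num)
      (by norm_num) (by norm_num) (by decide) ?_ (by decide) (by decide) (by norm_num)
    intro p hp hpp hd
    interval_cases p <;> first | decide | (exfalso; revert hpp; norm_num; done) | (exfalso; omega)
  · norm_num at hqe
    subst hqe
    refine fin2 32 3 34636833 23 7 3 {3, 5, 7, 11, 13, 17, 19} (by omega) hn hq (by omega)
      (by norm_num)
      (by norm_num) (by norm_num) (by decide) ?_ (by decide) (by decide) (by norm_num)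
    intro p hp hpp hd
    interval_cases p <;> first | decide | (exfalso; revert hpp; norm_num; done) | (exfalso; omega)
  · norm_num at hqe
    subst hqe
    refine fin2 64 3 ((2 ^ 36 - 1) / 63) 29 8 3 {3, 5, 7, 11, 13, 17, 19, 23} (by omega) hn hq
      (by omega) (by norm_num)
      (by norm_num) (by norm_num) (by decide) ?_ (by decide) (by decide) (by norm_num)
    intro p hp hpp hd
    interval_cases p <;> first | decide | (exfalso; revert hpp; norm_num; done) | (exfalso; omega)
end

/-- polynomials over `F₂` as bit lists -/
def bAdd : List Bool → List Bool → List Bool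
  | [], l => l
  | a :: k, [] => a :: k
  | a :: k, b :: l => (xor a b) :: bAdd k l

def bMulX (d : ℕ) (lo l : List Bool) : List Bool :=
  match (false :: l).drop d with
  | [t] => bAdd ((false :: l).take d) (if t then lo else [])
  | _ => false :: l

def bMul (d : ℕ) (lo : List Bool) : List Bool → List Bool → List Bool
  | [], _ => []
  | b :: l, y => bAdd (if b then y else []) (bMulX d lo (bMul d lo l y))

def bPow (d : ℕ) (lo x : List Bool) : ℕ → ℕ → List Bool
  | 0, _ => [true]
  | f + 1, k => if k = 0 then [true] else
      let r := bPow d lo x f (k / 2)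
      let r2 := bMul d lo r r
      if k % 2 = 1 then bMul d lo x r2 else r2

def bZero (l : List Bool) : Bool := l.all not

/-- `x * x^(2^d-2) = 1` -/
def bNz (d : ℕ) (lo x : List Bool) : Bool :=
  bZero (bAdd [true] (bMul d lo x (bPow d lo x 12 (2 ^ d - 2))))

noncomputable section

def bEv {R : Type*} [CommRing R] (a : R) : List Bool → R
  | [] => 0
  | b :: l => (if b then 1 else 0) + a * bEv a l

lemma bEv_add {R : Type*} [CommRing R] (h2 : (2 : R) = 0) (a : R)
    (k l : List Bool) : bEv a (bAdd k l) = bEv a k + bEv a l := by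
  induction k generalizing l with
  | nil => simp [bAdd, bEv]
  | cons x k ih =>
    cases l with
    | nil => simp [bAdd, bEv]
    | cons y l =>
      simp only [bAdd, bEv, ih]
      cases x <;> cases y <;> simp <;> first | (ring; done) | linear_combination (-1 : R) * h2

lemma bEv_take_drop {R : Type*} [CommRing R] (a : R) (d : ℕ) (l : List Bool) :
    bEv a l = bEv a (l.take d) + a ^ d * bEv a (l.drop d) := by
  induction d generalizing l with
  | zero => simp [bEv]
  | succ d ih =>
    cases l with
    | nil => simp [bEv]
    | cons x l =>
      simp only [List.take_succ_cons, List.drop_succ_cons, bEv]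
      rw [ih l]; ring

lemma bEv_mulX {R : Type*} [CommRing R] (h2 : (2 : R) = 0) (a : R) (d : ℕ)
    (lo : List Bool) (ha : a ^ d = bEv a lo) (l : List Bool) : bEv a (bMulX d lo l) = a * bEv a l := by
  have h0 : bEv a (false :: l) = a * bEv a l := by simp [bEv]
  unfold bMulX
  split
  · next t ht =>
    rw [bEv_add h2, ← h0, bEv_take_drop a d (false :: l), ht, ha]
    cases t <;> simp [bEv]
  · exact h0

lemma bEv_mul {R : Type*} [CommRing R] (h2 : (2 : R) = 0) (a : R) (d : ℕ)
    (lo : List Bool) (ha : a ^ d = bEv a lo) (k l : List Bool) : bEv a (bMul d lo k l) = bEv a k * bEv a l := by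
  induction k with
  | nil => simp [bMul, bEv]
  | cons x k ih =>
    simp only [bMul, bEv]
    rw [bEv_add h2, bEv_mulX h2 a d lo ha, ih]
    cases x <;> simp [bEv] <;> ring

lemma bEv_pow {R : Type*} [CommRing R] (h2 : (2 : R) = 0) (a : R) (d : ℕ)
    (lo : List Bool) (ha : a ^ d = bEv a lo) (x : List Bool) (f k : ℕ) (hk : k < 2 ^ f) :
    bEv a (bPow d lo x f k) = bEv a x ^ k := by
  induction f generalizing k with
  | zero =>
    obtain rfl : k = 0 := by simpa using hk
    simp [bPow, bEv]
  | succ f ih =>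
    have h1 := ih (k / 2) (by rw [pow_succ] at hk; omega)
    simp only [bPow]
    split_ifs with h h'
    · simp [bEv, h]
    · rw [bEv_mul h2 a d lo ha, bEv_mul h2 a d lo ha, h1, ← pow_add, ← pow_succ']
      congr 1; omega
    · rw [bEv_mul h2 a d lo ha, h1, ← pow_add]
      congr 1; omega

lemma bEv_zero {R : Type*} [CommRing R] (a : R) (l : List Bool) (hl : bZero l = true) : bEv a l = 0 := by
  induction l with
  | nil => rfl
  | cons x l ih =>
    simp only [bZero, List.all_cons, Bool.and_eq_true] at hl
    have := ih hl.2
    simp only [bEv, this]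
    cases x <;> simp at hl ⊢

lemma bEv_nz {R : Type*} [CommRing R] [Nontrivial R] (h2 : (2 : R) = 0) (a : R) (d : ℕ)
    (lo : List Bool) (ha : a ^ d = bEv a lo) (x : List Bool) (hd : d ≤ 12) (h : bNz d lo x = true) :
    bEv a x ≠ 0 := by
  have h1 := bEv_zero a _ h
  have hlt : 2 ^ d - 2 < 2 ^ 12 := by
    have := Nat.pow_le_pow_right (show 0 < 2 by norm_num) hd
    have := Nat.one_le_two_pow (n := d)
    omega
  rw [bEv_add h2, bEv_mul h2 a d lo ha, bEv_pow h2 a d lo ha _ _ _ hlt] at h1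
  intro h3
  rw [h3] at h1
  simp [bEv] at h1

lemma bEv_map {R R' : Type*} [CommRing R] [CommRing R'] (φ : R →+* R') (a : R) (l : List Bool) :
    φ (bEv a l) = bEv (φ a) l := by
  induction l with
  | nil => simp [bEv]
  | cons x l ih => cases x <;> simp [bEv, ih]

lemma bEv_degree {R : Type*} [CommRing R] (l : List Bool) :
    (bEv (X : R[X]) l).degree < l.length := by
  rw [degree_lt_iff_coeff_zero]
  induction l with
  | nil => simp [bEv]
  | cons x l ih =>
    intro m hm
    simp only [List.length_cons] at hm
    obtain ⟨m, rfl⟩ : ∃ k, m = k + 1 := ⟨m - 1, by omega⟩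
    have := ih m (by omega)
    cases x <;> simp [bEv, this, coeff_X_mul, coeff_one]

lemma exists_root_bits {K : Type*} [Field K] [Fintype K] (d : ℕ) (hd0 : 0 < d) (hd : d ≤ 12)
    (lo : List Bool) (hlo : lo.length ≤ d) (hK : Fintype.card K = 2 ^ d) [CharP K 2]
    (hchk : bZero (bAdd [false, true] (bPow d lo [false, true] 13 (2 ^ d))) = true) :
    ∃ a : K, a ^ d = bEv a lo := by
  let _ := ZMod.algebra K 2
  set m : (ZMod 2)[X] := X ^ d + bEv X lo with hm
  have hdeg : m.degree = d := by
    rw [hm, degree_add_eq_left_of_degree_lt, degree_X_pow]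
    rw [degree_X_pow]
    exact (bEv_degree lo).trans_le (by exact_mod_cast hlo)
  have h2P : (2 : (ZMod 2)[X]) = 0 := CharTwo.two_eq_zero
  have h2R : (2 : AdjoinRoot m) = 0 := by
    have := congrArg (AdjoinRoot.mk m) h2P
    rwa [map_zero, map_ofNat] at this
  have hroot : (AdjoinRoot.root m) ^ d = bEv (AdjoinRoot.root m) lo := by
    have h := AdjoinRoot.mk_self (f := m)
    rw [hm, map_add, map_pow, bEv_map, AdjoinRoot.mk_X, ← hm] at h
    linear_combination h - (bEv (AdjoinRoot.root m) lo) * h2R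
  have h1 := bEv_zero (AdjoinRoot.root m) _ hchk
  rw [bEv_add h2R, bEv_pow h2R _ d lo hroot _ _ _ (Nat.pow_lt_pow_right (by norm_num) (by omega))]
    at h1
  have hx : bEv (AdjoinRoot.root m) [false, true] = AdjoinRoot.root m := by simp [bEv]
  rw [hx] at h1
  have hdvd : m ∣ X ^ (2 ^ d) - X := by
    rw [← AdjoinRoot.mk_eq_zero, map_sub, map_pow, AdjoinRoot.mk_X]
    linear_combination h1 - (AdjoinRoot.root m) * h2R
  have hdvd' := Polynomial.map_dvd (algebraMap (ZMod 2) K) hdvd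
  rw [Polynomial.map_sub, Polynomial.map_pow, map_X] at hdvd'
  have hsp : Splits (X ^ (2 ^ d) - X : K[X]) := by
    rw [← hK, splits_iff_card_roots, FiniteField.roots_X_pow_card_sub_X,
      FiniteField.X_pow_card_sub_X_natDegree_eq K Fintype.one_lt_card]
    rfl
  have hsp' := hsp.of_dvd (FiniteField.X_pow_card_sub_X_ne_zero K (Nat.one_lt_two_pow hd0.ne')) hdvd'
  obtain ⟨a, ha⟩ := hsp'.exists_eval_eq_zero (by
    rw [degree_map, hdeg]; exact_mod_cast hd0.ne')
  refine ⟨a, ?_⟩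
  have h2K : (2 : K) = 0 := CharTwo.two_eq_zero
  rw [eval_map, hm, eval₂_add, eval₂_X_pow] at ha
  have := bEv_map (eval₂RingHom (algebraMap (ZMod 2) K) a) X lo
  rw [coe_eval₂RingHom, eval₂_X] at this
  rw [this] at ha
  linear_combination ha - (bEv a lo) * h2K

lemma prim_bits {K : Type*} [Field K] [Fintype K] (d : ℕ) (hd0 : 0 < d) (hd : d ≤ 12)
    (lo : List Bool) (hK : Fintype.card K = 2 ^ d) (h2 : (2 : K) = 0)
    (a : K) (ha : a ^ d = bEv a lo) (L : List ℕ) (hL : ∀ l, l.Prime → l ∣ 2 ^ d - 1 → l ∈ L)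
    (ha0 : a ≠ 0)
    (hnz : ∀ l ∈ L, bNz d lo (bAdd [true] (bPow d lo [false, true] 12 ((2 ^ d - 1) / l))) = true) :
    IsPrimitiveElt a := by
  classical
  have hx : bEv a [false, true] = a := by simp [bEv]
  have hone : (1 : ℕ) < 2 ^ d := Nat.one_lt_two_pow hd0.ne'
  refine isPrimitiveElt_of_orderOf (Units.mk0 a ha0) ?_
  rw [hK]
  refine orderOf_eq_of_pow_and_pow_div_prime (by omega) ?_ ?_
  · have := pow_card_eq_one' (x := Units.mk0 a ha0)
    rwa [Nat.card_eq_fintype_card, Fintype.card_units, hK] at this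
  · intro l hl hld h
    have h1 := bEv_nz h2 a d lo ha _ hd (hnz l (hL l hl hld))
    have hlt : (2 ^ d - 1) / l < 2 ^ 12 := by
      have := Nat.pow_le_pow_right (show 0 < 2 by norm_num) hd
      have := Nat.div_le_self (2 ^ d - 1) l
      omega
    rw [bEv_add h2, bEv_pow h2 a d lo ha _ _ _ hlt, hx] at h1
    have h3 := congrArg Units.val h
    simp only [Units.val_pow_eq_pow_val, Units.val_mk0, Units.val_one] at h3
    rw [h3] at h1
    apply h1
    simp [bEv]
    linear_combination h2
end

noncomputable section

lemma fac_dichotomy {F : Type*} [Field F] {s : ℕ} (hs : 0 < s) {f : F[X]} (hf : f ∈ facS F s) :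
    f = X - 1 ∨ f ∣ ∑ i ∈ Finset.range s, X ^ i := by
  obtain ⟨h1, h2, h3⟩ := (mem_facS hs).1 hf
  rw [← mul_geom_sum] at h3
  rcases h1.prime.dvd_or_dvd h3 with h | h
  · left
    have e : (X - 1 : F[X]) = X - C 1 := by simp
    refine eq_of_monic_of_associated h2 (by rw [e]; exact monic_X_sub_C 1)
      (h1.associated_of_dvd (by rw [e]; exact irreducible_X_sub_C 1) h)
  · exact Or.inr h

lemma exc_normal {F K : Type*} [Field F] [Fintype F] [Field K] [Fintype K] [Algebra F K]
    (q s : ℕ) [CharP F 2] (hs : 0 < s) (hn : Module.finrank F K = 2 * s)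
    (hq : Fintype.card F = q) (a : K) (ha : a ∈ kerP F K (polyG F 2 s))
    (ha' : ∀ f ∈ facS F s, ∀ h, polyG F 2 s = f * h → a ∉ kerP F K h) :
    IskNormal q (2 * s) 1 F a := by
  have hg := polyG_mul (F := F) (s := s) Nat.prime_two
  have h0 : (X ^ (2 * s) - 1 : F[X]) ≠ 0 := X_pow_sub_C_ne_zero (by omega) 1
  have hg0 : polyG F 2 s ≠ 0 := by intro h'; rw [h', zero_mul] at hg; exact h0 hg.symm
  rw [← hq]
  refine one_normal_of_order (2 * s) hn.symm (polyG F 2 s) hg0 ⟨_, hg.symm⟩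
    (polyG_deg Nat.prime_two hs) a ha ?_
  refine kerP_order _ hg0 (facS F s) (fun f hf => ((mem_facS hs).1 hf).1.ne_zero)
    (facS_cover Nat.prime_two hs) a ha fun f hf => ha' f hf _ ?_
  have hfg : f ∣ polyG F 2 s := by
    unfold polyG
    exact (((mem_facS hs).1 hf).2.2.trans (by simp)).mul_right _
  exact (EuclideanDomain.mul_div_cancel' ((mem_facS hs).1 hf).1.ne_zero hfg).symm

lemma polyG_two {F : Type*} [Field F] [CharP F 2] (s : ℕ) :
    polyG F 2 s = (X - 1) * ∑ i ∈ Finset.range s, X ^ (2 * i) := by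
  have : Fact (Nat.Prime 2) := ⟨Nat.prime_two⟩
  unfold polyG
  rw [← mul_geom_sum, show 2 - 1 = 1 from rfl, pow_one, mul_assoc, ← sq, sum_pow_char]
  congr 1
  refine Finset.sum_congr rfl fun i _ => ?_
  rw [← pow_mul, mul_comm]

lemma exc2 {F K : Type*} [Field F] [Fintype F] [Field K] [Fintype K] [Algebra F K]
    (s : ℕ) (hsp : s.Prime) [CharP F 2] (hn : Module.finrank F K = 2 * s)
    (hq : Fintype.card F = 2) (a : K)
    (ho : ∀ f : F[X], Irreducible f → f ∣ cyclotomic s F → f.natDegree = s - 1)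
    (htr : ∑ i ∈ Finset.range s, a ^ 2 ^ (2 * i) = 1)
    (hne : a ^ 2 ^ s ≠ a) : IskNormal 2 (2 * s) 1 F a := by
  have hv : aeval (frobT F K) (∑ i ∈ Finset.range s, X ^ (2 * i) : F[X]) a = 1 := by
    rw [map_sum, LinearMap.sum_apply, ← htr]
    refine Finset.sum_congr rfl fun i _ => ?_
    rw [map_pow, aeval_X, frobT_pow_apply, hq]
  have hX1 : (X - 1 : F[X]) ≠ 0 := by
    have e : (X - 1 : F[X]) = X - C 1 := by simp
    rw [e]; exact X_sub_C_ne_zero 1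
  refine exc_normal 2 s hsp.pos hn hq a ?_ ?_
  · rw [LinearMap.mem_ker, polyG_two, map_mul, Module.End.mul_apply, hv]
    have := frobT_pow_apply (F := F) (K := K) 1 1
    rw [pow_one, one_pow] at this
    simp [this]
  · intro f hf h hfh hah
    rw [LinearMap.mem_ker] at hah
    rcases fac_dichotomy hsp.pos hf with rfl | hfu
    · rw [polyG_two] at hfh
      rw [← mul_left_cancel₀ hX1 hfh, hv] at hah
      exact one_ne_zero hah
    · have : Fact s.Prime := ⟨hsp⟩
      obtain ⟨h1, h2, -⟩ := (mem_facS hsp.pos).1 hf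
      rw [← cyclotomic_prime] at hfu
      have hd := ho f h1 hfu
      have hfe : cyclotomic s F = f := by
        refine eq_of_monic_of_dvd_of_natDegree_le h2 (cyclotomic.monic s F) hfu ?_
        rw [natDegree_cyclotomic, Nat.totient_prime hsp, hd]
      unfold polyG at hfh
      rw [← cyclotomic_prime, hfe, mul_comm, show 2 - 1 = 1 from rfl, pow_one] at hfh
      rw [← mul_left_cancel₀ h1.ne_zero hfh] at hah
      apply hne
      rw [map_sub, map_pow, aeval_X, map_one, LinearMap.sub_apply, frobT_pow_apply, hq,
        sub_eq_zero] at hah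
      exact hah

lemma exc4 {F K : Type*} [Field F] [Fintype F] [Field K] [Fintype K] [Algebra F K]
    [CharP F 2] (hn : Module.finrank F K = 2 * 3)
    (hq : Fintype.card F = 4) (a : K)
    (htr : a ^ 4 ^ 5 + a ^ 4 ^ 4 + a ^ 4 ^ 3 + a ^ 4 ^ 2 + a ^ 4 + a = 0)
    (h1 : a ^ 4 ^ 4 + a ^ 4 ^ 2 + a ≠ 0)
    (h2 : a ^ 4 ^ 3 + a ≠ 0)
    (h3 : ((a ^ 4 ^ 3 + a) ^ 3) ^ 2 + (a ^ 4 ^ 3 + a) ^ 3 + 1 ≠ 0) :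
    IskNormal 4 (2 * 3) 1 F a := by
  have h20 : (2 : F[X]) = 0 := CharTwo.two_eq_zero
  have hX1 : (X - 1 : F[X]) ≠ 0 := by
    have e : (X - 1 : F[X]) = X - C 1 := by simp
    rw [e]; exact X_sub_C_ne_zero 1
  have hT : ∀ i, (frobT F K ^ i) a = a ^ 4 ^ i := fun i => by rw [frobT_pow_apply, hq]
  have hT1 : frobT F K a = a ^ 4 := by have := hT 1; rwa [pow_one, pow_one] at this
  refine exc_normal 4 3 (by norm_num) hn hq a ?_ ?_
  · have : polyG F 2 3 = X ^ 5 + X ^ 4 + X ^ 3 + X ^ 2 + X + 1 := by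
      rw [polyG_two]
      simp only [Finset.sum_range_succ, Finset.sum_range_zero]
      linear_combination (-(X ^ 4 + X ^ 2 + 1)) * h20
    rw [LinearMap.mem_ker, this]
    simp only [map_add, map_pow, aeval_X, map_one, LinearMap.add_apply, hT, hT1,
      Module.End.one_apply]
    exact htr
  · intro f hf h hfh hah
    rw [LinearMap.mem_ker] at hah
    rcases fac_dichotomy (by norm_num) hf with rfl | hfu
    · rw [polyG_two] at hfh
      rw [← mul_left_cancel₀ hX1 hfh] at hah
      simp only [Finset.sum_range_succ, Finset.sum_range_zero, map_add, map_pow, aeval_X, map_one,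
        LinearMap.add_apply, hT, map_zero, LinearMap.zero_apply] at hah
      apply h1
      norm_num at hah ⊢
      linear_combination hah
    · obtain ⟨hi, hm, hd⟩ := (mem_facS (by norm_num)).1 hf
      have hsp : Splits (X ^ 4 - X : F[X]) := by
        rw [← hq, splits_iff_card_roots, FiniteField.roots_X_pow_card_sub_X,
          FiniteField.X_pow_card_sub_X_natDegree_eq F Fintype.one_lt_card]
        rfl
      have hdeg := (hsp.of_dvd (FiniteField.X_pow_card_sub_X_ne_zero F (by norm_num))
        (hd.trans ⟨X, by ring⟩)).natDegree_eq_one_of_irreducible hi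
      obtain ⟨c, rfl⟩ : ∃ c, f = X + C c := ⟨_, hm.eq_X_add_C hdeg⟩
      have h2F : (2 : F) = 0 := CharTwo.two_eq_zero
      have hc : c ^ 2 + c + 1 = 0 := by
        obtain ⟨k, hk⟩ := hfu
        have := congrArg (eval (-c)) hk
        simp [Finset.sum_range_succ] at this
        linear_combination this + c * h2F
      have hcC : (C c : F[X]) ^ 2 + C c + 1 = 0 := by
        rw [← C_pow, ← C_add, ← C_1, ← C_add, hc, C_0]
      have hh : h = (X ^ 3 - 1) * (X + C (c + 1)) := by
        refine mul_left_cancel₀ hi.ne_zero (hfh.symm.trans ?_)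
        unfold polyG
        simp only [Finset.sum_range_succ, Finset.sum_range_zero, C_add, C_1]
        linear_combination (-(X ^ 3 - 1) * (C c * X)) * h20 + (-(X ^ 3 - 1)) * hcC +
          ((X ^ 3 - 1)) * h20
      have h2K : (2 : K) = 0 := by
        have := congrArg (algebraMap F K) h2F
        rwa [map_ofNat, map_zero] at this
      set b := a ^ 4 ^ 3 + a with hb
      have hTb : aeval (frobT F K) (X ^ 3 - 1 : F[X]) a = b := by
        simp only [map_sub, map_pow, aeval_X, map_one, LinearMap.sub_apply, hT,
          Module.End.one_apply]
        rw [hb]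
        linear_combination (-a) * h2K
      rw [hh, mul_comm, map_mul, Module.End.mul_apply, hTb] at hah
      have hTb2 : frobT F K b = b ^ 4 := by
        have := frobT_pow_apply (F := F) 1 b
        rwa [pow_one, pow_one, hq] at this
      simp only [map_add, aeval_X, aeval_C, LinearMap.add_apply, hTb2,
        Module.algebraMap_end_apply] at hah
      rw [Algebra.smul_def] at hah
      set w := algebraMap F K (c + 1) with hw
      have hw2 : w ^ 2 + w + 1 = 0 := by
        rw [hw, ← map_pow, ← map_add, ← map_one (algebraMap F K), ← map_add]
        have : (c + 1) ^ 2 + (c + 1) + 1 = 0 := by linear_combination hc + (c + 1) * h2F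
        rw [this, map_zero]
      have hbw : b ^ 3 = w := by
        refine mul_left_cancel₀ h2 ?_
        have hwc : w = algebraMap F K c + 1 := by rw [hw, map_add, map_one]
        rw [one_smul] at hah
        rw [hwc]
        linear_combination hah - (b * (algebraMap F K c + 1)) * h2K
      apply h3
      rw [hbw, hw2]
end

noncomputable section

lemma exc_2_3 {F K : Type*} [Field F] [Fintype F] [Field K] [Fintype K] [Algebra F K]
    [CharP F 2] [CharP K 2] (hn : Module.finrank F K = 2 * 3) (hq : Fintype.card F = 2) :
    ∃ α : K, IsPrimitiveElt α ∧ IskNormal 2 (2 * 3) 1 F α := by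
  have hK : Fintype.card K = 2 ^ 6 := by
    rw [Module.card_eq_pow_finrank (K := F), hq, hn]
  have h2 : (2 : K) = 0 := CharTwo.two_eq_zero
  obtain ⟨a, ha⟩ := exists_root_bits (K := K) 6 (by norm_num) (by norm_num) [true, true]
    (by decide) hK (by decide +kernel)
  have hx : bEv a [false, true] = a := by simp [bEv]
  have hpw := fun k hk => bEv_pow h2 a 6 [true, true] ha [false, true] 13 k hk
  rw [hx] at hpw
  have ha0 : a ≠ 0 := by
    rw [← hx]; exact bEv_nz h2 a 6 [true, true] ha _ (by norm_num) (by decide +kernel)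
  refine ⟨a, prim_bits 6 (by norm_num) (by norm_num) [true, true] hK h2 a ha [3, 7] ?_ ha0
    (by decide +kernel), exc2 3 Nat.prime_three hn hq a ?_ ?_ ?_⟩
  · intro l hl hd
    have : l ∣ 3 ^ 2 * 7 := by norm_num at hd ⊢; exact hd
    rcases (Nat.Prime.dvd_mul hl).1 this with h | h
    · have := (Nat.prime_dvd_prime_iff_eq hl Nat.prime_three).1 (hl.dvd_of_dvd_pow h)
      simp [this]
    · have := (Nat.prime_dvd_prime_iff_eq hl (by norm_num)).1 h
      simp [this]
  · intro f hf hfd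
    have : Fact (Nat.Prime 2) := ⟨Nat.prime_two⟩
    rw [natDegree_of_dvd_cyclotomic_of_irreducible (p := 2) (f := 1) hq (by decide) hfd hf]
    refine orderOf_eq_prime (p := 2) ?_ ?_ <;> decide
  · have h := bEv_zero a (bAdd [true] (bAdd (bPow 6 [true, true] [false, true] 13 (2 ^ (2 * 0)))
      (bAdd (bPow 6 [true, true] [false, true] 13 (2 ^ (2 * 1)))
      (bPow 6 [true, true] [false, true] 13 (2 ^ (2 * 2)))))) (by decide +kernel)
    simp only [bEv_add h2] at h
    rw [hpw _ (by norm_num), hpw _ (by norm_num), hpw _ (by norm_num)] at h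
    simp only [Finset.sum_range_succ, Finset.sum_range_zero]
    simp only [bEv, if_true] at h
    linear_combination h - h2
  · have h := bEv_nz h2 a 6 [true, true] ha
      (bAdd [false, true] (bPow 6 [true, true] [false, true] 13 (2 ^ 3))) (by norm_num)
      (by decide +kernel)
    rw [bEv_add h2, hpw _ (by norm_num), hx] at h
    intro h'
    rw [h'] at h
    exact h (by linear_combination a * h2)

lemma exc_2_5 {F K : Type*} [Field F] [Fintype F] [Field K] [Fintype K] [Algebra F K]
    [CharP F 2] [CharP K 2] (hn : Module.finrank F K = 2 * 5) (hq : Fintype.card F = 2) :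
    ∃ α : K, IsPrimitiveElt α ∧ IskNormal 2 (2 * 5) 1 F α := by
  have hK : Fintype.card K = 2 ^ 10 := by
    rw [Module.card_eq_pow_finrank (K := F), hq, hn]
  have h2 : (2 : K) = 0 := CharTwo.two_eq_zero
  obtain ⟨lo, hlo⟩ : ∃ lo, lo = [true, false, false, true] := ⟨_, rfl⟩
  obtain ⟨a, ha⟩ := exists_root_bits (K := K) 10 (by norm_num) (by norm_num) lo
    (by subst hlo; decide) hK (by subst hlo; decide +kernel)
  have hx : bEv a [false, true] = a := by simp [bEv]
  have hpw := fun k hk => bEv_pow h2 a 10 lo ha [false, true] 13 k hk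
  rw [hx] at hpw
  have ha0 : a ≠ 0 := by
    rw [← hx]; exact bEv_nz h2 a 10 lo ha _ (by norm_num) (by subst hlo; decide +kernel)
  refine ⟨a, prim_bits 10 (by norm_num) (by norm_num) lo hK h2 a ha [3, 11, 31] ?_ ha0
    (by subst hlo; decide +kernel), exc2 5 Nat.prime_five hn hq a ?_ ?_ ?_⟩
  · intro l hl hd
    have : l ∣ 3 * 11 * 31 := by norm_num at hd ⊢; exact hd
    rcases (Nat.Prime.dvd_mul hl).1 this with h | h
    · rcases (Nat.Prime.dvd_mul hl).1 h with h | h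
      · have := (Nat.prime_dvd_prime_iff_eq hl Nat.prime_three).1 h
        simp [this]
      · have := (Nat.prime_dvd_prime_iff_eq hl (by norm_num)).1 h
        simp [this]
    · have := (Nat.prime_dvd_prime_iff_eq hl (by norm_num)).1 h
      simp [this]
  · intro f hf hfd
    have : Fact (Nat.Prime 2) := ⟨Nat.prime_two⟩
    rw [natDegree_of_dvd_cyclotomic_of_irreducible (p := 2) (f := 1) hq (by decide) hfd hf]
    refine orderOf_eq_prime_pow (p := 2) (n := 1) ?_ ?_ <;> decide
  · have h := bEv_zero a (bAdd [true] (bAdd (bPow 10 lo [false, true] 13 (2 ^ (2 * 0)))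
      (bAdd (bPow 10 lo [false, true] 13 (2 ^ (2 * 1)))
      (bAdd (bPow 10 lo [false, true] 13 (2 ^ (2 * 2)))
      (bAdd (bPow 10 lo [false, true] 13 (2 ^ (2 * 3)))
      (bPow 10 lo [false, true] 13 (2 ^ (2 * 4)))))))) (by subst hlo; decide +kernel)
    simp only [bEv_add h2] at h
    rw [hpw _ (by norm_num), hpw _ (by norm_num), hpw _ (by norm_num), hpw _ (by norm_num),
      hpw _ (by norm_num)] at h
    simp only [Finset.sum_range_succ, Finset.sum_range_zero]
    simp only [bEv, if_true] at h
    linear_combination h - h2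
  · have h := bEv_nz h2 a 10 lo ha
      (bAdd [false, true] (bPow 10 lo [false, true] 13 (2 ^ 5))) (by norm_num)
      (by subst hlo; decide +kernel)
    rw [bEv_add h2, hpw _ (by norm_num), hx] at h
    intro h'
    rw [h'] at h
    exact h (by linear_combination a * h2)

lemma exc_4_3 {F K : Type*} [Field F] [Fintype F] [Field K] [Fintype K] [Algebra F K]
    [CharP F 2] [CharP K 2] (hn : Module.finrank F K = 2 * 3) (hq : Fintype.card F = 4) :
    ∃ α : K, IsPrimitiveElt α ∧ IskNormal 4 (2 * 3) 1 F α := by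
  have hK : Fintype.card K = 2 ^ 12 := by
    rw [Module.card_eq_pow_finrank (K := F), hq, hn]; norm_num
  have h2 : (2 : K) = 0 := CharTwo.two_eq_zero
  obtain ⟨lo, hlo⟩ : ∃ lo, lo = [true, true, false, false, true, false, true] := ⟨_, rfl⟩
  obtain ⟨a, ha⟩ := exists_root_bits (K := K) 12 (by norm_num) (by norm_num) lo
    (by subst hlo; decide) hK (by subst hlo; decide +kernel)
  have hx : bEv a [false, true] = a := by simp [bEv]
  have hpw := fun k hk => bEv_pow h2 a 12 lo ha [false, true] 13 k hk
  rw [hx] at hpw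
  have ha0 : a ≠ 0 := by
    rw [← hx]; exact bEv_nz h2 a 12 lo ha _ (by norm_num) (by subst hlo; decide +kernel)
  have hb : bEv a (bAdd (bPow 12 lo [false, true] 13 (4 ^ 3)) [false, true]) = a ^ 4 ^ 3 + a := by
    rw [bEv_add h2, hpw _ (by norm_num), hx]
  refine ⟨a, prim_bits 12 (by norm_num) (by norm_num) lo hK h2 a ha [3, 5, 7, 13] ?_ ha0
    (by subst hlo; decide +kernel), exc4 hn hq a ?_ ?_ ?_ ?_⟩
  · intro l hl hd
    have : l ∣ 3 ^ 2 * 5 * 7 * 13 := by norm_num at hd ⊢; exact hd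
    rcases (Nat.Prime.dvd_mul hl).1 this with h | h
    · rcases (Nat.Prime.dvd_mul hl).1 h with h | h
      · rcases (Nat.Prime.dvd_mul hl).1 h with h | h
        · have := (Nat.prime_dvd_prime_iff_eq hl Nat.prime_three).1 (hl.dvd_of_dvd_pow h)
          simp [this]
        · have := (Nat.prime_dvd_prime_iff_eq hl (by norm_num)).1 h
          simp [this]
      · have := (Nat.prime_dvd_prime_iff_eq hl (by norm_num)).1 h
        simp [this]
    · have := (Nat.prime_dvd_prime_iff_eq hl (by norm_num)).1 h
      simp [this]
  · have h := bEv_zero a (bAdd (bPow 12 lo [false, true] 13 (4 ^ 5))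
      (bAdd (bPow 12 lo [false, true] 13 (4 ^ 4))
      (bAdd (bPow 12 lo [false, true] 13 (4 ^ 3))
      (bAdd (bPow 12 lo [false, true] 13 (4 ^ 2))
      (bAdd (bPow 12 lo [false, true] 13 4) [false, true]))))) (by subst hlo; decide +kernel)
    simp only [bEv_add h2] at h
    rw [hpw _ (by norm_num), hpw _ (by norm_num), hpw _ (by norm_num), hpw _ (by norm_num),
      hpw _ (by norm_num), hx] at h
    linear_combination h
  · have h := bEv_nz h2 a 12 lo ha (bAdd (bPow 12 lo [false, true] 13 (4 ^ 4))
      (bAdd (bPow 12 lo [false, true] 13 (4 ^ 2)) [false, true])) (by norm_num)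
      (by subst hlo; decide +kernel)
    simp only [bEv_add h2] at h
    rw [hpw _ (by norm_num), hpw _ (by norm_num), hx, ← add_assoc] at h
    exact h
  · rw [← hb]
    exact bEv_nz h2 a 12 lo ha _ (by norm_num) (by subst hlo; decide +kernel)
  · have h := bEv_nz h2 a 12 lo ha (bAdd (bPow 12 lo
      (bAdd (bPow 12 lo [false, true] 13 (4 ^ 3)) [false, true]) 13 6) (bAdd (bPow 12 lo
      (bAdd (bPow 12 lo [false, true] 13 (4 ^ 3)) [false, true]) 13 3) [true])) (by norm_num)
      (by subst hlo; decide +kernel)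
    rw [bEv_add h2, bEv_add h2 a (bPow _ _ _ _ 3), bEv_pow h2 a 12 lo ha _ 13 6 (by norm_num),
      bEv_pow h2 a 12 lo ha _ 13 3 (by norm_num), hb] at h
    intro h'
    apply h
    simp only [bEv, if_true]
    linear_combination h'

end

/-- For `n = ps` with `s ≥ 3` and `gcd(p, s) = 1`, there is a primitive `1`-normal element
of `F_{qⁿ}` over `F_q`. -/
theorem stmt_15 (p e q s : ℕ) (hp : p.Prime) (he : 0 < e) (hq : q = p ^ e)
    (hs : 3 ≤ s) (hps : Nat.gcd p s = 1)
    (F K : Type) [Field F] [Fintype F] [Field K] [Fintype K] [Algebra F K]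
    (hcF : Fintype.card F = q) (hrK : Module.finrank F K = p * s) :
    ∃ α : K, IsPrimitiveElt α ∧ IskNormal q (p * s) 1 F α := by
  have hfp : Fact p.Prime := ⟨hp⟩
  have hchF : CharP F p := charP_of_card_eq_prime_pow (hcF.trans hq)
  have hchK : CharP K p := charP_of_injective_algebraMap (algebraMap F K).injective p
  have hpq : p ≤ q := by rw [hq]; exact Nat.le_self_pow he.ne' p
  by_cases h5 : 5 ≤ p
  · exact case_ge5 p q s hp hs hrK hcF h5 hpq
  have hp2 := hp.two_le
  obtain rfl | rfl | rfl : p = 2 ∨ p = 3 ∨ p = 4 := by omega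
  · have hodd : s % 2 = 1 := by
      by_contra h
      have : 2 ∣ Nat.gcd 2 s := Nat.dvd_gcd dvd_rfl (by omega)
      omega
    by_cases he4 : 4 ≤ e
    · exact case_2_big q s e he4 hq hs hodd hrK hcF
    obtain rfl | rfl | rfl : e = 1 ∨ e = 2 ∨ e = 3 := by omega
    · obtain rfl : q = 2 := by simpa using hq
      by_cases h7 : 7 ≤ s
      · exact case_2_2 s h7 hodd hrK hcF
      obtain rfl | rfl : s = 3 ∨ s = 5 := by omega
      · exact exc_2_3 hrK hcF
      · exact exc_2_5 hrK hcF
    · obtain rfl : q = 4 := by simpa using hq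
      by_cases h7 : 5 ≤ s
      · exact case_2_4 s h7 hodd hrK hcF
      obtain rfl : s = 3 := by omega
      exact exc_4_3 hrK hcF
    · obtain rfl : q = 8 := by simpa using hq
      exact case_2_8 s hs hodd hrK hcF
  · have h3 : s % 3 ≠ 0 := by
      intro h
      have : 3 ∣ Nat.gcd 3 s := Nat.dvd_gcd dvd_rfl (by omega)
      omega
    by_cases he2 : 2 ≤ e
    · refine case_3a q s (by omega) hrK hcF ?_
      rw [hq]
      exact (by norm_num : 9 ≤ 3 ^ 2).trans (Nat.pow_le_pow_right (by norm_num) he2)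
    · obtain rfl : e = 1 := by omega
      obtain rfl : q = 3 := by simpa using hq
      exact case_3b s (by omega) (by omega) hrK hcF
  · exact absurd hp (by norm_num)

end
end
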